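/- Let g be a root-reductive Lie algebra with splitting maximal toral subalgebra h and Dynkin Borel subalgebra b ⊇ h. Let M be an object of the extended category O-bar and λ, ν ∈ h* with λ ≼ ν. Then there exist a finite filtration 0 = M_0 ⊆ M_1 ⊆ ⋯ ⊆ M_{k−1} ⊆ M_k = M by g-submodules and a subset J ⊆ {1,…,k} such that: (i) if j ∈ J, then M_j/M_{j−1} ≅ L(ξ(j)) for some ξ(j) ∈ h* with λ ≼ ξ(j) ≼ ν; (ii) if j ∉ J, then either (M_j/M_{j−1})^μ = 0 for every μ ∈ h* with λ ≼ μ ≼ ν, or M_j/M_{j−1} ≅ L(ξ(j)) for some ξ(j) ≻ λ with ξ(j) ⋠ ν. -/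

import Mathlib

noncomputable section
namespace Paper

variable (K : Type) [Field K] [IsAlgClosed K] [CharZero K]
variable (g : Type) [LieRing g] [LieAlgebra K g]

def adWeightSpace (h : LieSubalgebra K g) (α : Module.Dual K h) : Submodule K g where
  carrier := {x | ∀ H : h, ⁅(H : g), x⁆ = α H • x}
  add_mem' := by intro a b ha hb H; rw [lie_add, ha H, hb H, smul_add]
  zero_mem' := by intro H; rw [lie_zero, smul_zero]
  smul_mem' := by intro c x hx H; rw [lie_smul, hx H, smul_comm]

def IsRootOf (h : LieSubalgebra K g) (α : Module.Dual K h) : Prop :=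
  α ≠ 0 ∧ adWeightSpace K g h α ≠ ⊥

def IsToralIn (s t : LieSubalgebra K g) : Prop :=
  t ≤ s ∧ IsLieAbelian t ∧
    s.toSubmodule ≤ ⨆ α : Module.Dual K t, s.toSubmodule ⊓ adWeightSpace K g t α

def IsMaxToralIn (s t : LieSubalgebra K g) : Prop :=
  IsToralIn K g s t ∧ ∀ t' : LieSubalgebra K g, IsToralIn K g s t' → t ≤ t' → t' = t

/-- A root-reductive Lie algebra `g` together with a splitting maximal toral subalgebra `h`
and a splitting Borel subalgebra `b ⊇ h` determined by a set `pos` of positive roots. -/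
structure Setup where
  /-- the exhausting chain of finite-dimensional reductive subalgebras -/
  F : ℕ → LieSubalgebra K g
  F_mono : Monotone F
  F_exhaust : ∀ x : g, ∃ n, x ∈ F n
  F_findim : ∀ n, FiniteDimensional K (F n)
  /-- each `F n` is reductive: every abelian ideal is central -/
  F_reductive : ∀ n, ∀ I : LieIdeal K (F n), IsLieAbelian I → I ≤ LieAlgebra.center K (F n)
  /-- the nested chain of Cartan subalgebras witnessing the root inclusions -/
  C : ℕ → LieSubalgebra K g
  C_mono : Monotone C
  C_le : ∀ n, C n ≤ F n
  C_cartan : ∀ n, (LieSubalgebra.comap (F n).incl (C n)).IsCartanSubalgebra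
  /-- each inclusion `F n ↪ F (n+1)` is a root inclusion with respect to `C (n+1)`:
  every root space of `F n` relative to `C n` is a root space of `F (n+1)` -/
  C_rootIncl : ∀ n, ∀ α : Module.Dual K (C n), α ≠ 0 →
    (F n).toSubmodule ⊓ adWeightSpace K g (C n) α ≠ ⊥ →
    ∃ β : Module.Dual K (C (n + 1)),
      (F n).toSubmodule ⊓ adWeightSpace K g (C n) α
        = (F (n + 1)).toSubmodule ⊓ adWeightSpace K g (C (n + 1)) β
  /-- the splitting maximal toral subalgebra -/
  h : LieSubalgebra K g
  h_maxToral : ∀ n, IsMaxToralIn K g (F n) (h ⊓ F n)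
  /-- `g` is the direct sum of its `h`-weight spaces -/
  h_indep : iSupIndep fun α : Module.Dual K h => adWeightSpace K g h α
  h_span : (⨆ α : Module.Dual K h, adWeightSpace K g h α) = ⊤
  /-- the set `Δ⁺` of positive roots -/
  pos : Set (Module.Dual K h)
  pos_root : ∀ α ∈ pos, IsRootOf K g h α
  pos_add : ∀ α ∈ pos, ∀ β ∈ pos, IsRootOf K g h (α + β) → α + β ∈ pos
  pos_polar : ∀ α : Module.Dual K h, IsRootOf K g h α → (α ∈ pos ↔ ¬(-α ∈ pos))
  neg_add : ∀ α β : Module.Dual K h, IsRootOf K g h α → IsRootOf K g h β →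
    α ∉ pos → β ∉ pos → IsRootOf K g h (α + β) → α + β ∉ pos
  /-- the splitting Borel subalgebra -/
  b : LieSubalgebra K g
  b_eq : b.toSubmodule = h.toSubmodule ⊔ ⨆ α ∈ pos, adWeightSpace K g h α


variable {K g}

namespace Setup

variable (S : Setup K g)

/-- `h ∩ g_n`. -/
def hn (n : ℕ) : LieSubalgebra K g := S.h ⊓ S.F n

/-- restriction of a functional on `h` to `h ∩ g_n`. -/
def resDual (n : ℕ) (lam : Module.Dual K S.h) : Module.Dual K (S.hn n) :=
  lam.comp (LieSubalgebra.inclusion (inf_le_left : S.hn n ≤ S.h)).toLinearMap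

/-- the `α`-root space of `g_n` relative to `h ∩ g_n`. -/
def rootSpaceN (n : ℕ) (α : Module.Dual K (S.hn n)) : Submodule K g :=
  (S.F n).toSubmodule ⊓ adWeightSpace K g (S.hn n) α

/-- the set of `b`-positive roots of `g_n`. -/
def posRootsN (n : ℕ) : Set (Module.Dual K (S.hn n)) :=
  {α | α ≠ 0 ∧ S.rootSpaceN n α ≠ ⊥ ∧ S.rootSpaceN n α ≤ S.b.toSubmodule}

/-- `ρ_n`, the half sum of the positive roots of `g_n` with respect to `b ∩ g_n`. -/
def rhoN (n : ℕ) : Module.Dual K (S.hn n) :=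
  (2 : K)⁻¹ • ∑ᶠ α ∈ S.posRootsN n, α

/-- `α` is a simple `b`-positive root: it is positive and cannot be written as a sum of
two or more positive roots. -/
def IsSimpleRoot (α : Module.Dual K S.h) : Prop :=
  α ∈ S.pos ∧ ¬∃ s : Multiset (Module.Dual K S.h),
    2 ≤ Multiset.card s ∧ (∀ β ∈ s, β ∈ S.pos) ∧ s.sum = α

/-- `b` is a Dynkin Borel subalgebra: it is generated, as a Lie subalgebra, by `h` together
with the simple root spaces. -/
def IsDynkin : Prop :=
  S.b = LieSubalgebra.lieSpan K g
    ((S.h : Set g) ∪ ⋃ α ∈ {α | S.IsSimpleRoot α}, (adWeightSpace K g S.h α : Set g))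

/-- the partial order `≼` on `h^*`: `lam ≼ mu` iff `mu - lam` is a `ℤ≥0`-linear combination
of positive roots. -/
def wle (lam mu : Module.Dual K S.h) : Prop :=
  ∃ s : Multiset (Module.Dual K S.h), (∀ β ∈ s, β ∈ S.pos) ∧ mu - lam = s.sum

/-- `g` is locally semisimple: each `g_n` is a semisimple Lie algebra. -/
def IsLocallySemisimple : Prop := ∀ n, LieAlgebra.IsSemisimple K (S.F n)

end Setup


/-- the universal enveloping algebra of `g`. -/
abbrev Env (K g : Type) [Field K] [LieRing g] [LieAlgebra K g] : Type :=
  UniversalEnvelopingAlgebra K g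

namespace Setup

variable {K : Type} [Field K] [IsAlgClosed K] [CharZero K]
variable {g : Type} [LieRing g] [LieAlgebra K g]
variable (S : Setup K g)

/-- the nilpotent radical `n⁺ = ⨁_{α ∈ Δ⁺} g^α` of `b`, as a subspace of `g`. -/
def nplus : Submodule K g := ⨆ α ∈ S.pos, adWeightSpace K g S.h α

/-- the left ideal of `U(g)` generated by `n⁺` and the elements `H - lam(H)`, `H ∈ h`. -/
def vermaIdeal (lam : Module.Dual K S.h) : Submodule (Env K g) (Env K g) :=
  Submodule.span (Env K g)
    ((UniversalEnvelopingAlgebra.ι K '' (S.nplus : Set g)) ∪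
      Set.range fun H : S.h =>
        UniversalEnvelopingAlgebra.ι K (H : g) - algebraMap K (Env K g) (lam H))

/-- the Verma module `M(lam) = U(g)/I`. -/
abbrev Verma (lam : Module.Dual K S.h) : Type := Env K g ⧸ S.vermaIdeal lam

/-- the maximal proper submodule of the Verma module `M(lam)`,
i.e. the sum of all proper submodules. -/
def maxSub (lam : Module.Dual K S.h) : Submodule (Env K g) (S.Verma lam) :=
  sSup {N : Submodule (Env K g) (S.Verma lam) | N ≠ ⊤}

/-- the simple module `L(lam)`, the unique simple quotient of `M(lam)`. -/
abbrev SimpleL (lam : Module.Dual K S.h) : Type := S.Verma lam ⧸ S.maxSub lam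

/-- `H` is the coroot `h_α` of the root `α`:  `α(H) = 2` and `H ∈ [g^α, g^{-α}]`. -/
def IsCoroot (α : Module.Dual K S.h) (H : S.h) : Prop :=
  α H = 2 ∧ ∃ x ∈ adWeightSpace K g S.h α, ∃ y ∈ adWeightSpace K g S.h (-α),
    (H : g) = ⁅x, y⁆

/-- the dot-reflection `s_α · mu = mu - (mu + ρ)(h_α) α` associated to a root `α`
with coroot `Hα`, relative to the half sum `ρ` of positive roots. -/
def dotReflect (ρ α : Module.Dual K S.h) (Hα : S.h) (mu : Module.Dual K S.h) :
    Module.Dual K S.h :=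
  mu - ((mu + ρ) Hα) • α

/-- `ρ` is the global half sum of positive roots: its restriction to each `h ∩ g_n`
is the half sum `ρ_n` of positive roots of `g_n`. -/
def IsGlobalRho (ρ : Module.Dual K S.h) : Prop := ∀ n : ℕ, S.resDual n ρ = S.rhoN n

/-- `lam` is strongly linked to `mu` (relative to `ρ`). -/
inductive StronglyLinked (ρ : Module.Dual K S.h) :
    Module.Dual K S.h → Module.Dual K S.h → Prop
  | refl (mu : Module.Dual K S.h) : StronglyLinked ρ mu mu
  | step {lam mu : Module.Dual K S.h} (α : Module.Dual K S.h) (Hα : S.h) :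
      α ∈ S.pos → S.IsCoroot α Hα →
      S.wle (S.dotReflect ρ α Hα mu) mu →
      StronglyLinked ρ lam (S.dotReflect ρ α Hα mu) →
      StronglyLinked ρ lam mu

/-- `lam` is antidominant: `(lam + ρ)(h_α)` is not a positive integer
for any positive root `α`. -/
def IsAntidominant (ρ lam : Module.Dual K S.h) : Prop :=
  ∀ α ∈ S.pos, ∀ Hα : S.h, S.IsCoroot α Hα → ¬∃ k : ℕ, 0 < k ∧ (lam + ρ) Hα = (k : K)

/-- `lam` is almost antidominant: `(lam + ρ)(h_α)` is a positive integer
for only finitely many positive roots `α`. -/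
def IsAlmostAntidominant (ρ lam : Module.Dual K S.h) : Prop :=
  {α | α ∈ S.pos ∧ ∃ Hα : S.h, S.IsCoroot α Hα ∧
    ∃ k : ℕ, 0 < k ∧ (lam + ρ) Hα = (k : K)}.Finite

end Setup

namespace Setup

variable {K : Type} [Field K] [IsAlgClosed K] [CharZero K]
variable {g : Type} [LieRing g] [LieAlgebra K g]
variable (S : Setup K g)

/-- the reflection `s_α : mu ↦ mu - mu(h_α) α`, as a linear map on `h^*`. -/
def reflectionMap (α : Module.Dual K S.h) (Hα : S.h) :
    Module.Dual K S.h →ₗ[K] Module.Dual K S.h where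
  toFun mu := mu - mu Hα • α
  map_add' mu ν := by
    simp only [LinearMap.add_apply, add_smul]
    abel
  map_smul' c mu := by
    simp only [LinearMap.smul_apply, RingHom.id_apply, smul_sub, smul_smul, smul_eq_mul]

/-- the reflection `s_α` associated to a root `α` with coroot `Hα`,
as a linear automorphism of `h^*`. -/
def reflection (α : Module.Dual K S.h) (Hα : S.h) (h2 : α Hα = 2) :
    Module.Dual K S.h ≃ₗ[K] Module.Dual K S.h :=
  LinearEquiv.ofInvolutive (S.reflectionMap α Hα) (by
    intro mu
    show S.reflectionMap α Hα (mu - mu Hα • α) = mu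
    show (mu - mu Hα • α) - ((mu - mu Hα • α) Hα) • α = mu
    rw [LinearMap.sub_apply, LinearMap.smul_apply, h2, smul_eq_mul]
    module)

/-- the Weyl group of `g`, realized as the group of linear automorphisms of `h^*`
generated by the reflections in the roots. -/
def weylGroup : Subgroup (Module.Dual K S.h ≃ₗ[K] Module.Dual K S.h) :=
  Subgroup.closure
    {w | ∃ (α : Module.Dual K S.h) (Hα : S.h) (hc : S.IsCoroot α Hα),
      IsRootOf K g S.h α ∧ w = S.reflection α Hα hc.1}

/-- the dot action `w · mu = w(mu + ρ) - ρ`. -/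
def dotAct (ρ : Module.Dual K S.h) (w : Module.Dual K S.h ≃ₗ[K] Module.Dual K S.h)
    (mu : Module.Dual K S.h) : Module.Dual K S.h :=
  w (mu + ρ) - ρ

/-- the root lattice `Λ`, the `ℤ`-span of the roots in `h^*`. -/
def rootLattice : Submodule ℤ (Module.Dual K S.h) :=
  Submodule.span ℤ {α : Module.Dual K S.h | IsRootOf K g S.h α}

end Setup

variable {K : Type} [Field K] [IsAlgClosed K] [CharZero K]
variable {g : Type} [LieRing g] [LieAlgebra K g]

lemma env_smul_comm {M : Type} [AddCommGroup M] [Module K M] [Module (Env K g) M]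
    [IsScalarTower K (Env K g) M] (c : K) (r : Env K g) (m : M) :
    r • (c • m) = c • (r • m) := by
  rw [← algebraMap_smul (Env K g) c m, ← mul_smul, ← Algebra.commutes, mul_smul,
    algebraMap_smul]

namespace Setup

variable (S : Setup K g)

section Modules

variable (M : Type) [AddCommGroup M] [Module K M] [Module (Env K g) M]
  [IsScalarTower K (Env K g) M]

/-- the `lam`-weight space of a `U(g)`-module `M`. -/
def wtSpace (lam : Module.Dual K S.h) : Submodule K M where
  carrier := {m | ∀ H : S.h, UniversalEnvelopingAlgebra.ι K (H : g) • m = lam H • m}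
  add_mem' := by
    intro a b ha hb H
    rw [smul_add, ha H, hb H, smul_add]
  zero_mem' := by
    intro H
    rw [smul_zero, smul_zero]
  smul_mem' := by
    intro c x hx H
    rw [env_smul_comm, hx H, smul_comm]

/-- the support of `M`: the set of `h`-weights of `M`. -/
def support : Set (Module.Dual K S.h) := {lam | S.wtSpace M lam ≠ ⊥}

/-- `M` is an object of the extended category `O-bar`:  it is an `h`-weight module with
finite-dimensional weight spaces and `U(n⁺) ⬝ v` is finite dimensional for every `v ∈ M`. -/
structure InO : Prop where
  indep : iSupIndep fun lam : Module.Dual K S.h => S.wtSpace M lam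
  span : (⨆ lam : Module.Dual K S.h, S.wtSpace M lam) = ⊤
  finite : ∀ lam : Module.Dual K S.h, FiniteDimensional K (S.wtSpace M lam)
  locFin : ∀ v : M, ∃ N : Submodule K M, FiniteDimensional K N ∧ v ∈ N ∧
    ∀ x ∈ S.nplus, ∀ m ∈ N, UniversalEnvelopingAlgebra.ι K x • m ∈ N

end Modules

end Setup

/-- a `U(g)`-module is indecomposable if it is nonzero and is not the direct sum of two
nonzero submodules. -/
def Indecomposable (M : Type) [AddCommGroup M] [Module (Env K g) M] : Prop :=
  (⊤ : Submodule (Env K g) M) ≠ ⊥ ∧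
    ∀ N₁ N₂ : Submodule (Env K g) M, IsCompl N₁ N₂ → N₁ = ⊥ ∨ N₂ = ⊥

/-- the subquotient `N₂ / N₁` of a pair of submodules. -/
abbrev subQuot {M : Type} [AddCommGroup M] [Module (Env K g) M]
    (N₁ N₂ : Submodule (Env K g) M) : Type :=
  N₂ ⧸ (N₁.comap N₂.subtype)

namespace Setup

variable (S : Setup K g)

/-- A composition series of `M` with bounds `lam ≼ nu`: a finite filtration of `M` together
with a relevant index set `J` such that relevant subquotients are simple modules `L(ξ)` with
`lam ≼ ξ ≼ nu`, and irrelevant subquotients either have no weights in the interval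
`[lam, nu]` or are simple modules `L(ξ)` with `ξ ≻ lam` and `ξ ⋠ nu`. -/
structure CompSeries (lam nu : Module.Dual K S.h) (M : Type) [AddCommGroup M] [Module K M]
    [Module (Env K g) M] [IsScalarTower K (Env K g) M] where
  k : ℕ
  c : Fin (k + 1) → Submodule (Env K g) M
  mono : Monotone c
  bot : c 0 = ⊥
  top : c (Fin.last k) = ⊤
  J : Finset (Fin k)
  rel : ∀ j ∈ J, ∃ ξ : Module.Dual K S.h, S.wle lam ξ ∧ S.wle ξ nu ∧
    Nonempty (subQuot (c j.castSucc) (c j.succ) ≃ₗ[Env K g] S.SimpleL ξ)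
  irrel : ∀ j : Fin k, j ∉ J →
    (∀ mu : Module.Dual K S.h, S.wle lam mu → S.wle mu nu →
        S.wtSpace (subQuot (c j.castSucc) (c j.succ)) mu = ⊥) ∨
    (∃ ξ : Module.Dual K S.h, S.wle lam ξ ∧ ξ ≠ lam ∧ ¬S.wle ξ nu ∧
        Nonempty (subQuot (c j.castSucc) (c j.succ) ≃ₗ[Env K g] S.SimpleL ξ))

/-- the `j`-th subquotient of a composition series. -/
abbrev CompSeries.quot {S : Setup K g} {lam nu : Module.Dual K S.h} {M : Type}
    [AddCommGroup M] [Module K M] [Module (Env K g) M] [IsScalarTower K (Env K g) M]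
    (T : S.CompSeries lam nu M) (j : Fin T.k) : Type :=
  subQuot (T.c j.castSucc) (T.c j.succ)

/-- the number of times the simple module `L(mu)` occurs in the composition series `T`. -/
noncomputable def CompSeries.mult {S : Setup K g} {lam nu : Module.Dual K S.h} {M : Type}
    [AddCommGroup M] [Module K M] [Module (Env K g) M] [IsScalarTower K (Env K g) M]
    (T : S.CompSeries lam nu M) (mu : Module.Dual K S.h) : ℕ :=
  Nat.card {j : Fin T.k // j ∈ T.J ∧ Nonempty (T.quot j ≃ₗ[Env K g] S.SimpleL mu)}

/-- `L(mu)` is a composition factor of `M`: it occurs in some composition series of `M`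
with bounds `lam ≼ mu ≼ nu`. -/
def IsCompFactor (M : Type) [AddCommGroup M] [Module K M] [Module (Env K g) M]
    [IsScalarTower K (Env K g) M] (mu : Module.Dual K S.h) : Prop :=
  ∃ (lam nu : Module.Dual K S.h) (T : S.CompSeries lam nu M),
    S.wle lam mu ∧ S.wle mu nu ∧
    ∃ j ∈ T.J, Nonempty (T.quot j ≃ₗ[Env K g] S.SimpleL mu)

end Setup

/-- A generalized composition series of `M`: a family of submodules indexed by a totally
ordered set `(J, <)`, strictly increasing, with trivial intersection, union equal to `M`,
and all subquotients `M_j / M_{<j}` simple. -/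
structure GenCompSeries (M : Type) [AddCommGroup M] [Module (Env K g) M] where
  J : Type
  lt : J → J → Prop
  linear : IsLinearOrder J lt
  c : J → Submodule (Env K g) M
  strict : ∀ {i j : J}, lt i j → c i < c j
  iInf_bot : (⨅ j, c j) = ⊥
  iSup_top : (⨆ j, c j) = ⊤
  simple : ∀ j : J,
    IsSimpleModule (Env K g) (subQuot (⨆ i : {i : J // lt i j}, c i) (c j))

/-- the subquotient `M_j / M_{<j}` of a generalized composition series. -/
abbrev GenCompSeries.quot {M : Type} [AddCommGroup M] [Module (Env K g) M]
    (T : GenCompSeries (K := K) (g := g) M) (j : T.J) : Type :=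
  subQuot (⨆ i : {i : T.J // T.lt i j}, T.c i) (T.c j)

set_option linter.unusedSectionVars false

section Sl2Ops
variable {K V : Type*} [Field K] [CharZero K] [AddCommGroup V] [Module K V]

/-- Three endomorphisms satisfying the `sl₂` relations. -/
structure Sl2Ops (E F H : Module.End K V) : Prop where
  EF : E * F = F * E + H
  HE : H * E = E * H + (2 : K) • E
  HF : H * F = F * H - (2 : K) • F

namespace Sl2Ops
variable {E F H : Module.End K V}

lemma symm (s : Sl2Ops E F H) : Sl2Ops F E (-H) where
  EF := by rw [s.EF]; abel
  HE := by rw [neg_mul, s.HF, mul_neg]; abel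
  HF := by rw [neg_mul, s.HE, mul_neg]; abel

lemma HE_apply (s : Sl2Ops E F H) (v : V) : H (E v) = E (H v) + (2 : K) • E v := by
  simpa using congrArg (fun f : Module.End K V => f v) s.HE

lemma HF_apply (s : Sl2Ops E F H) (v : V) : H (F v) = F (H v) - (2 : K) • F v := by
  simpa using congrArg (fun f : Module.End K V => f v) s.HF

lemma EF_apply (s : Sl2Ops E F H) (v : V) : E (F v) = F (E v) + H v := by
  simpa using congrArg (fun f : Module.End K V => f v) s.EF

lemma H_pow_E (s : Sl2Ops E F H) (k : ℕ) (v : V) :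
    H ((E ^ k) v) = (E ^ k) (H v) + (2 * k : K) • (E ^ k) v := by
  induction k with
  | zero => simp
  | succ k ih =>
    rw [pow_succ', Module.End.mul_apply, Module.End.mul_apply, s.HE_apply, ih, map_add, map_smul]
    push_cast
    module

lemma H_pow_F (s : Sl2Ops E F H) (k : ℕ) (v : V) :
    H ((F ^ k) v) = (F ^ k) (H v) - (2 * k : K) • (F ^ k) v := by
  have := s.symm.H_pow_E k v
  simp only [LinearMap.neg_apply, map_neg] at this
  rw [← neg_inj, this]; module

/-- Commutation of `E` with a power of `F`. -/
lemma E_pow_F (s : Sl2Ops E F H) (k : ℕ) (v : V) :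
    E ((F ^ (k + 1)) v) = (F ^ (k + 1)) (E v) + (k + 1 : K) • (F ^ k) (H v - (k : K) • v) := by
  induction k generalizing v with
  | zero => simp [s.EF_apply]
  | succ k ih =>
    rw [pow_succ, Module.End.mul_apply, ih, s.EF_apply, s.HF_apply]
    simp only [pow_succ, Module.End.mul_apply, map_sub, map_smul, map_add]
    push_cast
    module

variable [FiniteDimensional K V]

lemma isNilpotent_E (s : Sl2Ops E F H) : IsNilpotent E := by
  by_contra hn
  have hne : ∀ k : ℕ, E ^ k ≠ 0 := fun k hk => hn ⟨k, hk⟩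
  let A : Module.End K (Module.End K V) :=
    LinearMap.mulLeft K H - LinearMap.mulRight K H
  have hA : ∀ k : ℕ, A.HasEigenvalue (2 * k : K) := by
    intro k
    refine Module.End.hasEigenvalue_of_hasEigenvector (x := E ^ k) ⟨?_, hne k⟩
    rw [Module.End.mem_eigenspace_iff]
    ext v
    simp [A, s.H_pow_E k v]
  have hfin := Module.End.finite_hasEigenvalue A
  refine Set.infinite_of_injective_forall_mem (f := fun k : ℕ => (2 * k : K)) ?_ hA hfin
  intro a b hab
  simpa using hab

lemma isNilpotent_F (s : Sl2Ops E F H) : IsNilpotent F := s.symm.isNilpotent_E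

lemma exists_last {f : Module.End K V} (hf : IsNilpotent f) {v : V} (hv : v ≠ 0) :
    ∃ k : ℕ, (f ^ k) v ≠ 0 ∧ f ((f ^ k) v) = 0 := by
  classical
  obtain ⟨n, hn⟩ := hf
  have hex : ∃ n, (f ^ n) v = 0 := ⟨n, by simp [hn]⟩
  have h0 : Nat.find hex ≠ 0 := by
    intro h
    have := Nat.find_spec hex
    rw [h] at this
    exact hv (by simpa using this)
  obtain ⟨k, hk⟩ := Nat.exists_eq_succ_of_ne_zero h0
  refine ⟨k, Nat.find_min hex (by omega), ?_⟩
  have := Nat.find_spec hex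
  rwa [hk, Nat.succ_eq_add_one, pow_succ', Module.End.mul_apply] at this

/-- The weight of a primitive vector is a natural number, and the last nonzero power of `F`
is the expected one. -/
lemma primitive_nat (s : Sl2Ops E F H) {v : V} (hv : v ≠ 0) {μ : K} (hH : H v = μ • v)
    (hE : E v = 0) : ∃ n : ℕ, μ = n ∧ (F ^ n) v ≠ 0 ∧ F ((F ^ n) v) = 0 := by
  obtain ⟨k, hk, hk'⟩ := exists_last s.isNilpotent_F hv
  have := s.E_pow_F k v
  rw [pow_succ', Module.End.mul_apply, hk', map_zero, hE, map_zero, zero_add, hH, ← sub_smul,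
    map_smul, smul_smul] at this
  have h2 : (k + 1 : K) * (μ - k) = 0 := by
    by_contra h
    exact hk ((smul_eq_zero.1 this.symm).resolve_left h)
  have h3 : (k + 1 : K) ≠ 0 := by exact_mod_cast Nat.succ_ne_zero k
  exact ⟨k, sub_eq_zero.1 ((mul_eq_zero.1 h2).resolve_left h3), hk, hk'⟩

lemma lowest_nat (s : Sl2Ops E F H) {v : V} (hv : v ≠ 0) {μ : K} (hH : H v = μ • v)
    (hF : F v = 0) : ∃ n : ℕ, μ = -n := by
  obtain ⟨n, hn, -⟩ := s.symm.primitive_nat hv (μ := -μ) (by simp [hH]) hF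
  exact ⟨n, by rw [← hn, neg_neg]⟩

lemma exists_lowest (s : Sl2Ops E F H) {v : V} (hv : v ≠ 0) {μ : K} (hH : H v = μ • v) :
    ∃ k p : ℕ, (F ^ k) v ≠ 0 ∧ F ((F ^ k) v) = 0 ∧ μ - 2 * k = -p ∧
      H ((F ^ k) v) = (-p : K) • (F ^ k) v := by
  obtain ⟨k, hk, hk'⟩ := exists_last s.isNilpotent_F hv
  have h1 : H ((F ^ k) v) = (μ - 2 * k) • (F ^ k) v := by
    rw [s.H_pow_F, hH, map_smul, sub_smul]
  obtain ⟨p, hp⟩ := s.lowest_nat hk h1 hk'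
  exact ⟨k, p, hk, hk', hp, by rw [h1, hp]⟩

lemma exists_highest (s : Sl2Ops E F H) {v : V} (hv : v ≠ 0) {μ : K} (hH : H v = μ • v) :
    ∃ k p : ℕ, (E ^ k) v ≠ 0 ∧ E ((E ^ k) v) = 0 ∧ μ + 2 * k = p ∧
      H ((E ^ k) v) = (p : K) • (E ^ k) v := by
  obtain ⟨k, p, h1, h2, h3, h4⟩ := s.symm.exists_lowest hv (μ := -μ) (by simp [hH])
  refine ⟨k, p, h1, h2, by linear_combination -h3, ?_⟩
  rw [LinearMap.neg_apply, neg_smul] at h4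
  exact neg_inj.1 h4

lemma eigenvalue_int (s : Sl2Ops E F H) {v : V} (hv : v ≠ 0) {μ : K} (hH : H v = μ • v) :
    ∃ n : ℤ, μ = n := by
  obtain ⟨k, p, -, -, h, -⟩ := s.exists_lowest hv hH
  exact ⟨2 * k - p, by push_cast; linear_combination h⟩

variable (E F H) in
/-- The Casimir operator. -/
def cas : Module.End K V := (4 : K) • (E * F) - (2 : K) • H + H * H

lemma cas_apply (v : V) : cas E F H v = (4 : K) • E (F v) - (2 : K) • H v + H (H v) := rfl

lemma cas_comm_H (s : Sl2Ops E F H) : Commute (cas E F H) H := by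
  ext v
  simp only [Module.End.mul_apply, cas_apply, map_add, map_sub, map_smul, s.HF_apply, s.HE_apply,
    s.EF_apply]
  module

lemma cas_comm_E (s : Sl2Ops E F H) : Commute (cas E F H) E := by
  ext v
  simp only [Module.End.mul_apply, cas_apply, map_add, map_sub, map_smul, s.HE_apply, s.EF_apply]
  module

lemma cas_comm_F (s : Sl2Ops E F H) : Commute (cas E F H) F := by
  ext v
  simp only [Module.End.mul_apply, cas_apply, map_add, map_sub, map_smul, s.HF_apply, s.EF_apply]
  module

lemma cas_highest (s : Sl2Ops E F H) {v : V} {μ : K} (hH : H v = μ • v)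
    (h : F (E v) = 0) : cas E F H v = (μ ^ 2 + 2 * μ) • v := by
  rw [cas_apply, s.EF_apply, h, hH, map_smul, hH]; module

lemma cas_lowest {v : V} {μ : K} (hH : H v = μ • v) (h : F v = 0) :
    cas E F H v = (μ ^ 2 - 2 * μ) • v := by
  rw [cas_apply, h, map_zero, hH, map_smul, hH]; module

/-- `FE` is injective on weight spaces whose weight is not a natural number. -/
lemma FE_injective (s : Sl2Ops E F H) {v : V} {μ : K} (hH : H v = μ • v)
    (hμ : ∀ n : ℕ, μ ≠ n) (h : F (E v) = 0) : v = 0 := by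
  by_contra hv
  obtain ⟨k, p, h1, h2, h3, h4⟩ := s.exists_lowest hv hH
  have e1 := s.cas_highest hH h
  have e2 : cas E F H ((F ^ k) v) = _ := cas_lowest h4 h2
  have e3 : cas E F H ((F ^ k) v) = (F ^ k) (cas E F H v) := by
    have := (s.cas_comm_F.pow_right k).eq
    simpa using congrArg (fun f : Module.End K V => f v) this
  rw [e1, map_smul, e2] at e3
  have e4 := smul_left_injective K h1 e3
  have e5 : (μ - p) * (μ + p + 2) = 0 := by linear_combination -e4
  rcases mul_eq_zero.1 e5 with h | h
  · exact hμ p (sub_eq_zero.1 h)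
  · have : ((2 * k + 2 : ℕ) : K) = 0 := by push_cast; linear_combination h - h3
    simp at this
    norm_cast at this

/-- If the weight is not a natural number the weight space lies in the image of `FE`. -/
lemma exists_FE (s : Sl2Ops E F H) {v : V} {μ : K} (hH : H v = μ • v)
    (hμ : ∀ n : ℕ, μ ≠ n) : ∃ w, H w = μ • w ∧ F (E w) = v := by
  let W := Module.End.eigenspace H μ
  have hW : ∀ x ∈ W, (F * E) x ∈ W := by
    intro x hx
    rw [Module.End.mem_eigenspace_iff] at hx ⊢
    rw [Module.End.mul_apply, s.HF_apply, s.HE_apply, hx]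
    simp only [map_add, map_smul]; module
  have inj : Function.Injective ((F * E).restrict hW) := by
    rw [← LinearMap.ker_eq_bot, LinearMap.ker_eq_bot']
    intro x hx
    ext
    exact s.FE_injective (Module.End.mem_eigenspace_iff.1 x.2) hμ (by simpa using congrArg Subtype.val hx)
  obtain ⟨w, hw⟩ := (LinearMap.injective_iff_surjective.1 inj) ⟨v, Module.End.mem_eigenspace_iff.2 hH⟩
  exact ⟨w, Module.End.mem_eigenspace_iff.1 w.2, by simpa using congrArg Subtype.val hw⟩

/-- No nontrivial Jordan block of `H` can end in a primitive vector. -/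
lemma no_jordan (s : Sl2Ops E F H) (d : ℕ) : ∀ {u w : V} {μ : K}, H u = μ • u + w → H w = μ • w →
    E w = 0 → (E ^ (d + 1)) u = 0 → w = 0 := by
  induction d with
  | zero =>
    intro u w μ hu hw hE hEu
    by_contra hw0
    obtain ⟨n, rfl, hn1, hn2⟩ := s.primitive_nat hw0 hw hE
    have hEu : E u = 0 := by simpa using hEu
    have key : ∀ k : ℕ, (F ^ (n + 1 + k)) u ≠ 0 := by
      intro k
      induction k with
      | zero =>
        intro h0
        have := s.E_pow_F n u
        rw [show n + 1 = n + 1 + 0 from rfl, h0, map_zero, hEu, map_zero, zero_add, hu,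
          add_sub_cancel_left] at this
        have h3 : (n + 1 : K) ≠ 0 := by exact_mod_cast Nat.succ_ne_zero n
        exact hn1 ((smul_eq_zero.1 this.symm).resolve_left h3)
      | succ k ih =>
        intro h0
        have := s.E_pow_F (n + 1 + k) u
        have hw' : (F ^ (n + 1 + k)) w = 0 := by
          rw [show n + 1 + k = k + (n + 1) by ring, pow_add, Module.End.mul_apply, pow_succ',
            Module.End.mul_apply, hn2, map_zero]
        rw [show n + 1 + k + 1 = n + 1 + (k + 1) from rfl, h0, map_zero, hEu, map_zero, zero_add,
          hu, add_sub_right_comm, map_add, hw', add_zero, ← sub_smul, map_smul, smul_smul] at this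
        have h3 : (((n + 1 + k : ℕ) : K) + 1) * ((n : K) - ((n + 1 + k : ℕ) : K)) ≠ 0 := by
          apply mul_ne_zero
          · exact_mod_cast Nat.succ_ne_zero (n + 1 + k)
          · exact sub_ne_zero.2 (by norm_cast; omega)
        exact ih ((smul_eq_zero.1 this.symm).resolve_left h3)
    obtain ⟨N, hN⟩ := s.isNilpotent_F
    apply key N
    rw [pow_add, hN, mul_zero]; rfl
  | succ d ih =>
    intro u w μ hu hw hE hEu
    by_contra hw0
    obtain ⟨n, rfl, hn1, hn2⟩ := s.primitive_nat hw0 hw hE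
    set ν : K := n + 2 * (d + 1) with hν
    have hz : H ((E ^ (d + 1)) u) = ν • (E ^ (d + 1)) u := by
      rw [s.H_pow_E, hu, map_add, map_smul]
      have : (E ^ (d + 1)) w = 0 := by rw [pow_succ, Module.End.mul_apply, hE, map_zero]
      rw [this, hν]; push_cast; module
    have hz2 : E ((E ^ (d + 1)) u) = 0 := by
      rw [← Module.End.mul_apply, ← pow_succ']; exact hEu
    have cz := s.cas_highest hz (by rw [hz2, map_zero])
    have cw := s.cas_highest hw (by rw [hE, map_zero])
    have cH : ∀ x, H (cas E F H x) = cas E F H (H x) := fun x => by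
      simpa using congrArg (fun f : Module.End K V => f x) s.cas_comm_H.eq.symm
    have cE : (E ^ (d + 1)) (cas E F H u) = cas E F H ((E ^ (d + 1)) u) := by
      simpa using congrArg (fun f : Module.End K V => f u) (s.cas_comm_E.pow_right (d + 1)).eq.symm
    have hne : ((n : K) ^ 2 + 2 * n) - (ν ^ 2 + 2 * ν) ≠ 0 := by
      rw [sub_ne_zero, hν]
      norm_cast
      nlinarith
    have := ih (u := cas E F H u - (ν ^ 2 + 2 * ν) • u)
      (w := (((n : K) ^ 2 + 2 * n) - (ν ^ 2 + 2 * ν)) • w) (μ := n)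
      (by rw [map_sub, map_smul, cH, hu, map_add, map_smul, cw]; module)
      (by rw [map_smul, hw]; module) (by rw [map_smul, hE, smul_zero])
      (by rw [map_sub, map_smul, cE, cz]; exact sub_self _)
    exact hw0 ((smul_eq_zero.1 this).resolve_left hne)

lemma eq_zero_of_jordan (s : Sl2Ops E F H) {u w : V} {μ : K} (hu : H u = μ • u + w)
    (hw : H w = μ • w) : w = 0 := by
  by_contra hw0
  obtain ⟨k, p, h1, h2, h3, h4⟩ := s.exists_highest hw0 hw
  obtain ⟨d, hd⟩ := s.isNilpotent_E
  refine h1 (s.no_jordan d (u := (E ^ k) u) (μ := p) ?_ h4 h2 ?_)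
  · rw [s.H_pow_E, hu, map_add, map_smul, ← h3]; module
  · rw [pow_succ, hd, zero_mul]; rfl

lemma ker_pow_le (s : Sl2Ops E F H) (μ : K) (k : ℕ) {x : V}
    (hx : ((H - algebraMap K _ μ) ^ k) x = 0) : (H - algebraMap K (Module.End K V) μ) x = 0 := by
  induction k with
  | zero => simp at hx; simp [hx]
  | succ k ih =>
    rcases k with _ | k
    · simpa using hx
    · apply ih
      rw [pow_succ', Module.End.mul_apply, pow_succ', Module.End.mul_apply] at hx
      rw [pow_succ', Module.End.mul_apply]
      set y := ((H - algebraMap K (Module.End K V) μ) ^ k) x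
      apply s.eq_zero_of_jordan (u := y) (μ := μ)
      · simp [Module.algebraMap_end_apply]
      · simpa [Module.algebraMap_end_apply, sub_eq_zero] using hx

/-- `H` is diagonalizable. -/
lemma iSup_eigenspace [IsAlgClosed K] (s : Sl2Ops E F H) :
    ⨆ μ, Module.End.eigenspace H μ = ⊤ := by
  rw [eq_top_iff, ← Module.End.iSup_maxGenEigenspace_eq_top H]
  refine iSup_mono fun μ x hx => ?_
  rw [Module.End.mem_maxGenEigenspace] at hx
  obtain ⟨k, hk⟩ := hx
  rw [Module.End.mem_eigenspace_iff]
  have := s.ker_pow_le μ k (x := x) (by simpa [Algebra.algebraMap_eq_smul_one] using hk)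
  simpa [Module.algebraMap_end_apply, sub_eq_zero] using this

lemma restrict (s : Sl2Ops E F H) (U : Submodule K V) (hE : ∀ x ∈ U, E x ∈ U)
    (hF : ∀ x ∈ U, F x ∈ U) (hH : ∀ x ∈ U, H x ∈ U) :
    Sl2Ops (LinearMap.restrict E hE) (LinearMap.restrict F hF) (LinearMap.restrict H hH) where
  EF := by ext x; simp [s.EF_apply]
  HE := by ext x; simp [s.HE_apply]
  HF := by ext x; simp [s.HF_apply]

lemma eq_zero_of_cas_pow [IsAlgClosed K] (s : Sl2Ops E F H) {k : ℕ} (hk : cas E F H ^ k = 0) :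
    E = 0 ∧ F = 0 ∧ H = 0 := by
  have key : ∀ {z : V} {c : K}, z ≠ 0 → cas E F H z = c • z → c = 0 := by
    intro z c hz hc
    have : ∀ j : ℕ, (cas E F H ^ j) z = c ^ j • z := by
      intro j
      induction j with
      | zero => simp
      | succ j ih => rw [pow_succ, Module.End.mul_apply, hc, map_smul, ih, smul_smul, pow_succ']
    have h := this k
    rw [hk, LinearMap.zero_apply] at h
    exact eq_zero_of_pow_eq_zero ((smul_eq_zero.1 h.symm).resolve_right hz)
  have hH : H = 0 := by
    have : Module.End.eigenspace H 0 = ⊤ := by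
      rw [eq_top_iff, ← s.iSup_eigenspace]
      refine iSup_le fun μ v hv => ?_
      rw [Module.End.mem_eigenspace_iff] at hv
      by_cases hv0 : v = 0
      · rw [hv0]; exact zero_mem _
      obtain ⟨i, p, h1, h2, h3, h4⟩ := s.exists_highest hv0 hv
      obtain ⟨j, q, g1, g2, g3, g4⟩ := s.exists_lowest hv0 hv
      have hp := key h1 (s.cas_highest h4 (by rw [h2, map_zero]))
      have hq := key g1 (cas_lowest g4 g2)
      have hp : p = 0 := by norm_cast at hp; nlinarith
      have hq : q = 0 := by
        have : ((q ^ 2 + 2 * q : ℕ) : K) = 0 := by push_cast; linear_combination hq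
        norm_cast at this; nlinarith
      subst hp hq
      have : ((2 * i + 2 * j : ℕ) : K) = 0 := by push_cast; linear_combination h3 - g3
      norm_cast at this
      have hj : j = 0 := by omega
      subst hj
      have : μ = 0 := by simpa using g3
      rw [Module.End.mem_eigenspace_iff, hv, this]
    ext v
    have : v ∈ Module.End.eigenspace H 0 := this ▸ Submodule.mem_top
    simpa using this
  have h2 : (2 : K) ≠ 0 := two_ne_zero
  have hE := s.HE
  have hF := s.HF
  rw [hH, zero_mul, mul_zero, zero_add] at hE
  rw [hH, zero_mul, mul_zero, zero_sub] at hF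
  exact ⟨(smul_eq_zero.1 hE.symm).resolve_left h2,
    (smul_eq_zero.1 (neg_eq_zero.1 hF.symm)).resolve_left h2, hH⟩

/-- A partial inverse of the Casimir operator: `1 - C * D` projects onto the invariants. -/
lemma exists_drazin [IsAlgClosed K] (s : Sl2Ops E F H) :
    ∃ q : Polynomial K, ∀ v : V, ∀ w, w = v - cas E F H (Polynomial.aeval (cas E F H) q v) →
      E w = 0 ∧ F w = 0 ∧ H w = 0 := by
  set C := cas E F H with hC
  obtain ⟨m, hm, hndvd⟩ := Polynomial.exists_eq_pow_rootMultiplicity_mul_and_not_dvd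
    (minpoly K C) (minpoly.ne_zero (Algebra.IsIntegral.isIntegral C)) 0
  set k := (minpoly K C).rootMultiplicity 0
  rw [map_zero, sub_zero] at hm hndvd
  have hcop : IsCoprime (Polynomial.X ^ (k + 1) : Polynomial K) m := by
    apply IsCoprime.pow_left
    rw [Polynomial.irreducible_X.coprime_iff_not_dvd]
    exact hndvd
  obtain ⟨a, b, hab⟩ := hcop
  refine ⟨a * Polynomial.X ^ k, fun v w hw => ?_⟩
  have hw2 : w = Polynomial.aeval C (b * m) v := by
    have : b * m = 1 - Polynomial.X * (a * Polynomial.X ^ k) := by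
      rw [← hab]; ring
    rw [hw, this]
    simp
  let U : Submodule K V := LinearMap.ker (C ^ k)
  have hwU : w ∈ U := by
    rw [LinearMap.mem_ker, hw2, ← Module.End.mul_apply]
    have : C ^ k * Polynomial.aeval C (b * m) = Polynomial.aeval C (b * minpoly K C) := by
      rw [hm, show b * (Polynomial.X ^ k * m) = Polynomial.X ^ k * (b * m) by ring,
        map_mul (Polynomial.aeval C) (Polynomial.X ^ k)]
      simp
    rw [this, map_mul, minpoly.aeval, mul_zero]; rfl
  have hst : ∀ {A : Module.End K V}, Commute C A → ∀ x ∈ U, A x ∈ U := by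
    intro A hA x hx
    rw [LinearMap.mem_ker] at hx ⊢
    rw [← Module.End.mul_apply, (hA.pow_left k).eq, Module.End.mul_apply, hx, map_zero]
  have r := s.restrict U (hst s.cas_comm_E) (hst s.cas_comm_F) (hst s.cas_comm_H)
  have hk : cas (LinearMap.restrict E (hst s.cas_comm_E)) (LinearMap.restrict F (hst s.cas_comm_F))
      (LinearMap.restrict H (hst s.cas_comm_H)) ^ k = 0 := by
    have h1 : cas (LinearMap.restrict E (hst s.cas_comm_E)) (LinearMap.restrict F (hst s.cas_comm_F))
      (LinearMap.restrict H (hst s.cas_comm_H)) = LinearMap.restrict C (hst (Commute.refl C)) := by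
      ext x; rfl
    rw [h1, Module.End.pow_restrict]
    ext x
    exact x.2
  obtain ⟨h1, h2, h3⟩ := r.eq_zero_of_cas_pow hk
  refine ⟨?_, ?_, ?_⟩
  · exact congrArg Subtype.val (congrArg (fun f : Module.End K U => f ⟨w, hwU⟩) h1)
  · exact congrArg Subtype.val (congrArg (fun f : Module.End K U => f ⟨w, hwU⟩) h2)
  · exact congrArg Subtype.val (congrArg (fun f : Module.End K U => f ⟨w, hwU⟩) h3)

lemma aeval_apply_comm {A B : Module.End K V}
    (h : Commute A B) (q : Polynomial K) (x : V) :
    Polynomial.aeval A q (B x) = B (Polynomial.aeval A q x) := by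
  induction q using Polynomial.induction_on' with
  | add p q hp hq => rw [map_add, LinearMap.add_apply, LinearMap.add_apply, hp, hq, map_add]
  | monomial n a =>
    rw [Polynomial.aeval_monomial, ← Algebra.smul_def, LinearMap.smul_apply, LinearMap.smul_apply,
      map_smul]
    congr 1
    simpa using congrArg (fun f : Module.End K V => f x) (h.pow_left n).eq

/-- The correction terms needed to lift an `sl₂`-triple through an abelian ideal. -/
lemma exists_correction [IsAlgClosed K] (s : Sl2Ops E F H) :
    ∃ q : Polynomial K, ∀ p r : V, E r = F p →
      let C := cas E F H
      let D := Polynomial.aeval C q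
      let a := -(H (D p)) + (2 : K)⁻¹ • (p - C (D p))
      let b := -(H (D r)) - (2 : K)⁻¹ • (r - C (D r))
      p + H a - (2 : K) • a - E (E b - F a) = 0 ∧ r + H b + (2 : K) • b - F (E b - F a) = 0 := by
  obtain ⟨q, hq⟩ := s.exists_drazin
  refine ⟨q, fun p r hEr => ?_⟩
  intro C D a b
  have hDE : ∀ x, D (E x) = E (D x) := fun x => aeval_apply_comm s.cas_comm_E q x
  have hDF : ∀ x, D (F x) = F (D x) := fun x => aeval_apply_comm s.cas_comm_F q x
  have hEr' : E (D r) = F (D p) := by rw [← hDE, hEr, hDF]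
  obtain ⟨wE, wF, wH⟩ := hq p _ rfl
  obtain ⟨vE, vF, vH⟩ := hq r _ rfl
  change E (p - C (D p)) = 0 at wE
  change F (p - C (D p)) = 0 at wF
  change H (p - C (D p)) = 0 at wH
  change E (r - C (D r)) = 0 at vE
  change F (r - C (D r)) = 0 at vF
  change H (r - C (D r)) = 0 at vH
  have h22 : (2 : K) * 2⁻¹ = 1 := mul_inv_cancel₀ two_ne_zero
  have ha : (2 : K) • a = -((2 : K) • H (D p)) + (p - C (D p)) := by
    simp only [a]
    rw [smul_add, smul_smul, h22, one_smul, smul_neg]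
  have hb : (2 : K) • b = -((2 : K) • H (D r)) - (r - C (D r)) := by
    simp only [b]
    rw [smul_sub, smul_smul, h22, one_smul, smul_neg]
  have hEa : E b - F a = F (H (D p)) - E (H (D r)) := by
    change E (-(H (D r)) - (2 : K)⁻¹ • (r - C (D r))) - F (-(H (D p)) + (2 : K)⁻¹ • (p - C (D p))) = _
    rw [map_sub, map_add, map_smul, map_smul, vE, wF, map_neg, map_neg, smul_zero]; abel
  have hHa : H a = - H (H (D p)) := by
    change H (-(H (D p)) + (2 : K)⁻¹ • (p - C (D p))) = _
    rw [map_add, map_smul, wH, map_neg, smul_zero, add_zero]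
  have hHb : H b = - H (H (D r)) := by
    change H (-(H (D r)) - (2 : K)⁻¹ • (r - C (D r))) = _
    rw [map_sub, map_smul, vH, map_neg, smul_zero, sub_zero]
  have hCp : C (D p) = (4 : K) • E (F (D p)) - (2 : K) • H (D p) + H (H (D p)) := rfl
  have hCr : C (D r) = (4 : K) • E (F (D r)) - (2 : K) • H (D r) + H (H (D r)) := rfl
  have t1 : E (H (D r)) = H (F (D p)) - (2 : K) • F (D p) := by
    rw [← hEr', s.HE_apply]; abel
  have t2 : F (H (D p)) = H (F (D p)) + (2 : K) • F (D p) := by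
    rw [s.HF_apply]; abel
  have hX : E b - F a = (4 : K) • F (D p) := by
    rw [hEa, t1, t2]; module
  constructor
  · rw [ha, hHa, hX, hCp, map_smul]; module
  · rw [hb, hHb, hX, hCr, ← hEr', map_smul, s.EF_apply]; module

end Sl2Ops
end Sl2Ops

section SolvableLift
variable {K L : Type} [Field K] [CharZero K] [LieRing L] [LieAlgebra K L]

/-- `e, f` and `⁅e, f⁆` form an `sl₂`-triple. -/
def IsTriple (K : Type) {L : Type} [Field K] [LieRing L] [LieAlgebra K L] (e f : L) : Prop :=
  ⁅⁅e, f⁆, e⁆ = (2 : K) • e ∧ ⁅⁅e, f⁆, f⁆ = -((2 : K) • f)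

/-- A pair of elements which is an `sl₂`-triple modulo elements acting trivially gives
`sl₂`-operators. -/
lemma sl2Ops_of_triple {V : Type} [AddCommGroup V] [Module K V] [LieRingModule L V]
    [LieModule K L V] {e f h : L} (h0 : ∀ v : V, ⁅⁅e, f⁆ - h, v⁆ = 0)
    (h1 : ∀ v : V, ⁅⁅h, e⁆ - (2 : K) • e, v⁆ = 0)
    (h2 : ∀ v : V, ⁅⁅h, f⁆ + (2 : K) • f, v⁆ = 0) :
    Sl2Ops (LieModule.toEnd K L V e) (LieModule.toEnd K L V f) (LieModule.toEnd K L V h) where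
  EF := by
    ext v
    have := h0 v
    simp only [sub_lie, lie_lie] at this
    simp only [Module.End.mul_apply, LieModule.toEnd_apply_apply, LinearMap.add_apply]
    linear_combination (norm := module) this
  HE := by
    ext v
    have := h1 v
    simp only [sub_lie, lie_lie, smul_lie] at this
    simp only [Module.End.mul_apply, LieModule.toEnd_apply_apply, LinearMap.add_apply,
      LinearMap.smul_apply]
    linear_combination (norm := module) this
  HF := by
    ext v
    have := h2 v
    simp only [add_lie, lie_lie, smul_lie] at this
    simp only [Module.End.mul_apply, LieModule.toEnd_apply_apply, LinearMap.sub_apply,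
      LinearMap.smul_apply]
    linear_combination (norm := module) this

lemma IsTriple.sl2Ops {V : Type} [AddCommGroup V] [Module K V] [LieRingModule L V]
    [LieModule K L V] {e f : L} (h : IsTriple K e f) :
    Sl2Ops (LieModule.toEnd K L V e) (LieModule.toEnd K L V f) (LieModule.toEnd K L V ⁅e, f⁆) :=
  sl2Ops_of_triple (by simp) (by simp [h.1]) (by simp [h.2])

lemma aeval_mem_of_forall_mem {V : Type} [AddCommGroup V] [Module K V] {A : Module.End K V}
    {X : Submodule K V} (hX : ∀ x ∈ X, A x ∈ X) (q : Polynomial K) {x : V} (hx : x ∈ X) :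
    Polynomial.aeval A q x ∈ X := by
  induction q using Polynomial.induction_on' with
  | add p q hp hq => rw [map_add]; exact add_mem hp hq
  | monomial n a =>
    rw [Polynomial.aeval_monomial, ← Algebra.smul_def, LinearMap.smul_apply]
    refine Submodule.smul_mem _ _ ?_
    induction n with
    | zero => simpa
    | succ n ih => rw [pow_succ', Module.End.mul_apply]; exact hX _ ih

variable [IsAlgClosed K] [FiniteDimensional K L]

lemma lift_triple_abelian (A : LieIdeal K L) (hA : IsLieAbelian A) {Xp X0 Xm : Submodule K L}
    (hpm : ∀ x ∈ Xp, ∀ y ∈ Xm, ⁅x, y⁆ ∈ X0) (h0p : ∀ x ∈ X0, ∀ y ∈ Xp, ⁅x, y⁆ ∈ Xp)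
    (h0m : ∀ x ∈ X0, ∀ y ∈ Xm, ⁅x, y⁆ ∈ Xm) {e f : L} (he : e ∈ Xp) (hf : f ∈ Xm)
    (h1 : ⁅⁅e, f⁆, e⁆ - (2 : K) • e ∈ A) (h2 : ⁅⁅e, f⁆, f⁆ + (2 : K) • f ∈ A) :
    ∃ e' ∈ Xp, ∃ f' ∈ Xm, e' - e ∈ A ∧ f' - f ∈ A ∧ IsTriple K e' f' := by
  have hab : ∀ x ∈ A, ∀ y : A, ⁅x, y⁆ = 0 := by
    intro x hx y
    exact hA.trivial ⟨x, hx⟩ y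
  have s := sl2Ops_of_triple (K := K) (V := A) (e := e) (f := f) (h := ⁅e, f⁆) (by simp)
    (hab _ h1) (hab _ h2)
  set h := ⁅e, f⁆ with hh
  have hh0 : h ∈ X0 := hpm _ he _ hf
  set E := LieModule.toEnd K L A e with hE
  set F := LieModule.toEnd K L A f with hF
  set H := LieModule.toEnd K L A h with hH
  set C := Sl2Ops.cas E F H with hC
  let p : A := ⟨_, h1⟩
  let r : A := ⟨_, h2⟩
  have hEr : E r = F p := by
    ext
    have h3 : ⁅⁅h, e⁆, f⁆ + ⁅e, ⁅h, f⁆⁆ = 0 := by rw [← leibniz_lie, ← hh]; exact lie_self h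
    show ⁅e, ⁅h, f⁆ + (2 : K) • f⁆ = ⁅f, ⁅h, e⁆ - (2 : K) • e⁆
    rw [lie_add, lie_sub, lie_smul, lie_smul, ← lie_skew f e, ← lie_skew f ⁅h, e⁆]
    linear_combination (norm := module) h3
  obtain ⟨q, hq⟩ := s.exists_correction
  have hq := hq p r hEr
  rw [← hC] at hq
  set D := Polynomial.aeval C q with hD
  set a : A := -(H (D p)) + (2 : K)⁻¹ • (p - C (D p)) with ha
  set b : A := -(H (D r)) - (2 : K)⁻¹ • (r - C (D r)) with hb
  obtain ⟨eq1, eq2⟩ := hq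
  have hpXp : (p : L) ∈ Xp := sub_mem (h0p _ hh0 _ he) (Submodule.smul_mem _ _ he)
  have hrXm : (r : L) ∈ Xm := add_mem (h0m _ hh0 _ hf) (Submodule.smul_mem _ _ hf)
  have hab0 : ⁅(a : L), (b : L)⁆ = 0 := by
    have := hab a a.2 b
    simpa using congrArg Subtype.val this
  have hap : (a : L) ∈ Xp := by
    let U : Submodule K A := Xp.comap (A.toSubmodule.subtype)
    have hHU : ∀ x ∈ U, H x ∈ U := fun x hx => h0p _ hh0 _ hx
    have hCU : ∀ x ∈ U, C x ∈ U := by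
      intro x hx
      have hEFU : E (F x) ∈ U := by
        show ⁅e, ⁅f, (x : L)⁆⁆ ∈ Xp
        have : ⁅f, (x : L)⁆ ∈ X0 := by
          rw [← lie_skew]; exact neg_mem (hpm _ hx _ hf)
        rw [← lie_skew]
        exact neg_mem (h0p _ this _ he)
      exact add_mem (sub_mem (Submodule.smul_mem _ _ hEFU) (Submodule.smul_mem _ _ (hHU _ hx)))
        (hHU _ (hHU _ hx))
    have hDU := aeval_mem_of_forall_mem hCU q (x := p) hpXp
    exact add_mem (neg_mem (hHU _ hDU)) (Submodule.smul_mem _ _ (sub_mem hpXp (hCU _ hDU)))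
  have hbm : (b : L) ∈ Xm := by
    let U : Submodule K A := Xm.comap (A.toSubmodule.subtype)
    have hHU : ∀ x ∈ U, H x ∈ U := fun x hx => h0m _ hh0 _ hx
    have hCU : ∀ x ∈ U, C x ∈ U := by
      intro x hx
      have hEFU : F (E x) ∈ U := by
        show ⁅f, ⁅e, (x : L)⁆⁆ ∈ Xm
        rw [← lie_skew]
        exact neg_mem (h0m _ (hpm _ he _ hx) _ hf)
      have : C x = (4 : K) • F (E x) + (2 : K) • H x + H (H x) := by
        rw [hC, Sl2Ops.cas_apply, s.EF_apply]; module
      rw [this]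
      exact add_mem (add_mem (Submodule.smul_mem _ _ hEFU) (Submodule.smul_mem _ _ (hHU _ hx)))
        (hHU _ (hHU _ hx))
    have hDU := aeval_mem_of_forall_mem hCU q (x := r) hrXm
    exact sub_mem (neg_mem (hHU _ hDU)) (Submodule.smul_mem _ _ (sub_mem hrXm (hCU _ hDU)))
  have heq : ⁅e + (a : L), f + (b : L)⁆ = h + (⁅e, (b : L)⁆ - ⁅f, (a : L)⁆) := by
    rw [add_lie, lie_add, lie_add, hab0, ← hh, ← lie_skew (a : L) f]; abel
  have hcd : ∀ x y : A, ⁅⁅e, (b : L)⁆ - ⁅f, (a : L)⁆, (y : L)⁆ = 0 := by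
    intro x y
    exact congrArg Subtype.val (hab _ (E b - F a).2 y)
  refine ⟨e + a, add_mem he hap, f + b, add_mem hf hbm, by simp, by simp, ?_, ?_⟩
  · have e1 : ⁅h, e⁆ - (2 : K) • e + ⁅h, (a : L)⁆ - (2 : K) • (a : L) -
        ⁅e, ⁅e, (b : L)⁆ - ⁅f, (a : L)⁆⁆ = 0 := congrArg Subtype.val eq1
    rw [heq, add_lie, lie_add, lie_add, hcd a a, add_zero, ← lie_skew (⁅e, (b : L)⁆ - ⁅f, (a : L)⁆) e]
    linear_combination (norm := module) e1
  · have e1 : ⁅h, f⁆ + (2 : K) • f + ⁅h, (b : L)⁆ + (2 : K) • (b : L) -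
        ⁅f, ⁅e, (b : L)⁆ - ⁅f, (a : L)⁆⁆ = 0 := congrArg Subtype.val eq2
    rw [heq, add_lie, lie_add, lie_add, hcd a b, add_zero, ← lie_skew (⁅e, (b : L)⁆ - ⁅f, (a : L)⁆) f]
    linear_combination (norm := module) e1

end SolvableLift

section Quotient
variable {K L : Type} [Field K] [LieRing L] [LieAlgebra K L]

/-- The quotient map by an ideal, as a morphism of Lie algebras. -/
def qmk (I : LieIdeal K L) : L →ₗ⁅K⁆ L ⧸ I where
  toLinearMap := I.toSubmodule.mkQ
  map_lie' := rfl

lemma qmk_surjective (I : LieIdeal K L) : Function.Surjective (qmk I) :=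
  Submodule.mkQ_surjective _

lemma qmk_eq_zero (I : LieIdeal K L) {x : L} : qmk I x = 0 ↔ x ∈ I :=
  Submodule.Quotient.mk_eq_zero _

lemma map_derivedSeriesOfIdeal (J I : LieIdeal K L) (k : ℕ) :
    (LieAlgebra.derivedSeriesOfIdeal K L k I).map (qmk J) =
      LieAlgebra.derivedSeriesOfIdeal K (L ⧸ J) k (I.map (qmk J)) := by
  induction k with
  | zero => rfl
  | succ k ih =>
    rw [LieAlgebra.derivedSeriesOfIdeal_succ, LieAlgebra.derivedSeriesOfIdeal_succ, ← ih]
    exact LieIdeal.map_bracket_eq (qmk J) (qmk_surjective J)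

lemma isSolvable_iff_derivedSeriesOfIdeal (I : LieIdeal K L) :
    LieAlgebra.IsSolvable I ↔ ∃ k, LieAlgebra.derivedSeriesOfIdeal K L k I = ⊥ := by
  rw [LieAlgebra.isSolvable_iff K I]
  exact exists_congr fun k => LieIdeal.derivedSeries_eq_bot_iff I k

lemma isSolvable_map_qmk (J I : LieIdeal K L) (h : LieAlgebra.IsSolvable I) :
    LieAlgebra.IsSolvable (I.map (qmk J)) := by
  rw [isSolvable_iff_derivedSeriesOfIdeal] at h ⊢
  obtain ⟨k, hk⟩ := h
  refine ⟨k, ?_⟩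
  rw [← map_derivedSeriesOfIdeal, hk, LieIdeal.map_eq_bot_iff]
  exact bot_le

lemma isSolvable_comap_qmk (J : LieIdeal K L) (hJ : LieAlgebra.IsSolvable J)
    (I : LieIdeal K (L ⧸ J)) (h : LieAlgebra.IsSolvable I) :
    LieAlgebra.IsSolvable (I.comap (qmk J)) := by
  rw [isSolvable_iff_derivedSeriesOfIdeal] at h hJ ⊢
  obtain ⟨k, hk⟩ := h
  obtain ⟨l, hl⟩ := hJ
  refine ⟨l + k, ?_⟩
  rw [LieAlgebra.derivedSeriesOfIdeal_add, eq_bot_iff, ← hl]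
  apply LieAlgebra.derivedSeriesOfIdeal_mono
  intro x hx
  rw [← qmk_eq_zero, ← LieSubmodule.mem_bot (R := K) (L := L ⧸ J), ← hk]
  refine LieAlgebra.derivedSeriesOfIdeal_mono (LieIdeal.map_comap_le (f := qmk J)) k ?_
  rw [← map_derivedSeriesOfIdeal]
  exact LieIdeal.mem_map hx

instance hasTrivialRadical_quotient [IsNoetherian K L] :
    LieAlgebra.HasTrivialRadical K (L ⧸ LieAlgebra.radical K L) := by
  rw [LieAlgebra.hasTrivialRadical_iff_no_solvable_ideals]
  intro I hI
  have h1 := isSolvable_comap_qmk (LieAlgebra.radical K L) inferInstance I hI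
  rw [LieAlgebra.LieIdeal.solvable_iff_le_radical] at h1
  rw [eq_bot_iff]
  intro x hx
  obtain ⟨y, rfl⟩ := qmk_surjective _ x
  rw [LieSubmodule.mem_bot, qmk_eq_zero]
  exact h1 hx

end Quotient

section LiftSolvable
variable {K : Type} [Field K] [CharZero K] [IsAlgClosed K]

lemma lift_triple (n : ℕ) : ∀ {L : Type} [LieRing L] [LieAlgebra K L] [FiniteDimensional K L]
    (_ : Module.finrank K L ≤ n) (I : LieIdeal K L) (_ : LieAlgebra.IsSolvable I)
    {Xp X0 Xm : Submodule K L}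
    (_ : ∀ x ∈ Xp, ∀ y ∈ Xm, ⁅x, y⁆ ∈ X0) (_ : ∀ x ∈ X0, ∀ y ∈ Xp, ⁅x, y⁆ ∈ Xp)
    (_ : ∀ x ∈ X0, ∀ y ∈ Xm, ⁅x, y⁆ ∈ Xm) {e f : L} (_ : e ∈ Xp) (_ : f ∈ Xm)
    (_ : ⁅⁅e, f⁆, e⁆ - (2 : K) • e ∈ I) (_ : ⁅⁅e, f⁆, f⁆ + (2 : K) • f ∈ I),
    ∃ e' ∈ Xp, ∃ f' ∈ Xm, e' - e ∈ I ∧ f' - f ∈ I ∧ IsTriple K e' f' := by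
  induction n with
  | zero =>
    intro L _ _ _ hn I hI Xp X0 Xm hpm h0p h0m e f he hf h1 h2
    have : Subsingleton L := Module.finrank_zero_iff.1 (Nat.le_zero.1 hn)
    exact ⟨e, he, f, hf, by rw [sub_self]; exact zero_mem _, by rw [sub_self]; exact zero_mem _,
      Subsingleton.elim _ _, Subsingleton.elim _ _⟩
  | succ n ih =>
    intro L _ _ _ hn I hI Xp X0 Xm hpm h0p h0m e f he hf h1 h2
    by_cases hbot : I = ⊥
    · subst hbot
      rw [LieSubmodule.mem_bot] at h1 h2
      exact ⟨e, he, f, hf, by rw [sub_self]; exact zero_mem _, by rw [sub_self]; exact zero_mem _,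
        sub_eq_zero.1 h1, eq_neg_of_add_eq_zero_left h2⟩
    · let A := LieAlgebra.derivedAbelianOfIdeal I
      have hA : IsLieAbelian A := LieAlgebra.abelian_derivedAbelianOfIdeal I
      have hA0 : A ≠ ⊥ := fun h => hbot ((LieAlgebra.abelian_of_solvable_ideal_eq_bot_iff I).1 h)
      have hAI : A ≤ I := by
        change LieAlgebra.derivedAbelianOfIdeal I ≤ I
        rw [LieAlgebra.derivedAbelianOfIdeal]
        split
        · exact bot_le
        · exact LieAlgebra.derivedSeriesOfIdeal_le_self _ _
      let π := qmk A
      have hdim : Module.finrank K (L ⧸ A) ≤ n := by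
        have h3 : Module.finrank K (L ⧸ A.toSubmodule) + Module.finrank K A.toSubmodule =
          Module.finrank K L := Submodule.finrank_quotient_add_finrank _
        have h4 : 0 < Module.finrank K A.toSubmodule := by
          rw [Nat.pos_iff_ne_zero, Ne, Submodule.finrank_eq_zero]
          intro h
          exact hA0 ((LieSubmodule.toSubmodule_eq_bot _).1 h)
        change Module.finrank K (L ⧸ A.toSubmodule) ≤ n
        omega
      have hmem : ∀ {x : L}, π x ∈ I.map π → x ∈ I := by
        intro x hx
        obtain ⟨y, hy⟩ := LieIdeal.mem_map_of_surjective (qmk_surjective A) hx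
        have : x - y ∈ A := by
          rw [← qmk_eq_zero, map_sub, hy, sub_self]
        have h := add_mem (hAI this) y.2
        rwa [sub_add_cancel] at h
      have hb : ∀ {X Y Z : Submodule K L}, (∀ x ∈ X, ∀ y ∈ Y, ⁅x, y⁆ ∈ Z) →
          ∀ x ∈ X.map (π : L →ₗ[K] L ⧸ A), ∀ y ∈ Y.map (π : L →ₗ[K] L ⧸ A),
            ⁅x, y⁆ ∈ Z.map (π : L →ₗ[K] L ⧸ A) := by
        rintro X Y Z h _ ⟨x, hx, rfl⟩ _ ⟨y, hy, rfl⟩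
        exact ⟨⁅x, y⁆, h x hx y hy, π.map_lie x y⟩
      obtain ⟨_, ⟨e₁, he₁, rfl⟩, _, ⟨f₁, hf₁, rfl⟩, h3, h4, h5, h6⟩ :=
        ih hdim (I.map π) (isSolvable_map_qmk A I hI) (hb hpm) (hb h0p) (hb h0m)
          (e := π e) (f := π f) ⟨e, he, rfl⟩ ⟨f, hf, rfl⟩
          (by rw [← LieHom.map_lie, ← LieHom.map_lie, ← map_smul, ← map_sub]
              exact LieIdeal.mem_map h1)
          (by rw [← LieHom.map_lie, ← LieHom.map_lie, ← map_smul, ← map_add]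
              exact LieIdeal.mem_map h2)
      change π e₁ - π e ∈ _ at h3
      change π f₁ - π f ∈ _ at h4
      change ⁅⁅π e₁, π f₁⁆, π e₁⁆ = (2 : K) • π e₁ at h5
      change ⁅⁅π e₁, π f₁⁆, π f₁⁆ = -((2 : K) • π f₁) at h6
      rw [← map_sub] at h3 h4
      rw [← LieHom.map_lie, ← LieHom.map_lie, ← map_smul, ← sub_eq_zero, ← map_sub] at h5
      rw [← LieHom.map_lie, ← LieHom.map_lie, ← map_smul, ← sub_eq_zero, sub_neg_eq_add,
        ← map_add] at h6
      obtain ⟨e', he', f', hf', h7, h8, h9⟩ := lift_triple_abelian A hA hpm h0p h0m he₁ hf₁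
        ((qmk_eq_zero A).1 h5) ((qmk_eq_zero A).1 h6)
      refine ⟨e', he', f', hf', ?_, ?_, h9⟩
      · have := add_mem (hAI h7) (hmem h3); rwa [sub_add_sub_cancel] at this
      · have := add_mem (hAI h8) (hmem h4); rwa [sub_add_sub_cancel] at this

end LiftSolvable

section NilRadical

open LieModule

variable {K L : Type} [Field K] [CharZero K] [IsAlgClosed K]
  [LieRing L] [LieAlgebra K L] [FiniteDimensional K L]

/-- The ideal `[L, R]`, where `R` is the radical of `L`; it consists of nilpotent elements. -/
def nilRad (K L : Type) [Field K] [LieRing L] [LieAlgebra K L] : LieIdeal K L :=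
  ⁅(⊤ : LieIdeal K L), LieAlgebra.radical K L⁆

lemma lie_mem_nilRad (x : L) {r : L} (hr : r ∈ LieAlgebra.radical K L) :
    ⁅x, r⁆ ∈ nilRad K L :=
  LieSubmodule.lie_mem_lie (LieSubmodule.mem_top x) hr

lemma exists_lieSubmodule_nilRad (V : Type) [AddCommGroup V] [Module K V] [LieRingModule L V]
    [LieModule K L V] [FiniteDimensional K V] [Nontrivial V] :
    ∃ W : LieSubmodule K L V, W ≠ ⊥ ∧ ∀ x ∈ nilRad K L, ∀ w ∈ W, ⁅x, w⁆ = 0 := by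
  obtain ⟨χ, hχ⟩ := exists_nontrivial_weightSpace_of_isSolvable K (LieAlgebra.radical K L) V
  let W : LieSubmodule K L V := weightSpaceOfIsLieTower K V (A := LieAlgebra.radical K L) χ
  have hW : ∀ r (hr : r ∈ LieAlgebra.radical K L), ∀ w ∈ W, ⁅r, w⁆ = χ ⟨r, hr⟩ • w := by
    intro r hr w hw
    exact (mem_weightSpace (χ := χ) w).1 hw ⟨r, hr⟩
  have hWn : Nontrivial W := hχ
  refine ⟨W, (LieSubmodule.nontrivial_iff_ne_bot K L V).1 hWn, ?_⟩
  have key : ∀ (x r : L) (hr : r ∈ LieAlgebra.radical K L),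
      χ ⟨⁅x, r⁆, LieSubmodule.lie_mem _ hr⟩ = 0 := by
    intro x r hr
    have h1 : toEnd K L W x * toEnd K L W r - toEnd K L W r * toEnd K L W x =
        (χ ⟨⁅x, r⁆, LieSubmodule.lie_mem _ hr⟩) • (1 : Module.End K W) := by
      ext w
      have := hW ⁅x, r⁆ (LieSubmodule.lie_mem _ hr) w w.2
      simpa [lie_lie] using this
    have h2 := congrArg (LinearMap.trace K W) h1
    rw [map_sub, LinearMap.trace_mul_comm, sub_self, map_smul, LinearMap.trace_one,
      smul_eq_mul] at h2
    have : (Module.finrank K W : K) ≠ 0 := by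
      exact_mod_cast (Module.finrank_pos (R := K) (M := W)).ne'
    exact (mul_eq_zero.1 h2.symm).resolve_right this
  intro x hx w hw
  have hx' : x ∈ Submodule.span K {⁅y, r⁆ | (y ∈ (⊤ : LieIdeal K L))
      (r ∈ LieAlgebra.radical K L)} := by
    rw [← LieSubmodule.lieIdeal_oper_eq_linear_span']
    exact hx
  clear hx
  induction hx' using Submodule.span_induction with
  | mem x hx =>
    obtain ⟨y, -, r, hr, rfl⟩ := hx
    rw [hW _ (LieSubmodule.lie_mem _ hr) w hw, key y r hr, zero_smul]
  | zero => rw [zero_lie]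
  | add a b ha hb iha ihb =>
    rw [add_lie, iha, ihb, add_zero]
  | smul c a ha iha => rw [smul_lie, iha, smul_zero]

/-- Elements of `[L, R]` act nilpotently on finite-dimensional modules. -/
lemma isNilpotent_toEnd_of_mem_nilRad {x : L} (hx : x ∈ nilRad K L) (n : ℕ) :
    ∀ (V : Type) [AddCommGroup V] [Module K V] [LieRingModule L V]
    [LieModule K L V] [FiniteDimensional K V], Module.finrank K V ≤ n →
    ∃ k, ∀ v : V, (toEnd K L V x ^ k) v = 0 := by
  induction n with
  | zero =>
    intro V _ _ _ _ _ hV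
    have : Subsingleton V := Module.finrank_zero_iff.1 (Nat.le_zero.1 hV)
    exact ⟨0, fun v => Subsingleton.elim _ _⟩
  | succ n ih =>
    intro V _ _ _ _ _ hV
    rcases subsingleton_or_nontrivial V with h | h
    · exact ⟨0, fun v => Subsingleton.elim _ _⟩
    obtain ⟨W, hW, hWx⟩ := exists_lieSubmodule_nilRad (K := K) (L := L) V
    have hlt : Module.finrank K (V ⧸ W) < Module.finrank K V := by
      have h1 := Submodule.finrank_quotient_add_finrank (W : Submodule K V)
      have h2 : 0 < Module.finrank K (W : Submodule K V) := by
        rw [Module.finrank_pos_iff]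
        exact (LieSubmodule.nontrivial_iff_ne_bot K L V).2 hW
      have h3 : Module.finrank K (V ⧸ W) = Module.finrank K (V ⧸ (W : Submodule K V)) := rfl
      omega
    obtain ⟨k, hk⟩ := ih (V ⧸ W) (by omega)
    refine ⟨k + 1, fun v => ?_⟩
    rw [pow_succ', Module.End.mul_apply]
    apply hWx x hx
    have h4 : ∀ j, ∀ v : V, (LieSubmodule.Quotient.mk ((toEnd K L V x ^ j) v) : V ⧸ W) =
        (toEnd K L (V ⧸ W) x ^ j) (LieSubmodule.Quotient.mk v) := by
      intro j
      induction j with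
      | zero => intro v; rfl
      | succ j ihj =>
        intro v
        rw [pow_succ', Module.End.mul_apply, pow_succ', Module.End.mul_apply, ← ihj]
        rfl
    rw [← LieSubmodule.Quotient.mk_eq_zero]
    exact (h4 k v).trans (hk _)

lemma isNilpotent_ad_of_mem_nilRad {x : L} (hx : x ∈ nilRad K L) :
    IsNilpotent (toEnd K L L x) := by
  obtain ⟨k, hk⟩ := isNilpotent_toEnd_of_mem_nilRad hx _ L le_rfl
  exact ⟨k, LinearMap.ext hk⟩

lemma exists_lcs_nilRad_eq_bot : ∃ k, (nilRad K L).lcs L k = ⊥ := by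
  have : LieModule.IsNilpotent (nilRad K L) L := by
    rw [LieModule.isNilpotent_iff_forall (R := K)]
    intro x
    exact isNilpotent_ad_of_mem_nilRad x.2
  obtain ⟨k, hk⟩ := (LieModule.isNilpotent_iff K (nilRad K L) L).1 this
  refine ⟨k, ?_⟩
  rw [← LieSubmodule.toSubmodule_eq_bot, LieIdeal.coe_lcs_eq, hk]
  rfl

variable (K L) in
/-- Every abelian ideal is central. -/
def WeaklyReductive : Prop :=
  ∀ I : LieIdeal K L, IsLieAbelian I → I ≤ LieAlgebra.center K L

omit [CharZero K] [IsAlgClosed K] [FiniteDimensional K L] in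
lemma mem_center_iff' {x : L} : x ∈ LieAlgebra.center K L ↔ ∀ y : L, ⁅y, x⁆ = 0 :=
  LieModule.mem_maxTrivSubmodule K L L x

omit [CharZero K] [IsAlgClosed K] [FiniteDimensional K L] in
lemma WeaklyReductive.le_center (hL : WeaklyReductive K L) (I : LieIdeal K L)
    (hI : ∀ x ∈ I, ∀ y ∈ I, ⁅x, y⁆ = 0) : I ≤ LieAlgebra.center K L := by
  refine hL I ⟨fun x y => ?_⟩
  apply Subtype.ext
  exact hI x x.2 y y.2

/-- The descending central series of `[L, R]`. -/
def nilSeries (K L : Type) [Field K] [LieRing L] [LieAlgebra K L] : ℕ → LieIdeal K L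
  | 0 => nilRad K L
  | k + 1 => ⁅nilRad K L, nilSeries K L k⁆

omit [CharZero K] [IsAlgClosed K] [FiniteDimensional K L] in
lemma nilSeries_antitone : Antitone (nilSeries K L) :=
  antitone_nat_of_succ_le fun _ => LieSubmodule.lie_le_right _ _

lemma WeaklyReductive.lie_nilRad_mem_center (hL : WeaklyReductive K L) :
    ∀ x ∈ nilRad K L, ∀ y ∈ nilRad K L, ⁅x, y⁆ ∈ LieAlgebra.center K L := by
  have h0 : ∃ k, nilSeries K L k ≤ LieAlgebra.center K L := by
    obtain ⟨k, hk⟩ := exists_lcs_nilRad_eq_bot (K := K) (L := L)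
    have h1 : ∀ j, nilSeries K L j ≤ (nilRad K L).lcs L j := by
      intro j
      induction j with
      | zero => exact le_top
      | succ j ih =>
        rw [LieIdeal.lcs_succ]
        exact LieSubmodule.mono_lie_right _ ih
    exact ⟨k, (h1 k).trans (hk.le.trans bot_le)⟩
  classical
  have hk := Nat.find_spec h0
  have hmin := fun m => Nat.find_min h0 (m := m)
  generalize Nat.find h0 = k at hk hmin
  rcases Nat.lt_or_ge k 2 with h2 | h2
  · intro x hx y hy
    exact hk (nilSeries_antitone (Nat.le_of_lt_succ h2) (LieSubmodule.lie_mem_lie hx hy))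
  · exfalso
    obtain ⟨j, rfl⟩ : ∃ j, k = j + 2 := ⟨k - 2, by omega⟩
    refine hmin (j + 1) (by omega) (hL.le_center _ fun x hx y hy => ?_)
    have hx1 : x ∈ ⁅nilRad K L, nilSeries K L j⁆ := hx
    have hx' : x ∈ Submodule.span K {⁅a, b⁆ | (a ∈ nilRad K L) (b ∈ nilSeries K L j)} := by
      rw [← LieSubmodule.lieIdeal_oper_eq_linear_span']
      exact hx1
    clear hx hx1
    induction hx' using Submodule.span_induction with
    | mem x hx =>
      obtain ⟨a, ha, b, hb, rfl⟩ := hx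
      have hb' : b ∈ nilRad K L := nilSeries_antitone (Nat.zero_le j) hb
      have h3 : ∀ c ∈ nilRad K L, ⁅c, y⁆ ∈ LieAlgebra.center K L := fun c hc =>
        hk (show ⁅c, y⁆ ∈ ⁅nilRad K L, nilSeries K L (j + 1)⁆ from LieSubmodule.lie_mem_lie hc hy)
      rw [lie_lie, mem_center_iff'.1 (h3 b hb') a, mem_center_iff'.1 (h3 a ha) b, sub_zero]
    | zero => rw [zero_lie]
    | add a b ha hb iha ihb => rw [add_lie, iha, ihb, add_zero]
    | smul c a ha iha => rw [smul_lie, iha, smul_zero]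

omit [IsAlgClosed K] [CharZero K] [FiniteDimensional K L] in
lemma lie_center_left {x y : L} (hx : x ∈ LieAlgebra.center K L) : ⁅x, y⁆ = 0 := by
  rw [← lie_skew, mem_center_iff'.1 hx, neg_zero]

lemma WeaklyReductive.isNilpotent_ad_radical (hL : WeaklyReductive K L) {r : L}
    (hr : r ∈ LieAlgebra.radical K L) : IsNilpotent (toEnd K L L r) := by
  have hN := hL.lie_nilRad_mem_center
  have key : ∀ ρ : K, (toEnd K L L r).HasEigenvalue ρ → ρ = 0 := by
    intro ρ hρ
    by_contra hne
    obtain ⟨v, hv⟩ := hρ.exists_hasEigenvector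
    have hv1 : ⁅r, v⁆ = ρ • v := hv.apply_eq_smul
    have hrl : ∀ l : L, ⁅r, l⁆ ∈ nilRad K L := fun l => by
      rw [← lie_skew]
      exact neg_mem (lie_mem_nilRad l hr)
    let I : LieIdeal K L :=
      { carrier := {v | v ∈ nilRad K L ∧ ⁅r, v⁆ - ρ • v ∈ LieAlgebra.center K L}
        add_mem' := by
          rintro a b ⟨ha, ha'⟩ ⟨hb, hb'⟩
          refine ⟨add_mem ha hb, ?_⟩
          convert add_mem ha' hb' using 1
          rw [lie_add]; module
        zero_mem' := ⟨zero_mem _, by simp⟩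
        smul_mem' := by
          rintro c a ⟨ha, ha'⟩
          refine ⟨Submodule.smul_mem _ c ha, ?_⟩
          convert SMulMemClass.smul_mem c ha' using 1
          rw [lie_smul]; module
        lie_mem := by
          rintro x a ⟨ha, ha'⟩
          refine ⟨lie_mem_right K L (nilRad K L) x a ha, ?_⟩
          have h1 := mem_center_iff'.1 ha' x
          have h2 : ⁅r, ⁅x, a⁆⁆ - ρ • ⁅x, a⁆ = ⁅⁅r, x⁆, a⁆ := by
            rw [lie_sub, lie_smul] at h1
            rw [leibniz_lie r x a]
            linear_combination (norm := module) h1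
          show ⁅r, ⁅x, a⁆⁆ - ρ • ⁅x, a⁆ ∈ _
          rw [h2]
          exact hN _ (hrl x) _ ha }
    have hI : ∀ x ∈ I, ∀ y ∈ I, ⁅x, y⁆ = 0 := by
      rintro x ⟨hx, hx'⟩ y ⟨hy, hy'⟩
      have h1 := mem_center_iff'.1 (hN x hx y hy) r
      have h2 := mem_center_iff'.1 hy' x
      have h3 := lie_center_left (y := y) hx'
      rw [leibniz_lie] at h1
      rw [lie_sub, lie_smul] at h2
      rw [sub_lie, smul_lie] at h3
      have h4 : (2 * ρ) • ⁅x, y⁆ = 0 := by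
        linear_combination (norm := module) h1 - h2 - h3
      exact (smul_eq_zero.1 h4).resolve_left (mul_ne_zero two_ne_zero hne)
    have hvN : v ∈ nilRad K L := by
      have : v = ρ⁻¹ • ⁅r, v⁆ := by rw [hv1, smul_smul, inv_mul_cancel₀ hne, one_smul]
      rw [this]
      exact SMulMemClass.smul_mem _ (hrl v)
    have hvZ := hL.le_center I hI (show v ∈ I from ⟨hvN, by simp [hv1]⟩)
    rw [mem_center_iff'.1 hvZ] at hv1
    exact hv.2 ((smul_eq_zero.1 hv1.symm).resolve_left hne)
  have h1 := Module.End.iSup_maxGenEigenspace_eq_top (toEnd K L L r)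
  have h2 : Module.End.maxGenEigenspace (toEnd K L L r) 0 = ⊤ := by
    rw [← h1]
    refine le_antisymm (le_iSup _ _) (iSup_le fun ρ => ?_)
    by_cases h : ρ = 0
    · rw [h]
    · have h3 : ¬ (toEnd K L L r).HasUnifEigenvalue ρ ⊤ := fun h' => h (key ρ
        ((Module.End.hasUnifEigenvalue_iff_hasUnifEigenvalue_one (by simp)).1 h'))
      rw [Module.End.HasUnifEigenvalue, not_not] at h3
      exact h3.le.trans bot_le
  rw [Module.End.isNilpotent_iff_of_finite]
  intro v
  have : v ∈ Module.End.maxGenEigenspace (toEnd K L L r) 0 := by rw [h2]; trivial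
  simpa using (Module.End.mem_maxGenEigenspace _ _ _).1 this

lemma WeaklyReductive.lie_radical_nilRad_mem_center (hL : WeaklyReductive K L) :
    ∀ r ∈ LieAlgebra.radical K L, ∀ y ∈ nilRad K L, ⁅r, y⁆ ∈ LieAlgebra.center K L := by
  intro r hr
  have hN := hL.lie_nilRad_mem_center
  have hrl : ∀ l : L, ⁅r, l⁆ ∈ nilRad K L := fun l => by
    rw [← lie_skew]
    exact neg_mem (lie_mem_nilRad l hr)
  set D := toEnd K L L r with hD
  have hDN : ∀ k, ∀ y ∈ nilRad K L, (D ^ k) y ∈ nilRad K L := by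
    intro k y hy
    induction k with
    | zero => exact hy
    | succ k ih => rw [pow_succ', Module.End.mul_apply]; exact hrl _
  have hskew : ∀ x ∈ nilRad K L, ∀ y ∈ nilRad K L, ⁅D x, y⁆ = -⁅x, D y⁆ := by
    intro x hx y hy
    have h1 := mem_center_iff'.1 (hN x hx y hy) r
    rw [leibniz_lie] at h1
    exact eq_neg_of_add_eq_zero_left h1
  have h0 : ∃ k, ∀ y ∈ nilRad K L, (D ^ k) y ∈ LieAlgebra.center K L := by
    obtain ⟨k, hk⟩ := hL.isNilpotent_ad_radical hr
    exact ⟨k, fun y _ => by rw [hk]; exact zero_mem _⟩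
  classical
  have hk := Nat.find_spec h0
  have hmin := fun m => Nat.find_min h0 (m := m)
  generalize Nat.find h0 = k at hk hmin
  rcases Nat.lt_or_ge k 2 with h2 | h2
  · intro y hy
    interval_cases k
    · exact lie_mem_right K L _ r y (hk y hy)
    · exact hk y hy
  · exfalso
    obtain ⟨j, rfl⟩ : ∃ j, k = j + 2 := ⟨k - 2, by omega⟩
    have hlie : ∀ m, ∀ x : L, ∀ a ∈ nilRad K L,
        (D ^ m) ⁅x, a⁆ - ⁅x, (D ^ m) a⁆ ∈ LieAlgebra.center K L := by
      intro m x a ha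
      induction m with
      | zero => simp
      | succ m ih =>
        have h1 : D ((D ^ m) ⁅x, a⁆ - ⁅x, (D ^ m) a⁆) = 0 := mem_center_iff'.1 ih r
        have h2 : D ⁅x, (D ^ m) a⁆ = ⁅⁅r, x⁆, (D ^ m) a⁆ + ⁅x, D ((D ^ m) a)⁆ := leibniz_lie _ _ _
        rw [map_sub, h2] at h1
        rw [pow_succ', Module.End.mul_apply, Module.End.mul_apply]
        have h3 := hN _ (hrl x) _ (hDN m a ha)
        convert h3 using 1
        linear_combination (norm := module) h1
    let I : LieIdeal K L :=
      { carrier := {v | ∃ a ∈ nilRad K L, v - (D ^ (j + 1)) a ∈ LieAlgebra.center K L}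
        add_mem' := by
          rintro u v ⟨a, ha, ha'⟩ ⟨b, hb, hb'⟩
          refine ⟨a + b, add_mem ha hb, ?_⟩
          convert add_mem ha' hb' using 1
          rw [map_add]; module
        zero_mem' := ⟨0, zero_mem _, by simp⟩
        smul_mem' := by
          rintro c v ⟨a, ha, ha'⟩
          refine ⟨c • a, SMulMemClass.smul_mem c ha, ?_⟩
          convert SMulMemClass.smul_mem c ha' using 1
          rw [map_smul]; module
        lie_mem := by
          rintro x v ⟨a, ha, ha'⟩
          refine ⟨⁅x, a⁆, lie_mem_right K L (nilRad K L) x a ha, ?_⟩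
          have h1 := mem_center_iff'.1 ha' x
          rw [lie_sub] at h1
          convert neg_mem (hlie (j + 1) x a ha) using 1
          linear_combination (norm := module) h1 }
    have hI : ∀ x ∈ I, ∀ y ∈ I, ⁅x, y⁆ = 0 := by
      rintro x ⟨a, ha, ha'⟩ y ⟨b, hb, hb'⟩
      have h1 := lie_center_left (y := y) ha'
      have h2 := mem_center_iff'.1 hb' ((D ^ (j + 1)) a)
      rw [sub_lie] at h1
      rw [lie_sub] at h2
      have h3 : ⁅(D ^ (j + 1)) a, (D ^ (j + 1)) b⁆ = 0 := by
        have h4 : (D ^ (j + 1)) a = D ((D ^ j) a) := by rw [pow_succ', Module.End.mul_apply]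
        have h5 : D ((D ^ (j + 1)) b) = (D ^ (j + 2)) b := by
          rw [pow_succ' D (j + 1), Module.End.mul_apply]
        rw [h4, hskew _ (hDN j a ha) _ (hDN (j + 1) b hb), h5, mem_center_iff'.1 (hk b hb), neg_zero]
      linear_combination (norm := module) h1 + h2 + h3
    refine hmin (j + 1) (by omega) fun y hy => hL.le_center I hI ⟨y, hy, by simp⟩

end NilRadical

section JointEigenspaces

variable {K X Y τ ι : Type*} [Field K] [AddCommGroup X] [Module K X] [AddCommGroup Y] [Module K Y]

/-- The joint eigenspace of a family of operators. -/
def jointEig (A : τ → Module.End K X) (χ : τ → K) : Submodule K X where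
  carrier := {x | ∀ i, A i x = χ i • x}
  add_mem' := by intro a b ha hb i; rw [map_add, ha i, hb i, smul_add]
  zero_mem' := by intro i; rw [map_zero, smul_zero]
  smul_mem' := by intro c x hx i; rw [map_smul, hx i, smul_comm]

lemma mem_of_sum_mem (A : τ → Module.End K X) {c : ι → τ → K} (hc : Function.Injective c)
    (p : Submodule K X) (hp : ∀ i, ∀ x ∈ p, A i x ∈ p) (s : Finset ι) :
    ∀ f : ι → X, (∀ i ∈ s, f i ∈ jointEig A (c i)) → ∑ i ∈ s, f i ∈ p → ∀ i ∈ s, f i ∈ p := by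
  classical
  induction s using Finset.induction_on with
  | empty => intro f _ _ i hi; simp at hi
  | insert a s ha ih =>
    intro f hf hs
    rw [Finset.sum_insert ha] at hs
    have h1 : ∀ i ∈ s, f i ∈ p := by
      intro i hi
      have hne : c i ≠ c a := fun h => ha (hc h ▸ hi)
      obtain ⟨j, hj⟩ := Function.ne_iff.1 hne
      have h2 := ih (fun i => (c i j - c a j) • f i)
        (fun i hi => Submodule.smul_mem _ _ (hf i (Finset.mem_insert_of_mem hi))) (by
          have h3 := sub_mem (hp j _ hs) (p.smul_mem (c a j) hs)
          convert h3 using 1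
          rw [map_add, map_sum, hf a (Finset.mem_insert_self a s) j, smul_add, Finset.smul_sum,
            add_sub_add_left_eq_sub, ← Finset.sum_sub_distrib]
          refine Finset.sum_congr rfl fun i hi => ?_
          rw [hf i (Finset.mem_insert_of_mem hi) j, sub_smul]) i hi
      exact (p.smul_mem_iff (sub_ne_zero.2 hj)).1 h2
    intro i hi
    rcases Finset.mem_insert.1 hi with rfl | hi
    · exact (p.add_mem_iff_left (sum_mem h1)).1 hs
    · exact h1 i hi

lemma exists_components {A : τ → Module.End K X} {c : ι → τ → K}
    (hspan : ⨆ i, jointEig A (c i) = ⊤) (x : X) :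
    ∃ f : ι →₀ X, (∀ i, f i ∈ jointEig A (c i)) ∧ ∑ i ∈ f.support, f i = x := by
  have hx : x ∈ ⨆ i, jointEig A (c i) := hspan ▸ Submodule.mem_top
  obtain ⟨f, hf, h⟩ := (Submodule.mem_iSup_iff_exists_finsupp _ _).1 hx
  exact ⟨f, hf, h⟩

lemma le_iSup_inf_jointEig {A : τ → Module.End K X} {c : ι → τ → K} (hc : Function.Injective c)
    (hspan : ⨆ i, jointEig A (c i) = ⊤) (p : Submodule K X) (hp : ∀ i, ∀ x ∈ p, A i x ∈ p) :
    p ≤ ⨆ i, p ⊓ jointEig A (c i) := by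
  intro x hx
  obtain ⟨f, hf, rfl⟩ := exists_components hspan x
  refine sum_mem fun i hi => Submodule.mem_iSup_of_mem i ⟨?_, hf i⟩
  exact mem_of_sum_mem A hc p hp _ f (fun i _ => hf i) hx i hi

lemma exists_lift_jointEig {A : τ → Module.End K X} {B : τ → Module.End K Y} {c : ι → τ → K}
    (hc : Function.Injective c) (hspan : ⨆ i, jointEig A (c i) = ⊤) (π : X →ₗ[K] Y)
    (hπ : Function.Surjective π) (hAB : ∀ i x, π (A i x) = B i (π x)) {i : ι} {y : Y}
    (hy : y ∈ jointEig B (c i)) : ∃ x ∈ jointEig A (c i), π x = y := by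
  classical
  obtain ⟨x, rfl⟩ := hπ y
  obtain ⟨f, hf, hfx⟩ := exists_components hspan x
  refine ⟨f i, hf i, ?_⟩
  have hf' : ∀ j, π (f j) ∈ jointEig B (c j) := fun j k => by
    rw [← hAB, hf j k, map_smul]
  have h := mem_of_sum_mem B hc ⊥ (by simp) (insert i f.support)
    (fun j => π (f j) - if j = i then π x else 0) (fun j _ => by
      split_ifs with h
      · subst h; exact sub_mem (hf' j) hy
      · rw [sub_zero]; exact hf' j) (by
      rw [Finset.sum_sub_distrib, Finset.sum_ite_eq', if_pos (Finset.mem_insert_self _ _)]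
      rw [Finset.sum_subset (Finset.subset_insert i f.support)] at hfx
      · rw [← map_sum, hfx, sub_self]; exact zero_mem _
      · intro j _ hj; simpa using hj) i (Finset.mem_insert_self _ _)
  simpa [sub_eq_zero] using h

lemma iSup_jointEig_of_surjective {A : τ → Module.End K X} {B : τ → Module.End K Y} {c : ι → τ → K}
    (hspan : ⨆ i, jointEig A (c i) = ⊤) (π : X →ₗ[K] Y)
    (hπ : Function.Surjective π) (hAB : ∀ i x, π (A i x) = B i (π x)) :
    ⨆ i, jointEig B (c i) = ⊤ := by
  rw [eq_top_iff]
  intro y _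
  obtain ⟨x, rfl⟩ := hπ y
  obtain ⟨f, hf, rfl⟩ := exists_components hspan x
  rw [map_sum]
  refine sum_mem fun j _ => Submodule.mem_iSup_of_mem j fun k => ?_
  rw [← hAB, hf j k, map_smul]

lemma eq_zero_of_apply_apply_eq_zero {A : Module.End K X} (hA : ⨆ μ, A.eigenspace μ = ⊤) {x : X}
    (hx : A (A x) = 0) : A x = 0 := by
  have hX : x ∈ ⨆ μ, A.eigenspace μ := hA ▸ Submodule.mem_top
  obtain ⟨f, hf, rfl⟩ := (Submodule.mem_iSup_iff_exists_finsupp _ _).1 hX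
  have hf' : ∀ μ, A (f μ) = μ • f μ := fun μ => Module.End.mem_eigenspace_iff.1 (hf μ)
  have h := mem_of_sum_mem (fun _ : Unit => A) (c := fun (μ : K) _ => μ)
    (fun a b h => congrFun h ()) ⊥ (by simp) f.support (fun μ => A (A (f μ)))
    (fun μ _ _ => by simp only [hf', map_smul]) (by
      rw [← map_sum, ← map_sum]; exact hx)
  rw [Finsupp.sum, map_sum]
  refine Finset.sum_eq_zero fun μ hμ => ?_
  have h1 := (Submodule.mem_bot K).1 (h μ hμ)
  rw [hf', map_smul, hf', smul_smul] at h1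
  rw [hf']
  rcases smul_eq_zero.1 h1 with h1 | h1
  · rw [mul_self_eq_zero.1 h1, zero_smul]
  · rw [h1, smul_zero]

end JointEigenspaces

section MaximalTori

open LieModule

variable {K L : Type} [Field K] [CharZero K] [IsAlgClosed K]
  [LieRing L] [LieAlgebra K L]

/-- The centralizer of a subset. -/
def centr (K : Type) {L : Type} [Field K] [LieRing L] [LieAlgebra K L] (s : Set L) :
    LieSubalgebra K L where
  carrier := {x | ∀ t ∈ s, ⁅t, x⁆ = 0}
  add_mem' := by intro a b ha hb t ht; rw [lie_add, ha t ht, hb t ht, add_zero]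
  zero_mem' := by intro t _; rw [lie_zero]
  smul_mem' := by intro c x hx t ht; rw [lie_smul, hx t ht, smul_zero]
  lie_mem' := by
    intro x y hx hy t ht
    rw [leibniz_lie, hx t ht, hy t ht, zero_lie, lie_zero, add_zero]

lemma exists_cartan_ge [FiniteDimensional K L] (s : Set L) (hs : s ⊆ centr K s)
    (hd : ∀ t ∈ s, ⨆ μ, (toEnd K L L t).eigenspace μ = ⊤) :
    ∃ H : LieSubalgebra K L, H.IsCartanSubalgebra ∧ s ⊆ H ∧ H ≤ centr K s := by
  have : Infinite K := IsAlgClosed.instInfinite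
  obtain ⟨x, hx⟩ := LieAlgebra.exists_isCartanSubalgebra_engel K (centr K s)
  set H' := LieSubalgebra.engel K x
  have hself : H'.normalizer = H' := hx.self_normalizing
  have hmem : ∀ y : L, y ∈ H'.map (centr K s).incl ↔ ∃ h : y ∈ centr K s, (⟨y, h⟩ : centr K s) ∈ H' := by
    intro y
    rw [LieSubalgebra.mem_map]
    constructor
    · rintro ⟨z, hz, rfl⟩
      exact ⟨z.2, hz⟩
    · rintro ⟨h, h'⟩
      exact ⟨_, h', rfl⟩
  have hsH : s ⊆ H'.map (centr K s).incl := by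
    intro t ht
    refine (hmem t).2 ⟨hs ht, ?_⟩
    rw [← hself, LieSubalgebra.mem_normalizer_iff]
    intro y _
    have : ⁅(⟨t, hs ht⟩ : centr K s), y⁆ = 0 := Subtype.ext (y.2 t ht)
    rw [this]
    exact zero_mem _
  have hle : H'.map (centr K s).incl ≤ centr K s := fun y hy => ((hmem y).1 hy).1
  refine ⟨H'.map (centr K s).incl, ⟨?_, ?_⟩, hsH, hle⟩
  · have hn : LieRing.IsNilpotent H' := inferInstance
    let e : H' →ₗ⁅K⁆ H'.map (centr K s).incl :=
      { toFun := fun z => ⟨z.1.1, (hmem _).2 ⟨z.1.2, z.2⟩⟩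
        map_add' := fun _ _ => rfl
        map_smul' := fun _ _ => rfl
        map_lie' := fun {_ _} => rfl }
    have he : Function.Surjective e := by
      rintro ⟨y, hy⟩
      obtain ⟨h, h'⟩ := (hmem y).1 hy
      exact ⟨⟨⟨y, h⟩, h'⟩, rfl⟩
    exact he.lieAlgebra_isNilpotent
  · refine le_antisymm ?_ (LieSubalgebra.le_normalizer _)
    intro y hy
    rw [LieSubalgebra.mem_normalizer_iff] at hy
    have hyc : y ∈ centr K s := by
      intro t ht
      have h1 := hle (hy t (hsH ht)) t ht
      have h2 : ⁅t, ⁅t, y⁆⁆ = 0 := by rw [← lie_skew t y, lie_neg, h1, neg_zero]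
      exact eq_zero_of_apply_apply_eq_zero (hd t ht) h2
    refine (hmem y).2 ⟨hyc, ?_⟩
    rw [← hself, LieSubalgebra.mem_normalizer_iff]
    intro z hz
    obtain ⟨h, h'⟩ := (hmem _).1 (hy z.1 ((hmem _).2 ⟨z.2, hz⟩))
    exact h'

omit [CharZero K] [IsAlgClosed K] in
lemma isTriple_of_isSl2Triple {h e f : L} (htr : IsSl2Triple h e f) : IsTriple K e f :=
  ⟨by rw [htr.lie_e_f, htr.lie_h_e_nsmul, two_smul, two_smul],
    by rw [htr.lie_e_f, htr.lie_h_f_nsmul, two_smul, two_smul]⟩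

/-- `T` is a maximal toral subalgebra of `L`. -/
structure MaxTorus (T : LieSubalgebra K L) : Prop where
  comm : ∀ x ∈ T, ∀ y ∈ T, ⁅x, y⁆ = 0
  span : ⨆ α : Module.Dual K T, adWeightSpace K L T α = ⊤
  max : ∀ x, (∀ t ∈ T, ⁅t, x⁆ = 0) → (⨆ μ, (toEnd K L L x).eigenspace μ = ⊤) → x ∈ T

omit [CharZero K] [IsAlgClosed K] in
lemma lie_mem_adWeightSpace {T : LieSubalgebra K L} {α β : Module.Dual K T} {x y : L}
    (hx : x ∈ adWeightSpace K L T α) (hy : y ∈ adWeightSpace K L T β) :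
    ⁅x, y⁆ ∈ adWeightSpace K L T (α + β) := by
  intro t
  rw [leibniz_lie, hx t, hy t, smul_lie, lie_smul, ← add_smul]
  rfl

namespace MaxTorus

variable {T : LieSubalgebra K L} (hT : MaxTorus T)
include hT

lemma iSup_eigenspace {t : L} (ht : t ∈ T) : ⨆ μ, (toEnd K L L t).eigenspace μ = ⊤ := by
  rw [eq_top_iff, ← hT.span]
  refine iSup_le fun α => le_trans ?_ (le_iSup _ (α ⟨t, ht⟩))
  intro x hx
  exact Module.End.mem_eigenspace_iff.2 (hx ⟨t, ht⟩)

lemma lie_mem_of_triple [FiniteDimensional K L] {α : Module.Dual K T} {e f : L} (h : IsTriple K e f)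
    (he : e ∈ adWeightSpace K L T α) (hf : f ∈ adWeightSpace K L T (-α)) : ⁅e, f⁆ ∈ T := by
  refine hT.max _ (fun t ht => ?_) ?_
  · have := lie_mem_adWeightSpace he hf ⟨t, ht⟩
    rwa [add_neg_cancel, LinearMap.zero_apply, zero_smul] at this
  · exact (h.sl2Ops (V := L)).iSup_eigenspace

lemma exists_lift {M : Type} [LieRing M] [LieAlgebra K M] (π : L →ₗ⁅K⁆ M)
    (hπ : Function.Surjective π) (α : Module.Dual K T) {q : M}
    (hq : ∀ t : T, ⁅π t, q⁆ = α t • q) : ∃ x ∈ adWeightSpace K L T α, π x = q := by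
  exact exists_lift_jointEig (c := fun α : Module.Dual K T => (α : T → K))
    (A := fun t : T => toEnd K L L (t : L)) (B := fun t : T => toEnd K M M (π t))
    DFunLike.coe_injective hT.span (π : L →ₗ[K] M) hπ
    (fun i x => LieHom.map_lie π _ _) hq

variable [FiniteDimensional K L]

lemma exists_lift_triple (α : Module.Dual K T) {e f : L ⧸ LieAlgebra.radical K L}
    (he : ∀ t : T, ⁅qmk (LieAlgebra.radical K L) (t : L), e⁆ = α t • e)
    (hf : ∀ t : T, ⁅qmk (LieAlgebra.radical K L) (t : L), f⁆ = -α t • f)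
    (h : IsTriple K e f) :
    ∃ x ∈ adWeightSpace K L T α, ∃ y ∈ adWeightSpace K L T (-α),
      qmk (LieAlgebra.radical K L) x = e ∧ qmk (LieAlgebra.radical K L) y = f ∧
        IsTriple K x y := by
  obtain ⟨x, hx, rfl⟩ := hT.exists_lift _ (qmk_surjective _) α he
  obtain ⟨y, hy, rfl⟩ := hT.exists_lift _ (qmk_surjective _) (-α) hf
  have hw : ∀ {β γ δ : Module.Dual K T}, β + γ = δ → ∀ x ∈ adWeightSpace K L T β,
      ∀ y ∈ adWeightSpace K L T γ, ⁅x, y⁆ ∈ adWeightSpace K L T δ := by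
    rintro β γ δ rfl x hx y hy
    exact lie_mem_adWeightSpace hx hy
  obtain ⟨x', hx', y', hy', hxx, hyy, ht⟩ := lift_triple _ le_rfl (LieAlgebra.radical K L)
    inferInstance (Xp := adWeightSpace K L T α) (X0 := adWeightSpace K L T 0)
    (Xm := adWeightSpace K L T (-α)) (hw (add_neg_cancel α)) (hw (zero_add α)) (hw (zero_add _))
    hx hy (by
      rw [← qmk_eq_zero, map_sub, LieHom.map_lie, LieHom.map_lie, h.1, map_smul, sub_self])
    (by
      rw [← qmk_eq_zero, map_add, LieHom.map_lie, LieHom.map_lie, h.2, map_smul,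
        neg_add_cancel])
  rw [← qmk_eq_zero, map_sub, sub_eq_zero] at hxx hyy
  exact ⟨x', hx', y', hy', hxx, hyy, ht⟩

lemma exists_cartan : ∃ H : LieSubalgebra K (L ⧸ LieAlgebra.radical K L), H.IsCartanSubalgebra ∧
    (∀ q, q ∈ H ↔ ∃ t ∈ T, qmk (LieAlgebra.radical K L) t = q) := by
  set π := qmk (LieAlgebra.radical K L)
  obtain ⟨H, hH, hsH, hHs⟩ := exists_cartan_ge (K := K) (π '' (T : Set L)) (by
      rintro _ ⟨t, ht, rfl⟩ _ ⟨t', ht', rfl⟩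
      rw [← LieHom.map_lie, hT.comm _ ht' _ ht, map_zero]) (by
      rintro _ ⟨t, ht, rfl⟩
      have h := iSup_jointEig_of_surjective (A := fun _ : Unit => toEnd K L L t)
        (B := fun _ : Unit => toEnd K _ _ (π t)) (c := fun (μ : K) (_ : Unit) => μ) (by
          rw [← hT.iSup_eigenspace ht]
          refine iSup_congr fun μ => ?_
          ext x
          rw [Module.End.mem_eigenspace_iff]
          exact ⟨fun h => h (), fun h _ => h⟩) (π : L →ₗ[K] L ⧸ LieAlgebra.radical K L)
        (qmk_surjective _) (fun _ x => LieHom.map_lie π t x)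
      rw [← h]
      refine iSup_congr fun μ => ?_
      ext x
      rw [Module.End.mem_eigenspace_iff]
      exact ⟨fun h _ => h, fun h => h ()⟩)
  refine ⟨H, hH, fun q => ⟨fun hq => ?_, ?_⟩⟩
  swap
  · rintro ⟨t, ht, rfl⟩
    exact hsH ⟨t, ht, rfl⟩
  have hspan := (inferInstance : (LieAlgebra.IsKilling.rootSystem H).IsRootSystem).span_coroot_eq_top
  have hqm : (⟨q, hq⟩ : H) ∈ Submodule.span K
    (Set.range (LieAlgebra.IsKilling.rootSystem H).coroot) := hspan ▸ Submodule.mem_top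
  have key : ∀ z : H, z ∈ Submodule.span K (Set.range (LieAlgebra.IsKilling.rootSystem H).coroot) →
      ∃ t ∈ T, π t = z := by
    intro z hz
    induction hz using Submodule.span_induction with
    | zero => exact ⟨0, zero_mem _, map_zero _⟩
    | add a b _ _ iha ihb =>
      obtain ⟨s, hs, hs'⟩ := iha
      obtain ⟨t, ht, ht'⟩ := ihb
      exact ⟨s + t, add_mem hs ht, by rw [map_add, hs', ht']; rfl⟩
    | smul c a _ iha =>
      obtain ⟨s, hs, hs'⟩ := iha
      exact ⟨c • s, T.smul_mem c hs, by rw [map_smul, hs']; rfl⟩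
    | mem z hz =>
      obtain ⟨⟨α, hα⟩, rfl⟩ := hz
      have hα' : α.IsNonZero := by simpa [LieSubalgebra.root] using hα
      obtain ⟨h, e, f, htr, he, hf⟩ :=
        LieAlgebra.IsKilling.exists_isSl2Triple_of_weight_isNonZero hα'
      have hco := htr.h_eq_coroot hα' he hf
      let χ : Module.Dual K T :=
        { toFun := fun t => α ⟨π t, hsH ⟨t, t.2, rfl⟩⟩
          map_add' := fun s t => by
            rw [← Weight.toLinear_apply, ← Weight.toLinear_apply, ← Weight.toLinear_apply,
              ← map_add]
            congr 1
          map_smul' := fun c t => by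
            rw [← Weight.toLinear_apply, ← Weight.toLinear_apply, RingHom.id_apply,
              ← map_smul]
            congr 1 }
      obtain ⟨x, hx, y, hy, hxe, hyf, ht⟩ := hT.exists_lift_triple χ (e := e) (f := f)
        (fun t => LieAlgebra.IsKilling.lie_eq_smul_of_mem_rootSpace he ⟨π t, hsH ⟨t, t.2, rfl⟩⟩)
        (fun t => LieAlgebra.IsKilling.lie_eq_smul_of_mem_rootSpace hf ⟨π t, hsH ⟨t, t.2, rfl⟩⟩)
        (isTriple_of_isSl2Triple htr)
      refine ⟨⁅x, y⁆, hT.lie_mem_of_triple ht hx hy, ?_⟩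
      rw [LieHom.map_lie, hxe, hyf, htr.lie_e_f, hco]
      rfl
  exact key _ hqm

end MaxTorus

end MaximalTori

section Principal

open LieModule LieAlgebra LieAlgebra.IsKilling

variable {K Q : Type} [Field K] [CharZero K] [IsAlgClosed K]
  [LieRing Q] [LieAlgebra K Q] [FiniteDimensional K Q] [LieAlgebra.IsKilling K Q]

lemma exists_height (H : LieSubalgebra K Q) [H.IsCartanSubalgebra]
    (b : (rootSystem H).Base) : ∃ h : H, (∀ j ∈ b.support, j.1 h = 2) ∧
      ∀ i : H.root, ∃ k : ℤ, k ≠ 0 ∧ i.1 h = 2 * k := by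
  set h : H := (Module.evalEquiv K H).symm (b.toWeightBasis.constr K (fun _ => (2 : K)))
  have hj : ∀ j ∈ b.support, j.1 h = 2 := by
    intro j hj
    have h1 := Module.apply_evalEquiv_symm_apply (R := K) (M := H) ((rootSystem H).root j)
      (b.toWeightBasis.constr K (fun _ => (2 : K)))
    have h2 := b.toWeightBasis.constr_basis K (fun _ => (2 : K)) ⟨j, hj⟩
    rw [RootPairing.Base.toWeightBasis_apply] at h2
    rw [h2] at h1
    exact h1
  refine ⟨h, hj, fun i => ⟨b.height i, b.height_ne_zero i, ?_⟩⟩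
  obtain ⟨f, -, -, hf⟩ := b.exists_root_eq_sum_int i
  have h1 := congrArg (fun l : Module.Dual K H => l h) hf
  simp only [rootSystem_root_apply, LinearMap.sum_apply, LinearMap.smul_apply] at h1
  rw [RootPairing.Base.height_eq_sum hf, Int.cast_sum, Finset.mul_sum]
  refine h1.trans (Finset.sum_congr rfl fun j hjs => ?_)
  rw [Weight.toLinear_apply, hj j hjs, zsmul_eq_mul, mul_comm]

theorem exists_principal (H : LieSubalgebra K Q) [H.IsCartanSubalgebra] :
    ∃ h ∈ H, ∃ e f : Q, ⁅e, f⁆ = h ∧ ⁅h, e⁆ = (2 : K) • e ∧ ⁅h, f⁆ = -((2 : K) • f) ∧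
      H.toSubmodule ⊔ (⨆ k : {k : ℤ // k ≠ 0}, (toEnd K Q Q h).eigenspace (2 * (k.1 : K))) = ⊤ := by
  obtain ⟨b⟩ := (rootSystem H).nonempty_base
  obtain ⟨h, hs, hr⟩ := exists_height H b
  have hnz : ∀ i : H.root, i.1.IsNonZero := fun i => LieSubalgebra.isNonZero_coe_root i
  choose h' e f htr he hf using fun i : H.root => exists_isSl2Triple_of_weight_isNonZero (hnz i)
  have hco : ∀ i, h' i = coroot i.1 := fun i => (htr i).h_eq_coroot (hnz i) (he i) (hf i)
  set c := b.toCoweightBasis.repr h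
  have hsum : (h : Q) = ∑ j : b.support, c j • h' j := by
    have h1 := congrArg (fun z : H => (z : Q)) (b.toCoweightBasis.sum_repr h).symm
    simp only [RootPairing.Base.toCoweightBasis_apply] at h1
    refine h1.trans ?_
    push_cast
    exact Finset.sum_congr rfl fun j _ => by rw [hco]; rfl
  have hef : ∀ i j : b.support, i ≠ j → ⁅e i, f j⁆ = 0 := by
    intro i j hij
    have h1 := lie_mem_genWeightSpace_of_mem_genWeightSpace (he i) (hf j)
    rw [← sub_eq_add_neg] at h1
    by_contra hne
    have hw : genWeightSpace Q (⇑(i.1.1) - ⇑(j.1.1)) ≠ ⊥ := by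
      intro h0
      rw [h0] at h1
      exact hne ((LieSubmodule.mem_bot _).1 h1)
    let χ : Weight K H Q := ⟨_, hw⟩
    have hχ : χ.IsNonZero := by
      intro h0
      refine hij (Subtype.ext (Subtype.ext (Weight.ext fun x => ?_)))
      have := congrFun h0 x
      exact sub_eq_zero.1 this
    refine b.sub_notMem_range_root i.2 j.2 ⟨⟨χ, by simpa [LieSubalgebra.root] using hχ⟩, ?_⟩
    rfl
  have hhe : ∀ j ∈ b.support, ⁅(h : Q), e j⁆ = (2 : K) • e j := by
    intro j hj
    have := lie_eq_smul_of_mem_rootSpace (he j) h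
    rwa [hs j hj] at this
  have hhf : ∀ j ∈ b.support, ⁅(h : Q), f j⁆ = -((2 : K) • f j) := by
    intro j hj
    have := lie_eq_smul_of_mem_rootSpace (hf j) h
    rwa [Pi.neg_apply, hs j hj, neg_smul] at this
  refine ⟨h, h.2, ∑ j : b.support, e j, ∑ j : b.support, c j • f j, ?_, ?_, ?_, ?_⟩
  · rw [hsum, sum_lie_sum]
    refine Finset.sum_congr rfl fun i _ => ?_
    rw [Finset.sum_eq_single i]
    · rw [lie_smul, (htr i).lie_e_f]
    · intro j _ hj
      rw [lie_smul, hef i j hj.symm, smul_zero]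
    · intro hi
      exact (hi (Finset.mem_univ _)).elim
  · rw [lie_sum, Finset.smul_sum]
    exact Finset.sum_congr rfl fun j _ => hhe j j.2
  · rw [lie_sum, Finset.smul_sum, ← Finset.sum_neg_distrib]
    refine Finset.sum_congr rfl fun j _ => ?_
    rw [lie_smul, hhf j j.2, smul_neg, smul_comm]
  · have htop := congrArg LieSubmodule.toSubmodule (iSup_genWeightSpace_eq_top' K H Q)
    rw [LieSubmodule.iSup_toSubmodule, LieSubmodule.top_toSubmodule] at htop
    rw [eq_top_iff, ← htop]
    refine iSup_le fun χ => ?_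
    by_cases hχ : χ.IsZero
    · have h0 : (χ : H → K) = 0 := hχ
      rw [h0]
      refine le_trans (le_of_eq ?_) le_sup_left
      have := rootSpace_zero_eq K Q H
      exact (congrArg LieSubmodule.toSubmodule this).trans rfl
    · obtain ⟨k, hk, hk'⟩ := hr ⟨χ, by simpa [LieSubalgebra.root] using hχ⟩
      refine le_trans (le_trans ?_ (le_iSup _ ⟨k, hk⟩)) le_sup_right
      intro x hx
      have := lie_eq_smul_of_mem_rootSpace hx h
      rw [hk'] at this
      exact Module.End.mem_eigenspace_iff.2 this

end Principal

section Closure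

variable {K L M : Type*} [Field K] [LieRing L] [LieAlgebra K L] [AddCommGroup M] [Module K M]

/-- A vector which is an eigenvector modulo `p` for a complement `B` of `A` generates, modulo `p`,
a submodule contained in any `A`-stable subspace containing it. -/
lemma exists_stable_le (ρ : L →ₗ[K] Module.End K M)
    (hρ : ∀ x y m, ρ ⁅x, y⁆ m = ρ x (ρ y m) - ρ y (ρ x m)) {A B : Set L}
    (hAB : ∀ x, ∃ a ∈ A, ∃ b ∈ B, x = a + b) {p : Submodule K M}
    (hp : ∀ x, ∀ m ∈ p, ρ x m ∈ p) {v : M} (hv : ∀ b ∈ B, ∃ c : K, ρ b v - c • v ∈ p)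
    {W : Submodule K M} (hpW : p ≤ W) (hvW : v ∈ W) (hW : ∀ a ∈ A, ∀ w ∈ W, ρ a w ∈ W) :
    ∃ Y : Submodule K M, (∀ x, ∀ m ∈ Y, ρ x m ∈ Y) ∧ v ∈ Y ∧ p ≤ Y ∧ Y ≤ W := by
  set S : Set (Submodule K M) := {X | (∀ a ∈ A, ∀ w ∈ X, ρ a w ∈ X) ∧ v ∈ X ∧ p ≤ X}
  have hY : sInf S ∈ S := by
    refine ⟨fun a ha w hw => ?_, ?_, ?_⟩
    · rw [Submodule.mem_sInf] at hw ⊢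
      exact fun X hX => hX.1 a ha w (hw X hX)
    · rw [Submodule.mem_sInf]
      exact fun X hX => hX.2.1
    · exact le_sInf fun X hX => hX.2.2
  refine ⟨sInf S, ?_, hY.2.1, hY.2.2, sInf_le ⟨hW, hvW, hpW⟩⟩
  let X : Submodule K M :=
    { carrier := {w | w ∈ sInf S ∧ ∀ x, ρ x w ∈ sInf S}
      add_mem' := fun {a b} ha hb => ⟨add_mem ha.1 hb.1, fun x => by
        rw [map_add]; exact add_mem (ha.2 x) (hb.2 x)⟩
      zero_mem' := ⟨zero_mem _, fun x => by rw [map_zero]; exact zero_mem _⟩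
      smul_mem' := fun c a ha => ⟨Submodule.smul_mem _ c ha.1, fun x => by
        rw [map_smul]; exact Submodule.smul_mem _ c (ha.2 x)⟩ }
  have hX : X ∈ S := by
    refine ⟨fun a ha w hw => ⟨hY.1 a ha w hw.1, fun x => ?_⟩, ⟨hY.2.1, fun x => ?_⟩,
      fun m hm => ⟨hY.2.2 hm, fun x => hY.2.2 (hp x m hm)⟩⟩
    · have h := hρ x a w
      rw [eq_sub_iff_add_eq] at h
      rw [← h]
      exact add_mem (hw.2 _) (hY.1 a ha _ (hw.2 x))
    · obtain ⟨a, ha, b, hb, rfl⟩ := hAB x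
      obtain ⟨c, hc⟩ := hv b hb
      rw [map_add, LinearMap.add_apply]
      refine add_mem (hY.1 a ha v hY.2.1) ?_
      have := add_mem (hY.2.2 hc) (Submodule.smul_mem _ c hY.2.1)
      rwa [sub_add_cancel] at this
  exact fun x m hm => (sInf_le hX hm : m ∈ X).2 x

end Closure

section TripleLifting

open LieModule

variable {K L : Type} [Field K] [CharZero K] [LieRing L] [LieAlgebra K L]

lemma lie_center_right {x y : L} (hy : y ∈ LieAlgebra.center K L) : ⁅x, y⁆ = 0 :=
  mem_center_iff'.1 hy x

lemma lie_pow_eq_zero {N : LieIdeal K L}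
    (hN : ∀ x ∈ N, ∀ y ∈ N, ⁅x, y⁆ ∈ LieAlgebra.center K L) (f : L) {v : L} (hv : v ∈ N) (m : ℕ) :
    ⁅(toEnd K L L f ^ (2 * m)) v, v⁆ = 0 := by
  have hmem : ∀ k, (toEnd K L L f ^ k) v ∈ N := by
    intro k
    induction k with
    | zero => exact hv
    | succ k ih =>
      rw [pow_succ', Module.End.mul_apply]
      exact LieSubmodule.lie_mem N ih
  have key : ∀ k j, ⁅(toEnd K L L f ^ k) v, (toEnd K L L f ^ j) v⁆ =
      (-1 : K) ^ k • ⁅v, (toEnd K L L f ^ (k + j)) v⁆ := by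
    intro k
    induction k with
    | zero => intro j; simp
    | succ k ih =>
      intro j
      have h0 : ⁅f, ⁅(toEnd K L L f ^ k) v, (toEnd K L L f ^ j) v⁆⁆ = 0 :=
        lie_center_right (hN _ (hmem k) _ (hmem j))
      have h2 := ih (j + 1)
      rw [leibniz_lie] at h0
      rw [pow_succ' _ j, Module.End.mul_apply, toEnd_apply_apply] at h2
      rw [pow_succ' _ k, Module.End.mul_apply, toEnd_apply_apply, eq_neg_of_add_eq_zero_left h0,
        h2, pow_succ, mul_neg_one, neg_smul, show k + (j + 1) = k + 1 + j by ring]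
  have h1 := key (2 * m) 0
  rw [pow_zero, Module.End.one_apply, add_zero, Even.neg_one_pow (even_two_mul m), one_smul,
    ← lie_skew] at h1
  have h2 : (2 : K) • ⁅v, (toEnd K L L f ^ (2 * m)) v⁆ = 0 := by
    linear_combination (norm := module) -h1
  rw [← lie_skew, (smul_eq_zero.1 h2).resolve_left two_ne_zero, neg_zero]

lemma lie_eq_zero_of_principal {N : LieIdeal K L}
    (hN : ∀ x ∈ N, ∀ y ∈ N, ⁅x, y⁆ ∈ LieAlgebra.center K L) {e f t v y : L} (hv : v ∈ N) (m : ℕ)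
    (htv : ⁅t, v⁆ = (2 * m : K) • v) (htf : ⁅t, f⁆ = -((2 : K) • f))
    (hev : ⁅e, v⁆ ∈ LieAlgebra.center K L)
    (hr : ∀ w ∈ N, ⁅⁅e, f⁆ - t, w⁆ ∈ LieAlgebra.center K L) (hy : y ∈ N) {c : K}
    (hc : (toEnd K L L e ^ (2 * m)) y - c • v ∈ LieAlgebra.center K L) : ⁅v, y⁆ = 0 := by
  set F := toEnd K L L f
  set E := toEnd K L L e
  have hmem : ∀ k, (F ^ k) v ∈ N := by
    intro k
    induction k with
    | zero => exact hv
    | succ k ih =>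
      rw [pow_succ', Module.End.mul_apply]
      exact LieSubmodule.lie_mem N ih
  have hmemy : ∀ k, (E ^ k) y ∈ N := by
    intro k
    induction k with
    | zero => exact hy
    | succ k ih =>
      rw [pow_succ', Module.End.mul_apply]
      exact LieSubmodule.lie_mem N ih
  have hwt : ∀ k : ℕ, ⁅t, (F ^ k) v⁆ = (2 * m - 2 * k : K) • (F ^ k) v := by
    intro k
    induction k with
    | zero => rw [pow_zero, Module.End.one_apply, htv]; simp
    | succ k ih =>
      rw [pow_succ', Module.End.mul_apply]
      change ⁅t, ⁅f, _⁆⁆ = _ • ⁅f, _⁆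
      rw [leibniz_lie, htf, ih, neg_lie, smul_lie, lie_smul]
      push_cast
      module
  have hA : ∀ k : ℕ, ⁅e, (F ^ (k + 1)) v⁆ - ((k + 1) * (2 * m - k) : K) • (F ^ k) v ∈
      LieAlgebra.center K L := by
    intro k
    have hs : ∀ k : ℕ, ⁅e, (F ^ (k + 1)) v⁆ = ⁅⁅e, f⁆ - t, (F ^ k) v⁆ +
        (2 * m - 2 * k : K) • (F ^ k) v + ⁅f, ⁅e, (F ^ k) v⁆⁆ := by
      intro k
      rw [pow_succ', Module.End.mul_apply, ← hwt k, sub_lie]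
      change ⁅e, ⁅f, _⁆⁆ = _
      rw [leibniz_lie e f]
      abel
    induction k with
    | zero =>
      rw [hs 0, pow_zero, Module.End.one_apply, lie_center_right hev]
      have := hr v hv
      convert this using 1
      push_cast
      module
    | succ k ih =>
      have h1 : ⁅f, ⁅e, (F ^ (k + 1)) v⁆⁆ = ((k + 1) * (2 * m - k) : K) • (F ^ (k + 1)) v := by
        have := lie_center_right (x := f) ih
        rw [lie_sub, sub_eq_zero] at this
        rw [this, lie_smul, pow_succ', Module.End.mul_apply]
        rfl
      rw [hs (k + 1), h1]
      have := hr _ (hmem (k + 1))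
      convert this using 1
      push_cast
      module
  have hstep : ∀ k : ℕ, ((k + 1) * (2 * m - k) : K) • ⁅(F ^ k) v, (E ^ k) y⁆ +
      ⁅(F ^ (k + 1)) v, (E ^ (k + 1)) y⁆ = 0 := by
    intro k
    have h0 : ⁅e, ⁅(F ^ (k + 1)) v, (E ^ k) y⁆⁆ = 0 :=
      lie_center_right (hN _ (hmem (k + 1)) _ (hmemy k))
    have h1 : ⁅⁅e, (F ^ (k + 1)) v⁆ - ((k + 1) * (2 * m - k) : K) • (F ^ k) v, (E ^ k) y⁆ = 0 :=
      lie_center_left (hA k)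
    rw [leibniz_lie] at h0
    rw [sub_lie, sub_eq_zero, smul_lie] at h1
    rw [h1] at h0
    rw [pow_succ' E, Module.End.mul_apply]
    exact h0
  have hlast : ⁅(F ^ (2 * m)) v, (E ^ (2 * m)) y⁆ = 0 := by
    have h1 := lie_center_right (x := (F ^ (2 * m)) v) hc
    rw [lie_sub, lie_smul, lie_pow_eq_zero hN f hv m, smul_zero, sub_zero] at h1
    exact h1
  have hdesc : ∀ k ≤ 2 * m, ⁅(F ^ (2 * m - k)) v, (E ^ (2 * m - k)) y⁆ = 0 := by
    intro k
    induction k with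
    | zero => intro _; exact hlast
    | succ k ih =>
      intro hk
      have h1 := hstep (2 * m - (k + 1))
      rw [show 2 * m - (k + 1) + 1 = 2 * m - k by omega, ih (by omega), add_zero] at h1
      refine (smul_eq_zero.1 h1).resolve_left ?_
      obtain ⟨j, hj⟩ : ∃ j, 2 * m = j + (k + 1) := ⟨2 * m - (k + 1), by omega⟩
      rw [show 2 * m - (k + 1) = j by omega]
      have hj' : (2 * m : K) = j + (k + 1) := by exact_mod_cast hj
      rw [hj', add_sub_cancel_left]
      exact_mod_cast mul_ne_zero (Nat.succ_ne_zero j) (Nat.succ_ne_zero k)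
  have := hdesc (2 * m) le_rfl
  simpa using this

end TripleLifting

section TorusTriples

open LieModule

variable {K L : Type} [Field K] [CharZero K] [IsAlgClosed K] [LieRing L] [LieAlgebra K L]
  [FiniteDimensional K L] {T : LieSubalgebra K L}

namespace MaxTorus

variable (hT : MaxTorus T)
include hT

lemma iSup_jointEig_unit {t : L} (ht : t ∈ T) :
    ⨆ μ : K, jointEig (fun _ : Unit => toEnd K L L t) (fun _ => μ) = ⊤ := by
  rw [← hT.iSup_eigenspace ht]
  refine iSup_congr fun μ => ?_
  ext x
  rw [Module.End.mem_eigenspace_iff]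
  exact ⟨fun h => h (), fun h _ => h⟩

lemma exists_lift_eigenvector {t : L} (ht : t ∈ T) {M : Type} [LieRing M] [LieAlgebra K M]
    (π : L →ₗ⁅K⁆ M) (hπ : Function.Surjective π) {μ : K} {q : M} (hq : ⁅π t, q⁆ = μ • q) :
    ∃ x, ⁅t, x⁆ = μ • x ∧ π x = q := by
  obtain ⟨x, hx, h⟩ := exists_lift_jointEig (c := fun (μ : K) (_ : Unit) => μ)
    (fun a b h => congrFun h ()) (hT.iSup_jointEig_unit ht) (π : L →ₗ[K] M) hπ
    (B := fun _ : Unit => toEnd K M M (π t)) (fun i x => LieHom.map_lie π _ _)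
    (i := μ) (y := q) (fun _ => hq)
  exact ⟨x, hx (), h⟩

lemma exists_principal : ∃ t ∈ T, ∃ e f : L, ⁅t, e⁆ = (2 : K) • e ∧ ⁅t, f⁆ = -((2 : K) • f) ∧
    ⁅e, f⁆ - t ∈ LieAlgebra.radical K L ∧
    (LieAlgebra.radical K L).toSubmodule ⊔ (T.toSubmodule ⊔
      ⨆ k : {k : ℤ // k ≠ 0}, (toEnd K L L t).eigenspace (2 * (k.1 : K))) = ⊤ := by
  obtain ⟨H, hH, hHT⟩ := hT.exists_cartan
  set π := qmk (LieAlgebra.radical K L)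
  obtain ⟨h, hh, e', f', hef, he, hf, hspan⟩ := Paper.exists_principal H
  obtain ⟨t, ht, rfl⟩ := (hHT h).1 hh
  obtain ⟨e, hte, rfl⟩ := hT.exists_lift_eigenvector ht π (qmk_surjective _) he
  rw [← neg_smul] at hf
  obtain ⟨f, htf, rfl⟩ := hT.exists_lift_eigenvector ht π (qmk_surjective _) hf
  refine ⟨t, ht, e, f, hte, by rw [htf, neg_smul], ?_, ?_⟩
  · rw [← qmk_eq_zero, map_sub, LieHom.map_lie, sub_eq_zero]
    exact hef
  · set S := T.toSubmodule ⊔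
      ⨆ k : {k : ℤ // k ≠ 0}, (toEnd K L L t).eigenspace (2 * (k.1 : K))
    have hS : S.map (π : L →ₗ[K] L ⧸ LieAlgebra.radical K L) = ⊤ := by
      rw [eq_top_iff, ← hspan]
      refine sup_le ?_ (iSup_le fun k => ?_)
      · intro q hq
        obtain ⟨s, hs, rfl⟩ := (hHT q).1 hq
        exact ⟨s, Submodule.mem_sup_left hs, rfl⟩
      · intro q hq
        obtain ⟨x, hx, rfl⟩ := hT.exists_lift_eigenvector ht π (qmk_surjective _)
          (Module.End.mem_eigenspace_iff.1 hq)
        refine ⟨x, Submodule.mem_sup_right (le_iSup (fun k : {k : ℤ // k ≠ 0} =>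
          (toEnd K L L t).eigenspace (2 * (k.1 : K))) k (Module.End.mem_eigenspace_iff.2 hx)), rfl⟩
    rw [eq_top_iff]
    intro x _
    obtain ⟨s, hs, hsx⟩ := (hS ▸ Submodule.mem_top : π x ∈ S.map (π : L →ₗ[K] L ⧸ LieAlgebra.radical K L))
    have hsx' : π s = π x := hsx
    have : x - s ∈ LieAlgebra.radical K L := by
      rw [← qmk_eq_zero, map_sub, sub_eq_zero]
      exact hsx'.symm
    rw [← sub_add_cancel x s]
    exact add_mem (Submodule.mem_sup_left this) (Submodule.mem_sup_right hs)

omit hT in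
/-- The part of the nilpotent radical of degree `2 k` for `t`. -/
def nilPart (t : L) (k : ℤ) : Submodule K L :=
  (nilRad K L).toSubmodule ⊓ (toEnd K L L t).eigenspace (2 * (k : K))

omit hT [CharZero K] [IsAlgClosed K] in
lemma mem_nilPart {t x : L} {k : ℤ} :
    x ∈ nilPart (K := K) t k ↔ x ∈ nilRad K L ∧ ⁅t, x⁆ = (2 * (k : K)) • x := by
  rw [nilPart, Submodule.mem_inf, Module.End.mem_eigenspace_iff]
  rfl

omit hT [CharZero K] [IsAlgClosed K] in
lemma lie_mem_nilPart {t x y : L} {j k : ℤ} (hx : ⁅t, x⁆ = (2 * (j : K)) • x)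
    (hy : y ∈ nilPart (K := K) t k) : ⁅x, y⁆ ∈ nilPart (K := K) t (j + k) := by
  rw [mem_nilPart] at hy ⊢
  refine ⟨LieSubmodule.lie_mem _ hy.1, ?_⟩
  rw [leibniz_lie, hx, hy.2, smul_lie, lie_smul]
  push_cast
  module

lemma exists_max_nilPart {t : L} (k₀ : ℤ) (hk₀ : ¬ nilPart (K := K) t k₀ ≤ (LieAlgebra.center K L).toSubmodule) :
    ∃ k, k₀ ≤ k ∧ ¬ nilPart (K := K) t k ≤ (LieAlgebra.center K L).toSubmodule ∧
      ∀ j, k < j → nilPart (K := K) t j ≤ (LieAlgebra.center K L).toSubmodule := by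
  set S : Set ℤ := {k | ¬ nilPart (K := K) t k ≤ (LieAlgebra.center K L).toSubmodule}
  have hS : S.Finite := by
    have h1 : Set.Finite {μ : K | (toEnd K L L t).HasEigenvalue μ} :=
      Module.End.finite_hasEigenvalue _
    refine (h1.preimage (f := fun k : ℤ => 2 * (k : K)) ?_).subset ?_
    · intro a _ b _ hab
      exact_mod_cast mul_left_cancel₀ (two_ne_zero (α := K)) hab
    · intro k hk h0
      refine hk fun x hx => ?_
      have : x ∈ (toEnd K L L t).eigenspace (2 * (k : K)) := hx.2
      have h0' : (toEnd K L L t).eigenspace (2 * (k : K)) = ⊥ := h0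
      rw [h0', Submodule.mem_bot] at this
      rw [this]
      exact zero_mem _
  obtain ⟨k, hk, hmax⟩ := Set.exists_max_image S id hS ⟨k₀, hk₀⟩
  refine ⟨k, hmax k₀ hk₀, hk, fun j hj => ?_⟩
  by_contra h
  exact absurd (hmax j h) (not_le.2 hj)

theorem mem_center_of_lie_eq_zero (hL : WeaklyReductive K L) {u : L} (hu : u ∈ nilRad K L)
    (hTu : ∀ t ∈ T, ⁅t, u⁆ = 0) : u ∈ LieAlgebra.center K L := by
  obtain ⟨t, ht, e, f, hte, htf, hefr, hspan⟩ := hT.exists_principal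
  have hNN := hL.lie_nilRad_mem_center
  have hRN := hL.lie_radical_nilRad_mem_center
  by_contra huZ
  obtain ⟨m', hm0, hm, hmax⟩ := hT.exists_max_nilPart (t := t) 0 (fun h => huZ (h (by
    rw [mem_nilPart]
    exact ⟨hu, by rw [hTu t ht]; simp⟩)))
  obtain ⟨m, rfl⟩ := Int.eq_ofNat_of_zero_le hm0
  set Z : Submodule K L := (LieAlgebra.center K L).toSubmodule
  -- a weight vector of maximal degree
  obtain ⟨α, v, ⟨hvP, hvα⟩, hvZ⟩ : ∃ α : Module.Dual K T, ∃ v,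
      v ∈ nilPart (K := K) t m ⊓ adWeightSpace K L T α ∧ v ∉ Z := by
    by_contra! hcon
    refine hm (le_trans (le_iSup_inf_jointEig (c := fun α : Module.Dual K T => (α : T → K))
      (A := fun t : T => toEnd K L L (t : L)) DFunLike.coe_injective hT.span _ ?_)
      (iSup_le fun α v hv => hcon α v hv))
    rintro ⟨s, hs⟩ x hx
    rw [mem_nilPart] at hx ⊢
    refine ⟨LieSubmodule.lie_mem _ hx.1, ?_⟩
    change ⁅t, ⁅s, x⁆⁆ = _ • ⁅s, x⁆
    rw [leibniz_lie, hT.comm t ht s hs, zero_lie, zero_add, hx.2, lie_smul]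
  obtain ⟨hvN, htv⟩ := mem_nilPart.1 hvP
  set A : Submodule K L := ⨆ k : {k : ℤ // k < 0}, (toEnd K L L t).eigenspace (2 * (k.1 : K))
  set B : Submodule K L := (LieAlgebra.radical K L).toSubmodule ⊔ (T.toSubmodule ⊔
      ⨆ k : {k : ℤ // 0 < k}, (toEnd K L L t).eigenspace (2 * (k.1 : K)))
  set W : Submodule K L := Z ⊔ (K ∙ v ⊔ ⨆ k : {k : ℤ // k < m}, nilPart (K := K) t k.1)
  have hAB : ∀ x : L, ∃ a ∈ (A : Set L), ∃ b ∈ (B : Set L), x = a + b := by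
    have : A ⊔ B = ⊤ := by
      rw [eq_top_iff, ← hspan]
      refine sup_le (le_sup_of_le_right le_sup_left) (sup_le
        (le_sup_of_le_right (le_sup_of_le_right le_sup_left)) (iSup_le ?_))
      rintro ⟨k, hk⟩
      rcases lt_or_gt_of_ne hk with hk | hk
      · exact le_sup_of_le_left (le_iSup (fun k : {k : ℤ // k < 0} =>
          (toEnd K L L t).eigenspace (2 * (k.1 : K))) ⟨k, hk⟩)
      · exact le_sup_of_le_right (le_sup_of_le_right (le_sup_of_le_right
          (le_iSup (fun k : {k : ℤ // 0 < k} =>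
          (toEnd K L L t).eigenspace (2 * (k.1 : K))) ⟨k, hk⟩)))
    intro x
    obtain ⟨a, ha, b, hb, h⟩ := Submodule.mem_sup.1 (this ▸ Submodule.mem_top : x ∈ A ⊔ B)
    exact ⟨a, ha, b, hb, h.symm⟩
  have hBv : ∀ b ∈ (B : Set L), ∃ c : K, (toEnd K L L : L →ₗ[K] Module.End K L) b v - c • v ∈ Z := by
    intro b hb
    obtain ⟨r, hr, b', hb', rfl⟩ := Submodule.mem_sup.1 hb
    obtain ⟨s, hs, p, hp, rfl⟩ := Submodule.mem_sup.1 hb'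
    refine ⟨α ⟨s, hs⟩, ?_⟩
    have h1 : ⁅r, v⁆ ∈ Z := hRN r hr v hvN
    have h2 : ⁅s, v⁆ = α ⟨s, hs⟩ • v := hvα ⟨s, hs⟩
    have h3 : ⁅p, v⁆ ∈ Z := by
      have hle : (⨆ k : {k : ℤ // 0 < k}, (toEnd K L L t).eigenspace (2 * (k.1 : K))) ≤
          Z.comap ((toEnd K L L : L →ₗ[K] Module.End K L).flip v) := by
        refine iSup_le fun k x hx => ?_
        have := lie_mem_nilPart (Module.End.mem_eigenspace_iff.1 hx) hvP
        exact hmax _ (by have := k.2; omega) this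
      exact hle hp
    have : ⁅r + (s + p), v⁆ - α ⟨s, hs⟩ • v = ⁅r, v⁆ + ⁅p, v⁆ := by
      rw [add_lie, add_lie, h2]; abel
    change ⁅r + (s + p), v⁆ - _ ∈ Z
    rw [this]
    exact add_mem h1 h3
  have hA : ∀ a ∈ (A : Set L), ∀ w ∈ W, (toEnd K L L : L →ₗ[K] Module.End K L) a w ∈ W := by
    intro a ha w hw
    have hle : A ≤ W.comap ((toEnd K L L : L →ₗ[K] Module.End K L).flip w) := by
      refine iSup_le fun j x hx => ?_
      have hx' := Module.End.mem_eigenspace_iff.1 hx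
      have hle2 : W ≤ W.comap (toEnd K L L x) := by
        refine sup_le ?_ (sup_le ?_ (iSup_le fun k => ?_))
        · intro z hz
          change ⁅x, z⁆ ∈ W
          rw [lie_center_right hz]
          exact zero_mem _
        · rw [Submodule.span_singleton_le_iff_mem]
          exact Submodule.mem_sup_right (Submodule.mem_sup_right (le_iSup (fun k : {k : ℤ // k < m} =>
            nilPart (K := K) t k.1) ⟨j.1 + m, by have := j.2; omega⟩ (lie_mem_nilPart hx' hvP)))
        · intro y hy
          exact Submodule.mem_sup_right (Submodule.mem_sup_right (le_iSup (fun k : {k : ℤ // k < m} =>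
            nilPart (K := K) t k.1) ⟨j.1 + k, by have := j.2; have := k.2; omega⟩
            (lie_mem_nilPart hx' hy)))
      exact hle2 hw
    exact hle ha
  obtain ⟨Y, hYst, hvY, hZY, hYW⟩ := exists_stable_le (toEnd K L L : L →ₗ[K] Module.End K L)
    (fun x y z => lie_lie x y z) hAB (p := Z)
    (fun x z hz => by
      change ⁅x, z⁆ ∈ Z
      rw [lie_center_right hz]; exact zero_mem _) hBv le_sup_left
    (Submodule.mem_sup_right (Submodule.mem_sup_left (Submodule.mem_span_singleton_self v))) hA
  have hYst' : ∀ x, ∀ y ∈ Y, ⁅x, y⁆ ∈ Y := hYst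
  have hWN : W ≤ Z ⊔ (nilRad K L).toSubmodule := by
    refine sup_le le_sup_left (le_sup_of_le_right (sup_le ?_ (iSup_le fun k x hx => hx.1)))
    rw [Submodule.span_singleton_le_iff_mem]
    exact hvN
  have htop : ∀ y ∈ W, ⁅t, y⁆ = (2 * m : K) • y → ∃ c : K, y - c • v ∈ Z := by
    intro y hy hty
    obtain ⟨z, hz, y', hy', rfl⟩ := Submodule.mem_sup.1 hy
    obtain ⟨cv, hcv, w, hw, rfl⟩ := Submodule.mem_sup.1 hy'
    obtain ⟨c, rfl⟩ := Submodule.mem_span_singleton.1 hcv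
    refine ⟨c, ?_⟩
    have htv' : ⁅t, v⁆ = (2 * m : K) • v := by simpa using htv
    have hindep := (toEnd K L L t).eigenspaces_iSupIndep (2 * (m : K))
    have hw' : w ∈ ⨆ (μ) (_ : μ ≠ (2 * (m : K))), (toEnd K L L t).eigenspace μ := by
      refine (iSup_le fun k => ?_ : (⨆ k : {k : ℤ // k < m}, nilPart (K := K) t k.1) ≤ _) hw
      refine le_trans (fun x hx => hx.2) (le_iSup₂ (f := fun μ (_ : μ ≠ (2 * (m : K))) =>
        (toEnd K L L t).eigenspace μ) (2 * (k.1 : K)) ?_)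
      intro h
      have h' := mul_left_cancel₀ (two_ne_zero (α := K)) h
      have : k.1 = m := by exact_mod_cast h'
      exact absurd k.2 (by omega)
    have hzt : ⁅t, z⁆ = 0 := lie_center_right hz
    have hsum : ⁅t, z + w⁆ = (2 * m : K) • (z + w) := by
      rw [lie_add, lie_add, lie_smul, htv'] at hty
      rw [lie_add]
      linear_combination (norm := module) hty
    have heq : z + (c • v + w) - c • v = z + w := by abel
    rw [heq]
    rcases Nat.eq_zero_or_pos m with h0 | h0
    · subst h0
      rw [Nat.cast_zero, mul_zero, zero_smul, lie_add, hzt, zero_add] at hsum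
      have := (Submodule.disjoint_def.1 hindep) w (by
        rw [Module.End.mem_eigenspace_iff, Nat.cast_zero, mul_zero, zero_smul]; exact hsum) hw'
      rw [this, add_zero]
      exact hz
    · have hz' : z ∈ ⨆ (μ) (_ : μ ≠ (2 * (m : K))), (toEnd K L L t).eigenspace μ := by
        refine le_iSup₂ (f := fun μ (_ : μ ≠ (2 * (m : K))) =>
          (toEnd K L L t).eigenspace μ) 0 ?_ ?_
        · exact (mul_ne_zero two_ne_zero (by exact_mod_cast h0.ne')).symm
        · rw [Module.End.mem_eigenspace_iff, zero_smul]; exact hzt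
      have := (Submodule.disjoint_def.1 hindep) (z + w) (by
        rw [Module.End.mem_eigenspace_iff]; exact hsum) (add_mem hz' hw')
      rw [this]
      exact zero_mem _
  have hvY0 : ∀ y ∈ Y, ⁅v, y⁆ = 0 := by
    have hle : Y ≤ LinearMap.ker (toEnd K L L v) := by
      refine le_trans (le_iSup_inf_jointEig (c := fun (μ : K) (_ : Unit) => μ)
        (fun a b h => congrFun h ()) (hT.iSup_jointEig_unit ht) Y (fun _ y hy => hYst' t y hy))
        (iSup_le fun μ => ?_)
      rintro y ⟨hyY, hyμ⟩
      have hyμ' : ⁅t, y⁆ = μ • y := hyμ ()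
      change ⁅v, y⁆ = 0
      obtain ⟨z, hz, n, hn, hzn⟩ := Submodule.mem_sup.1 (hWN (hYW hyY))
      have hvz : ⁅v, z⁆ = 0 := lie_center_right hz
      have hvy : ⁅v, y⁆ = ⁅v, n⁆ := by rw [← hzn, lie_add, hvz, zero_add]
      have hcen : ⁅v, y⁆ ∈ Z := by rw [hvy]; exact hNN v hvN n hn
      have h0 : ⁅t, ⁅v, y⁆⁆ = 0 := lie_center_right hcen
      have htv' : ⁅t, v⁆ = (2 * m : K) • v := by simpa using htv
      rw [leibniz_lie, htv', hyμ', smul_lie, lie_smul, ← add_smul] at h0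
      rcases smul_eq_zero.1 h0 with hμ | h
      swap
      · exact h
      rw [hvy]
      have hpow : ∀ k : ℕ, (toEnd K L L e ^ k) y ∈ Y ∧
          ⁅t, (toEnd K L L e ^ k) y⁆ = (μ + 2 * k) • (toEnd K L L e ^ k) y := by
        intro k
        induction k with
        | zero => simpa using ⟨hyY, hyμ'⟩
        | succ k ih =>
          rw [pow_succ', Module.End.mul_apply]
          refine ⟨hYst' e _ ih.1, ?_⟩
          change ⁅t, ⁅e, _⁆⁆ = _ • ⁅e, _⁆
          rw [leibniz_lie, hte, ih.2, smul_lie, lie_smul]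
          push_cast
          module
      obtain ⟨c, hc⟩ := htop _ (hYW (hpow (2 * m)).1) (by
        rw [(hpow (2 * m)).2]
        congr 1
        push_cast
        linear_combination hμ)
      have hzp : ∀ k : ℕ, (toEnd K L L e ^ k) z ∈ Z := by
        intro k
        induction k with
        | zero => exact hz
        | succ k ih =>
          rw [pow_succ', Module.End.mul_apply, toEnd_apply_apply, lie_center_right ih]
          exact zero_mem _
      refine lie_eq_zero_of_principal hNN (e := e) (f := f) (t := t) (c := c) hvN m htv' htf ?_
        (fun w hw => hRN _ hefr w hw) hn ?_
      · refine hmax (1 + m) (by omega) (lie_mem_nilPart ?_ hvP)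
        rw [hte]; simp
      · have h2 := sub_mem hc (hzp (2 * m))
        rw [← hzn, map_add] at h2
        rwa [add_sub_assoc, add_sub_cancel_left] at h2
    exact fun y hy => hle hy
  -- the elements of `Y` commuting with `Y`
  let I : LieIdeal K L :=
    { carrier := {x | x ∈ Y ∧ ∀ y ∈ Y, ⁅x, y⁆ = 0}
      add_mem' := fun {a b} ha hb => ⟨add_mem ha.1 hb.1, fun y hy => by
        rw [add_lie, ha.2 y hy, hb.2 y hy, add_zero]⟩
      zero_mem' := ⟨zero_mem _, fun y _ => zero_lie y⟩
      smul_mem' := fun c a ha => ⟨Y.smul_mem c ha.1, fun y hy => by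
        rw [smul_lie, ha.2 y hy, smul_zero]⟩
      lie_mem := fun {x a} ha => ⟨hYst' x a ha.1, fun y hy => by
        rw [lie_lie, ha.2 y hy, ha.2 _ (hYst' x y hy), lie_zero, sub_zero]⟩ }
  exact hvZ (WeaklyReductive.le_center hL I (fun x hx y hy => hx.2 y hy.1) ⟨hvY, hvY0⟩)

end MaxTorus
end TorusTriples

section TorusRoots

open LieModule

variable {K L : Type} [Field K] [CharZero K] [IsAlgClosed K] [LieRing L] [LieAlgebra K L]
  [FiniteDimensional K L] {T : LieSubalgebra K L}

namespace MaxTorus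

variable (hT : MaxTorus T)
include hT

lemma apply_eq_two_of_triple {α : Module.Dual K T} {x y : L}
    (hx : x ∈ adWeightSpace K L T α) (hy : y ∈ adWeightSpace K L T (-α)) (h : IsTriple K x y)
    (hx0 : x ≠ 0) : α ⟨⁅x, y⁆, hT.lie_mem_of_triple h hx hy⟩ = 2 := by
  have h1 := hx ⟨⁅x, y⁆, hT.lie_mem_of_triple h hx hy⟩
  have h2 : ⁅⁅x, y⁆, x⁆ = (2 : K) • x := h.1
  rw [h2] at h1
  exact (smul_left_injective K hx0 h1).symm

lemma eq_zero_of_mem_nilRad (hL : WeaklyReductive K L) {α : Module.Dual K T} {x y v : L}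
    (hx : x ∈ adWeightSpace K L T α) (hy : y ∈ adWeightSpace K L T (-α)) (h : IsTriple K x y)
    (hx0 : x ≠ 0) (hv : v ∈ adWeightSpace K L T α) (hvN : v ∈ nilRad K L) : v = 0 := by
  have hc : ⁅y, v⁆ ∈ LieAlgebra.center K L := by
    refine hT.mem_center_of_lie_eq_zero hL (LieSubmodule.lie_mem _ hvN) fun t ht => ?_
    have := lie_mem_adWeightSpace hy hv ⟨t, ht⟩
    rwa [neg_add_cancel, LinearMap.zero_apply, zero_smul] at this
  have hw := hv ⟨⁅x, y⁆, hT.lie_mem_of_triple h hx hy⟩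
  rw [hT.apply_eq_two_of_triple hx hy h hx0] at hw
  refine (h.sl2Ops (V := L)).symm.FE_injective (μ := -2) (v := v) ?_ ?_ ?_
  · change -⁅⁅x, y⁆, v⁆ = _
    rw [show ⁅⁅x, y⁆, v⁆ = (2 : K) • v from hw, neg_smul]
  · intro n hn
    have : ((n + 2 : ℕ) : K) = 0 := by push_cast; rw [← hn]; ring
    exact absurd (Nat.cast_eq_zero.1 this) (by omega)
  · exact lie_center_right hc

lemma exists_triple_of_quotient {α : Module.Dual K T} (hα : α ≠ 0)
    {q : L ⧸ LieAlgebra.radical K L} (hq : ∀ t : T, ⁅qmk (LieAlgebra.radical K L) (t : L), q⁆ = α t • q)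
    (hq0 : q ≠ 0) : ∃ x ∈ adWeightSpace K L T α, ∃ y ∈ adWeightSpace K L T (-α),
      qmk (LieAlgebra.radical K L) x = q ∧ IsTriple K x y := by
  obtain ⟨H, hH, hHT⟩ := hT.exists_cartan
  set π := qmk (LieAlgebra.radical K L)
  have hpre : ∀ h : H, ∃ t : T, π t = h := fun h => by
    obtain ⟨t, ht, hth⟩ := (hHT h).1 h.2
    exact ⟨⟨t, ht⟩, hth⟩
  choose s hs using hpre
  have hmem : q ∈ LieAlgebra.rootSpace H (fun h => α (s h)) := by
    refine weightSpace_le_genWeightSpace _ _ ?_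
    rw [mem_weightSpace]
    intro h
    have := hq (s h)
    rw [hs h] at this
    exact this
  have hαs : ∀ (t : T) (h : H), π t = h → α (s h) = α t := by
    intro t h hth
    have h1 := hq (s h)
    rw [hs h, ← hth, hq t] at h1
    exact (smul_left_injective K hq0 h1).symm
  let χ : Weight K H (L ⧸ LieAlgebra.radical K L) := ⟨fun h => α (s h), fun h0 => hq0 (by
    rw [LieAlgebra.rootSpace, h0] at hmem
    exact (LieSubmodule.mem_bot _).1 hmem)⟩
  have hχ : χ.IsNonZero := by
    intro h0
    refine hα (LinearMap.ext fun t => ?_)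
    rw [← hαs t ⟨π t, (hHT _).2 ⟨t, t.2, rfl⟩⟩ rfl]
    exact congrFun h0 _
  obtain ⟨h, e, f, htr, he, hf⟩ := LieAlgebra.IsKilling.exists_isSl2Triple_of_weight_isNonZero hχ
  obtain ⟨c, hc⟩ : ∃ c : K, c • q = e := by
    have h1 := LieAlgebra.IsKilling.finrank_rootSpace_eq_one χ hχ
    obtain ⟨c, hc⟩ := (finrank_eq_one_iff_of_nonzero' (⟨q, hmem⟩ : LieAlgebra.rootSpace H χ)
      (fun h => hq0 (congrArg Subtype.val h))).1 h1 ⟨e, he⟩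
    exact ⟨c, congrArg Subtype.val hc⟩
  have htri : IsTriple K q (c • f) := by
    have h1 := isTriple_of_isSl2Triple (K := K) htr
    have hc0 : c ≠ 0 := by
      rintro rfl
      rw [zero_smul] at hc
      exact htr.e_ne_zero hc.symm
    rw [← hc] at h1
    have hb : ⁅q, c • f⁆ = ⁅c • q, f⁆ := by rw [lie_smul, smul_lie]
    refine ⟨?_, ?_⟩
    · rw [hb]
      have := h1.1
      rw [lie_smul, smul_comm] at this
      exact smul_right_injective _ hc0 this
    · rw [hb, lie_smul, h1.2, smul_neg, smul_comm]
  have hfw : ∀ t : T, ⁅π (t : L), c • f⁆ = -α t • (c • f) := by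
    intro t
    have := LieAlgebra.IsKilling.lie_eq_smul_of_mem_rootSpace hf ⟨π t, (hHT _).2 ⟨t, t.2, rfl⟩⟩
    rw [lie_smul, smul_comm]
    congr 1
    refine this.trans ?_
    congr 1
    exact congrArg Neg.neg (hαs t ⟨π t, (hHT _).2 ⟨t, t.2, rfl⟩⟩ rfl)
  obtain ⟨x, hx, y, hy, hxq, -, ht⟩ := hT.exists_lift_triple α hq hfw htri
  exact ⟨x, hx, y, hy, hxq, ht⟩

omit hT in
lemma mem_nilRad_of_mem_radical {α : Module.Dual K T} (hα : α ≠ 0) {x : L}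
    (hx : x ∈ adWeightSpace K L T α) (hxR : x ∈ LieAlgebra.radical K L) : x ∈ nilRad K L := by
  obtain ⟨t, ht⟩ : ∃ t, α t ≠ 0 := by
    by_contra! h
    exact hα (LinearMap.ext h)
  have h1 : x = (α t)⁻¹ • ⁅(t : L), x⁆ := by rw [hx t, smul_smul, inv_mul_cancel₀ ht, one_smul]
  rw [h1]
  exact SMulMemClass.smul_mem _ (lie_mem_nilRad _ hxR)

lemma eq_zero_of_mem_radical (hL : WeaklyReductive K L) {α : Module.Dual K T} (hα : α ≠ 0)
    {q : L ⧸ LieAlgebra.radical K L} (hq : ∀ t : T, ⁅qmk (LieAlgebra.radical K L) (t : L), q⁆ = α t • q)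
    (hq0 : q ≠ 0) {v : L} (hv : v ∈ adWeightSpace K L T α) (hvR : v ∈ LieAlgebra.radical K L) :
    v = 0 := by
  obtain ⟨x, hx, y, hy, hxq, ht⟩ := hT.exists_triple_of_quotient hα hq hq0
  refine hT.eq_zero_of_mem_nilRad hL hx hy ht ?_ hv (mem_nilRad_of_mem_radical hα hv hvR)
  rintro rfl
  rw [map_zero] at hxq
  exact hq0 hxq.symm

/-- A nonzero root vector is either in the nilpotent radical or the first entry of a triple. -/
theorem mem_nilRad_or_exists_triple (hL : WeaklyReductive K L) {α : Module.Dual K T} (hα : α ≠ 0)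
    {x : L} (hx : x ∈ adWeightSpace K L T α) :
    x ∈ nilRad K L ∨ ∃ y ∈ adWeightSpace K L T (-α), IsTriple K x y := by
  have hw : ∀ t : T, ⁅qmk (LieAlgebra.radical K L) (t : L), qmk (LieAlgebra.radical K L) x⁆ =
      α t • qmk (LieAlgebra.radical K L) x := fun t => by
    rw [← LieHom.map_lie, hx t, map_smul]
  by_cases h0 : qmk (LieAlgebra.radical K L) x = 0
  · exact Or.inl (mem_nilRad_of_mem_radical hα hx ((qmk_eq_zero _).1 h0))
  · right
    obtain ⟨x', hx', y, hy, hxx, ht⟩ := hT.exists_triple_of_quotient hα hw h0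
    have : x' - x = 0 := by
      refine hT.eq_zero_of_mem_radical hL hα hw h0 (sub_mem hx' hx) ?_
      rw [← qmk_eq_zero, map_sub, hxx, sub_self]
    rw [sub_eq_zero] at this
    subst this
    exact ⟨y, hy, ht⟩

theorem mem_of_lie_eq_zero (hL : WeaklyReductive K L) {x : L} (hx : ∀ t ∈ T, ⁅t, x⁆ = 0) :
    x ∈ T := by
  obtain ⟨H, hH, hHT⟩ := hT.exists_cartan
  have hxH : qmk (LieAlgebra.radical K L) x ∈ H := by
    rw [← hH.self_normalizing, LieSubalgebra.mem_normalizer_iff]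
    intro h hh
    obtain ⟨t, ht, rfl⟩ := (hHT h).1 hh
    rw [← LieHom.map_lie, ← lie_skew, hx t ht, neg_zero, map_zero]
    exact zero_mem _
  obtain ⟨t, ht, htx⟩ := (hHT _).1 hxH
  have hr : x - t ∈ LieAlgebra.radical K L := by
    rw [← qmk_eq_zero, map_sub, htx, sub_self]
  set r := x - t
  have hTr : ∀ s ∈ T, ⁅s, r⁆ = 0 := fun s hs => by
    rw [lie_sub, hx s hs, hT.comm s hs t ht, sub_zero]
  have hrZ : ∀ y : L, ⁅y, r⁆ ∈ LieAlgebra.center K L := by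
    have hle : (⊤ : Submodule K L) ≤ (LieAlgebra.center K L).toSubmodule.comap
        ((toEnd K L L : L →ₗ[K] Module.End K L).flip r) := by
      rw [← hT.span]
      refine iSup_le fun β y hy => ?_
      change ⁅y, r⁆ ∈ LieAlgebra.center K L
      have hyr : ⁅y, r⁆ ∈ adWeightSpace K L T β := by
        have h0 : r ∈ adWeightSpace K L T 0 := fun s => by
          rw [hTr s s.2, LinearMap.zero_apply, zero_smul]
        have := lie_mem_adWeightSpace hy h0
        rwa [add_zero] at this
      by_cases hβ : β = 0
      · refine hT.mem_center_of_lie_eq_zero hL (lie_mem_nilRad _ hr) fun s hs => ?_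
        have := hyr ⟨s, hs⟩
        rwa [hβ, LinearMap.zero_apply, zero_smul] at this
      by_cases h0 : qmk (LieAlgebra.radical K L) y = 0
      · rw [← lie_skew]
        exact neg_mem (hL.lie_radical_nilRad_mem_center _ hr _
          (mem_nilRad_of_mem_radical hβ hy ((qmk_eq_zero _).1 h0)))
      · have := hT.eq_zero_of_mem_radical hL hβ (fun s => by
          rw [← LieHom.map_lie, hy s, map_smul]) h0 hyr (lie_mem_right K L _ _ _ hr)
        rw [this]
        exact zero_mem _
    exact fun y => hle Submodule.mem_top
  have hrc : r ∈ LieAlgebra.center K L := by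
    let I : LieIdeal K L :=
      { toSubmodule := (LieAlgebra.center K L).toSubmodule ⊔ K ∙ r
        lie_mem := fun {y a} ha => by
          obtain ⟨z, hz, b, hb, rfl⟩ := Submodule.mem_sup.1 ha
          obtain ⟨c, rfl⟩ := Submodule.mem_span_singleton.1 hb
          refine Submodule.mem_sup_left ?_
          rw [lie_add, lie_center_right hz, zero_add, lie_smul]
          exact SMulMemClass.smul_mem c (hrZ y) }
    refine WeaklyReductive.le_center hL I ?_ (Submodule.mem_sup_right
      (Submodule.mem_span_singleton_self r))
    intro a ha b hb
    obtain ⟨z, hz, p, hp, rfl⟩ := Submodule.mem_sup.1 ha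
    obtain ⟨w, hw, q, hq, rfl⟩ := Submodule.mem_sup.1 hb
    obtain ⟨c, rfl⟩ := Submodule.mem_span_singleton.1 hp
    obtain ⟨d, rfl⟩ := Submodule.mem_span_singleton.1 hq
    rw [add_lie, lie_add, lie_add, lie_center_left hz, lie_center_left hz, lie_center_right hw,
      lie_smul, smul_lie, lie_self, smul_zero, smul_zero]
    simp
  have hrT : r ∈ T := by
    refine hT.max r hTr ?_
    rw [eq_top_iff]
    refine le_trans ?_ (le_iSup _ 0)
    intro y _
    rw [Module.End.mem_eigenspace_iff, zero_smul]
    exact lie_center_left hrc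
  have := add_mem hrT ht
  rwa [sub_add_cancel] at this

end MaxTorus
end TorusRoots

section WeightDecomposition

open LieModule

variable {K : Type} [Field K] [IsAlgClosed K] [CharZero K]
variable {g : Type} [LieRing g] [LieAlgebra K g]

lemma mem_iSup_adWeightSpace {t : LieSubalgebra K g} {y : g} {p : Submodule K g} (hyp : y ∈ p)
    (h : ∀ z ∈ t, ∃ c : K, ⁅z, y⁆ = c • y) :
    y ∈ ⨆ β : Module.Dual K t, p ⊓ adWeightSpace K g t β := by
  by_cases hy : y = 0
  · rw [hy]; exact zero_mem _
  choose c hc using fun z : t => h z z.2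
  have hinj := smul_left_injective K hy
  let β : Module.Dual K t :=
    { toFun := c
      map_add' := fun a b => hinj (by
        change c (a + b) • y = (c a + c b) • y
        rw [← hc, add_smul, ← hc, ← hc]
        exact add_lie _ _ _)
      map_smul' := fun r a => hinj (by
        change c (r • a) • y = (r * c a) • y
        rw [← hc, mul_smul, ← hc]
        exact smul_lie _ _ _) }
  exact Submodule.mem_iSup_of_mem β ⟨hyp, fun z => hc z⟩

theorem maxTorus_comap {F t : LieSubalgebra K g} (h : IsMaxToralIn K g F t) :
    MaxTorus (t.comap F.incl) := by
  obtain ⟨⟨htF, hab, hspan⟩, hmax⟩ := h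
  have hcomm : ∀ x ∈ t, ∀ y ∈ t, ⁅x, y⁆ = 0 := fun x hx y hy =>
    congrArg Subtype.val (hab.trivial ⟨x, hx⟩ ⟨y, hy⟩)
  have hspan' : ⨆ α : Module.Dual K (t.comap F.incl), adWeightSpace K F (t.comap F.incl) α = ⊤ := by
    rw [eq_top_iff]
    rintro ⟨x, hx⟩ -
    have h1 : F.toSubmodule ≤ (⨆ α : Module.Dual K (t.comap F.incl),
        adWeightSpace K F (t.comap F.incl) α).map F.toSubmodule.subtype := by
      refine hspan.trans (iSup_le fun α => ?_)
      rintro y ⟨hyF, hy⟩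
      let e : t.comap F.incl →ₗ[K] t :=
        { toFun := fun z => ⟨z.1.1, z.2⟩
          map_add' := fun _ _ => rfl
          map_smul' := fun _ _ => rfl }
      exact ⟨⟨y, hyF⟩, Submodule.mem_iSup_of_mem (α.comp e) fun z => Subtype.ext (hy (e z)), rfl⟩
    obtain ⟨y, hy, hyx⟩ := h1 hx
    rwa [show (⟨x, hx⟩ : F) = y from Subtype.ext hyx.symm]
  refine ⟨fun x hx y hy => Subtype.ext (hcomm _ hx _ hy), hspan', fun x hx hxd => ?_⟩
  have htx : ∀ z ∈ t, ⁅z, (x : g)⁆ = 0 := fun z hz =>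
    congrArg Subtype.val (hx ⟨z, htF hz⟩ hz)
  have hxt : ∀ z ∈ t, ⁅(x : g), z⁆ = 0 := fun z hz => by
    rw [← lie_skew (x : g) z, htx z hz, neg_zero]
  have hab' : ∀ a ∈ t.toSubmodule ⊔ Submodule.span K {(x : g)},
      ∀ b ∈ t.toSubmodule ⊔ Submodule.span K {(x : g)}, ⁅a, b⁆ = 0 := by
    intro a ha b hb
    obtain ⟨a1, ha1, a2, ha2, rfl⟩ := Submodule.mem_sup.1 ha
    obtain ⟨b1, hb1, b2, hb2, rfl⟩ := Submodule.mem_sup.1 hb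
    obtain ⟨c, rfl⟩ := Submodule.mem_span_singleton.1 ha2
    obtain ⟨d, rfl⟩ := Submodule.mem_span_singleton.1 hb2
    simp [hcomm a1 ha1 b1 hb1, htx a1 ha1, hxt b1 hb1]
  let t' : LieSubalgebra K g :=
    { t.toSubmodule ⊔ Submodule.span K {(x : g)} with
      lie_mem' := fun {a b} ha hb => by
        rw [hab' a ha b hb]; exact zero_mem (t.toSubmodule ⊔ Submodule.span K {(x : g)}) }
  have htt' : t ≤ t' := fun z hz => Submodule.mem_sup_left (S := t.toSubmodule) hz
  have hxt' : (x : g) ∈ t' :=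
    Submodule.mem_sup_right (S := t.toSubmodule) (Submodule.mem_span_singleton_self _)
  have h1 : t' = t := by
    refine hmax t' ⟨?_, ⟨fun a b => Subtype.ext (hab' a a.2 b b.2)⟩, ?_⟩ htt'
    · intro z hz
      obtain ⟨a, ha, b, hb, rfl⟩ := (Submodule.mem_sup (p := t.toSubmodule)).1 hz
      obtain ⟨c, rfl⟩ := Submodule.mem_span_singleton.1 hb
      exact add_mem (htF ha) (F.smul_mem c x.2)
    · intro y hy
      have h2 : (⟨y, hy⟩ : F) ∈ (⨆ β : Module.Dual K t', F.toSubmodule ⊓ adWeightSpace K g t' β).comap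
          F.toSubmodule.subtype := by
        have h3 : (⟨y, hy⟩ : F) ∈ ⨆ μ, (toEnd K F F x).eigenspace μ := hxd ▸ Submodule.mem_top
        refine (iSup_le fun μ => ?_ : (⨆ μ, (toEnd K F F x).eigenspace μ) ≤ _) h3
        refine (le_iSup_inf_jointEig (A := fun z : t.comap F.incl => toEnd K F F (z : F))
          (c := fun α : Module.Dual K (t.comap F.incl) => α) DFunLike.coe_injective hspan'
          ((toEnd K F F x).eigenspace μ) fun z v hv => ?_).trans (iSup_le fun α => ?_)
        · rw [Module.End.mem_eigenspace_iff] at hv ⊢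
          simp only [toEnd_apply_apply] at hv ⊢
          rw [leibniz_lie, hv, ← lie_skew x (z : F), hx z z.2, neg_zero, zero_lie, zero_add, lie_smul]
        · rintro v ⟨hvx, hvα⟩
          refine mem_iSup_adWeightSpace (y := (v : g)) v.2 fun z hz => ?_
          obtain ⟨a, ha, b, hb, rfl⟩ := (Submodule.mem_sup (p := t.toSubmodule)).1 hz
          obtain ⟨c, rfl⟩ := Submodule.mem_span_singleton.1 hb
          have e1 : ⁅a, (v : g)⁆ = _ := congrArg Subtype.val (hvα ⟨⟨a, htF ha⟩, ha⟩)
          have e2 : ⁅(x : g), (v : g)⁆ = μ • (v : g) :=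
            congrArg Subtype.val (Module.End.mem_eigenspace_iff.1 hvx)
          refine ⟨α ⟨⟨a, htF ha⟩, ha⟩ + c * μ, ?_⟩
          rw [add_lie, smul_lie, e1, e2, add_smul, mul_smul]
          rfl
      exact h2
  exact h1 ▸ hxt'

end WeightDecomposition

section RationalTrace

variable {K V : Type*} [Field K] [CharZero K] [AddCommGroup V] [Module K V] [FiniteDimensional K V]

/-- The square of an operator diagonalizable with rational eigenvalues has nonnegative rational
trace, which vanishes only if the operator does. -/
lemma exists_trace_sq {A : Module.End K V}
    (hA : ⊤ ≤ Submodule.span K {v | ∃ q : ℚ, A v = (q : K) • v}) :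
    ∃ r : ℚ, LinearMap.trace K V (A * A) = r ∧ 0 ≤ r ∧ (r = 0 → A = 0) := by
  classical
  let b := Module.Basis.ofSpan hA
  have hb : ∀ i, ∃ q : ℚ, A (b i) = (q : K) • b i := fun i =>
    Module.Basis.ofSpan_subset hA (Set.mem_range_self i)
  choose q hq using hb
  have : Fintype ↑((linearIndepOn_empty K id).extend (Set.empty_subset
    {v | ∃ q : ℚ, A v = (q : K) • v})) := FiniteDimensional.fintypeBasisIndex b
  refine ⟨∑ i, q i ^ 2, ?_, Finset.sum_nonneg fun i _ => sq_nonneg _, fun h => ?_⟩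
  · rw [LinearMap.trace_eq_matrix_trace K b, Matrix.trace]
    push_cast
    refine Finset.sum_congr rfl fun i _ => ?_
    rw [Matrix.diag_apply, LinearMap.toMatrix_apply, Module.End.mul_apply, hq, map_smul, hq,
      map_smul, map_smul, Finsupp.smul_apply, Finsupp.smul_apply, b.repr_self,
      Finsupp.single_eq_same, smul_eq_mul, smul_eq_mul, mul_one, sq]
  · rw [Finset.sum_eq_zero_iff_of_nonneg fun i _ => sq_nonneg _] at h
    refine b.ext fun i => ?_
    rw [hq, pow_eq_zero_iff (two_ne_zero) |>.1 (h i (Finset.mem_univ i)), Rat.cast_zero, zero_smul,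
      LinearMap.zero_apply]

end RationalTrace

section Positivity

open LieModule

variable {K L : Type} [Field K] [CharZero K] [IsAlgClosed K] [LieRing L] [LieAlgebra K L]
  [FiniteDimensional K L] {T : LieSubalgebra K L}

/-- A nonnegative combination of roots with `sl₂`-triples which is nonpositive on all the
corresponding coroots vanishes. -/
theorem MaxTorus.sum_eq_zero (hT : MaxTorus T) {ι : Type*} (s : Finset ι) (n : ι → ℕ)
    (α : ι → Module.Dual K T) (x y : ι → L) (hx : ∀ i ∈ s, x i ∈ adWeightSpace K L T (α i))
    (hy : ∀ i ∈ s, y i ∈ adWeightSpace K L T (-α i)) (h : ∀ i ∈ s, IsTriple K (x i) (y i))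
    (hx0 : ∀ i ∈ s, x i ≠ 0) (c : ι → T) (hc : ∀ i ∈ s, (c i : L) = ⁅x i, y i⁆)
    (hneg : ∀ i ∈ s, ∃ m : ℕ, ∑ j ∈ s, (n j : K) * α j (c i) = -m) :
    ∑ i ∈ s, (n i : K) • α i = 0 := by
  classical
  have hc2 : ∀ i ∈ s, α i (c i) = 2 := fun i hi => by
    rw [← hT.apply_eq_two_of_triple (hx i hi) (hy i hi) (h i hi) (hx0 i hi)]
    exact congrArg _ (Subtype.ext (hc i hi))
  -- weights take integral values on coroots
  have h_int : ∀ χ : Module.Dual K T, adWeightSpace K L T χ ≠ ⊥ → ∀ i ∈ s, ∃ k : ℤ, χ (c i) = k := by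
    intro χ hχ i hi
    obtain ⟨v, hv, hv0⟩ := Submodule.exists_mem_ne_zero_of_ne_bot hχ
    refine ((h i hi).sl2Ops (V := L)).eigenvalue_int hv0 ?_
    rw [← hc i hi]
    exact hv (c i)
  have hrat : ∀ a : ι → ℚ, ⊤ ≤ Submodule.span K
      {v | ∃ q : ℚ, toEnd K L L (∑ i ∈ s, (a i : K) • (c i : L)) v = (q : K) • v} := by
    intro a
    rw [← hT.span]
    refine iSup_le fun χ => ?_
    by_cases hχ : adWeightSpace K L T χ = ⊥
    · rw [hχ]; exact bot_le
    choose! k hk using h_int χ hχ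
    intro v hv
    refine Submodule.subset_span ⟨∑ i ∈ s, a i * k i, ?_⟩
    rw [toEnd_apply_apply, sum_lie]
    push_cast
    rw [Finset.sum_smul]
    refine Finset.sum_congr rfl fun i hi => ?_
    rw [smul_lie, hv (c i), hk i hi, mul_smul]
  have hform : ∀ i ∈ s, ∀ t : T, traceForm K L L (c i : L) t = α i t * traceForm K L L (x i) (y i) := by
    intro i hi t
    rw [hc i hi, traceForm_apply_lie_apply, ← lie_skew (y i) (t : L), hy i hi t]
    simp
  have hpos : ∀ i ∈ s, ∃ r : ℚ, 0 < r ∧ traceForm K L L (x i) (y i) = r := by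
    intro i hi
    obtain ⟨r, hr, hr0, hr1⟩ := exists_trace_sq (hrat (Pi.single i 1))
    have hs : ∑ j ∈ s, ((Pi.single i 1 : ι → ℚ) j : K) • (c j : L) = c i := by
      rw [Finset.sum_eq_single_of_mem i hi fun j _ hj => by rw [Pi.single_eq_of_ne hj]; simp]
      simp
    rw [hs] at hr hr1
    have hr' : traceForm K L L (c i : L) (c i) = r := hr
    rw [hform i hi, hc2 i hi] at hr'
    refine ⟨r / 2, ?_, ?_⟩
    · refine half_pos (lt_of_le_of_ne hr0 fun h0 => ?_)
      have h2 := (h i hi).1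
      rw [← hc i hi, ← toEnd_apply_apply K L L, hr1 h0.symm] at h2
      exact smul_ne_zero two_ne_zero (hx0 i hi) h2.symm
    · push_cast
      linear_combination hr' / 2
  choose! r hr0 hr using hpos
  choose! m hm using hneg
  let a : ι → ℚ := fun i => n i / r i
  have ha : ∀ i ∈ s, (a i : K) * r i = n i := fun i hi => by
    have : a i * r i = n i := div_mul_cancel₀ _ (hr0 i hi).ne'
    exact_mod_cast this
  obtain ⟨q, hq, hq0, hq1⟩ := exists_trace_sq (hrat a)
  have hU : ∀ t : T, traceForm K L L (∑ i ∈ s, (a i : K) • (c i : L)) t = ∑ i ∈ s, (n i : K) * α i t := by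
    intro t
    rw [map_sum, LinearMap.sum_apply]
    refine Finset.sum_congr rfl fun i hi => ?_
    rw [map_smul, LinearMap.smul_apply, hform i hi, hr i hi, smul_eq_mul, ← ha i hi]
    ring
  have hq2 : q = -∑ i ∈ s, a i * m i := by
    have h1 : traceForm K L L (∑ i ∈ s, (a i : K) • (c i : L))
        ((∑ i ∈ s, (a i : K) • c i : T) : L) = (q : K) := by
      have h2 : ((∑ i ∈ s, (a i : K) • c i : T) : L) = ∑ i ∈ s, (a i : K) • (c i : L) :=
        map_sum T.toSubmodule.subtype _ _
      rw [← hq, traceForm_apply_apply, h2, Module.End.mul_eq_comp]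
    rw [hU] at h1
    have h2 : (q : K) = ((-∑ i ∈ s, a i * m i : ℚ) : K) := by
      rw [← h1]
      push_cast
      simp only [map_sum, map_smul, Finset.mul_sum, smul_eq_mul]
      rw [Finset.sum_comm, ← Finset.sum_neg_distrib]
      refine Finset.sum_congr rfl fun i hi => ?_
      rw [← mul_neg, ← hm i hi, Finset.mul_sum]
      exact Finset.sum_congr rfl fun j _ => by ring
    exact_mod_cast h2
  have hq3 : q = 0 := by
    refine le_antisymm ?_ hq0
    rw [hq2]
    exact neg_nonpos.2 (Finset.sum_nonneg fun i hi =>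
      mul_nonneg (div_nonneg (Nat.cast_nonneg _) (hr0 i hi).le) (Nat.cast_nonneg _))
  ext t
  simp only [LinearMap.sum_apply, LinearMap.zero_apply, LinearMap.smul_apply, smul_eq_mul]
  rw [← hU, traceForm_apply_apply, hq1 hq3, LinearMap.zero_comp, map_zero]

end Positivity

namespace Setup
section RealTriples

open LieModule Filter

variable {K : Type} [Field K] [IsAlgClosed K] [CharZero K]
variable {g : Type} [LieRing g] [LieAlgebra K g]
variable (S : Setup K g)

/-- The root space of `α`. -/
abbrev W (α : Module.Dual K S.h) : Submodule K g := adWeightSpace K g S.h α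

/-- `h ∩ F n` as a subalgebra of `F n`. -/
def T (n : ℕ) : LieSubalgebra K (S.F n) := S.h.comap (S.F n).incl

/-- The restriction of a functional on `h` to `h ∩ F n`. -/
def res (n : ℕ) (α : Module.Dual K S.h) : Module.Dual K (S.T n) where
  toFun t := α ⟨(t : S.F n), t.2⟩
  map_add' a b := map_add α ⟨(a : S.F n), a.2⟩ ⟨(b : S.F n), b.2⟩
  map_smul' r a := map_smul α r ⟨(a : S.F n), a.2⟩

lemma maxTorus (n : ℕ) : MaxTorus (S.T n) := by
  have h := maxTorus_comap (S.h_maxToral n)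
  have h2 : (S.h ⊓ S.F n).comap (S.F n).incl = S.T n := by
    ext x
    change _ ∧ _ ↔ _
    exact ⟨fun hx => hx.1, fun hx => ⟨hx, x.2⟩⟩
  rwa [h2] at h

lemma weaklyReductive (n : ℕ) : WeaklyReductive K (S.F n) := S.F_reductive n

lemma eventually_mem (x : g) : ∀ᶠ n in atTop, x ∈ S.F n := by
  obtain ⟨n, hn⟩ := S.F_exhaust x
  exact eventually_atTop.2 ⟨n, fun m hm => S.F_mono hm hn⟩

variable {S}

lemma mem_res {n : ℕ} {α : Module.Dual K S.h} {x : g} (hx : x ∈ S.W α) (hxn : x ∈ S.F n) :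
    (⟨x, hxn⟩ : S.F n) ∈ adWeightSpace K (S.F n) (S.T n) (S.res n α) := fun t =>
  Subtype.ext (hx ⟨(t : S.F n), t.2⟩)

lemma lie_h_h {x y : g} (hx : x ∈ S.h) (hy : y ∈ S.h) : ⁅x, y⁆ = 0 := by
  obtain ⟨n, hxn, hyn⟩ := ((S.eventually_mem x).and (S.eventually_mem y)).exists
  exact congrArg Subtype.val ((S.maxTorus n).comm ⟨x, hxn⟩ hx ⟨y, hyn⟩ hy)

lemma mem_W_zero {x : g} : x ∈ S.W 0 ↔ x ∈ S.h := by
  refine ⟨fun hx => ?_, fun hx H => ?_⟩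
  · obtain ⟨n, hn⟩ := (S.eventually_mem x).exists
    have := S.F_findim n
    exact (S.maxTorus n).mem_of_lie_eq_zero (S.weaklyReductive n) (x := ⟨x, hn⟩) fun t ht =>
      Subtype.ext ((hx ⟨t, ht⟩).trans (zero_smul K x))
  · rw [lie_h_h H.2 hx, LinearMap.zero_apply, zero_smul]

lemma exists_comp (S : Setup K g) (x : g) :
    ∃ f : Module.Dual K S.h →₀ g, (∀ i, f i ∈ S.W i) ∧ ∑ i ∈ f.support, f i = x :=
  exists_components (A := fun t : S.h => toEnd K g g (t : g))
    (c := fun α : Module.Dual K S.h => α) S.h_span x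

lemma comp_mem {p : Submodule K g} (hp : ∀ t ∈ S.h, ∀ x ∈ p, ⁅t, x⁆ ∈ p)
    (s : Finset (Module.Dual K S.h)) (f : Module.Dual K S.h → g) (hf : ∀ i ∈ s, f i ∈ S.W i)
    (h : ∑ i ∈ s, f i ∈ p) : ∀ i ∈ s, f i ∈ p :=
  mem_of_sum_mem (fun t : S.h => toEnd K g g (t : g)) (c := fun α : Module.Dual K S.h => α)
    DFunLike.coe_injective p (fun t x hx => hp t t.2 x hx) s f hf h

lemma le_iSup_inf {p : Submodule K g} (hp : ∀ t ∈ S.h, ∀ x ∈ p, ⁅t, x⁆ ∈ p) :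
    p ≤ ⨆ α, p ⊓ S.W α :=
  le_iSup_inf_jointEig (A := fun t : S.h => toEnd K g g (t : g))
    (c := fun α : Module.Dual K S.h => α) DFunLike.coe_injective S.h_span p
    fun t x hx => hp t t.2 x hx

/-- The homogeneous component: if `A` is homogeneous of degree `δ` and `A x` is homogeneous of degree `α + δ`,
then `x` can be replaced by a homogeneous element of degree `α`. -/
lemma exists_homogeneous {α δ : Module.Dual K S.h} {A : g →ₗ[K] g}
    (hA : ∀ β, ∀ z ∈ S.W β, A z ∈ S.W (β + δ)) (x : g) (hx : A x ∈ S.W (α + δ)) :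
    ∃ z ∈ S.W α, A z = A x ∧ ∀ p : Submodule K g, (∀ t ∈ S.h, ∀ x ∈ p, ⁅t, x⁆ ∈ p) → x ∈ p → z ∈ p := by
  classical
  obtain ⟨f, hf, hfx⟩ := S.exists_comp x
  refine ⟨f α, hf α, ?_, fun p hp hxp => ?_⟩
  · have hs : ∑ i ∈ insert α f.support, f i = x := by
      rw [← hfx, ← Finset.sum_subset (Finset.subset_insert α f.support)]
      intro j _ hj; simpa using hj
    have h := mem_of_sum_mem (fun t : S.h => toEnd K g g (t : g))
      (c := fun β : Module.Dual K S.h => (β + δ : Module.Dual K S.h)) 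
      (fun a b hab => add_right_cancel (DFunLike.coe_injective hab)) ⊥ (by simp)
      (insert α f.support) (fun j => A (f j) - if j = α then A x else 0) (fun j _ => by
        change _ ∈ S.W (j + δ)
        split_ifs with h
        · subst h; exact sub_mem (hA _ _ (hf j)) hx
        · rw [sub_zero]; exact hA _ _ (hf j)) (by
        rw [Finset.sum_sub_distrib, Finset.sum_ite_eq', if_pos (Finset.mem_insert_self _ _),
          ← map_sum, hs, sub_self]
        exact zero_mem _) α (Finset.mem_insert_self _ _)
    simpa [sub_eq_zero] using h
  · by_cases h : f α = 0
    · rw [h]; exact zero_mem _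
    · exact comp_mem hp f.support f (fun i _ => hf i) (hfx ▸ hxp) α (Finsupp.mem_support_iff.2 h)

/-- `x` and `y` form an `sl₂`-triple in the root spaces of `±α`. -/
structure RealTriple (S : Setup K g) (α : Module.Dual K S.h) (x y : g) : Prop where
  x_mem : x ∈ S.W α
  y_mem : y ∈ S.W (-α)
  triple : IsTriple K x y
  ne : x ≠ 0

lemma RealTriple.lie_mem {α : Module.Dual K S.h} {x y : g} (h : S.RealTriple α x y) :
    ⁅x, y⁆ ∈ S.h := by
  have := lie_mem_adWeightSpace h.x_mem h.y_mem
  rw [add_neg_cancel] at this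
  exact mem_W_zero.1 this

lemma RealTriple.symm {α : Module.Dual K S.h} {x y : g} (h : S.RealTriple α x y) :
    S.RealTriple (-α) y x := by
  have hs : ⁅y, x⁆ = -⁅x, y⁆ := (lie_skew x y).symm ▸ (neg_neg _).symm
  refine ⟨h.y_mem, by rw [neg_neg]; exact h.x_mem, ⟨?_, ?_⟩, fun h0 => ?_⟩
  · rw [hs, neg_lie, h.triple.2, neg_neg]
  · rw [hs, neg_lie, h.triple.1]
  · have := h.triple.1
    rw [h0, lie_zero, zero_lie] at this
    exact smul_ne_zero two_ne_zero h.ne this.symm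

/-- Elements eventually lying in the nilpotent radicals of the `F n`. -/
def nilIdeal (S : Setup K g) : LieIdeal K g where
  carrier := {x | ∀ᶠ n in atTop, ∃ hx : x ∈ S.F n, (⟨x, hx⟩ : S.F n) ∈ nilRad K (S.F n)}
  add_mem' := fun {a b} ha hb => by
    filter_upwards [ha, hb] with n ⟨h1, h2⟩ ⟨h3, h4⟩
    exact ⟨add_mem h1 h3, add_mem h2 h4⟩
  zero_mem' := Eventually.of_forall fun n => ⟨zero_mem _, zero_mem _⟩
  smul_mem' := fun c x hx => by
    filter_upwards [hx] with n ⟨h1, h2⟩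
    exact ⟨(S.F n).smul_mem c h1, SMulMemClass.smul_mem c h2⟩
  lie_mem := fun {x m} hm => by
    have hm' : ∀ᶠ n in atTop, ∃ hx : m ∈ S.F n, (⟨m, hx⟩ : S.F n) ∈ nilRad K (S.F n) := hm
    filter_upwards [hm', S.eventually_mem x] with n ⟨h1, h2⟩ h3
    exact ⟨(S.F n).lie_mem h3 h1, lie_mem_right K (S.F n) (nilRad K (S.F n)) ⟨x, h3⟩ _ h2⟩

lemma mem_nilIdeal {x : g} : x ∈ S.nilIdeal ↔
    ∀ᶠ n in atTop, ∃ hx : x ∈ S.F n, (⟨x, hx⟩ : S.F n) ∈ nilRad K (S.F n) := Iff.rfl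

lemma lie_lie_nilIdeal {x y : g} (hx : x ∈ S.nilIdeal) (hy : y ∈ S.nilIdeal) (z : g) :
    ⁅z, ⁅x, y⁆⁆ = 0 := by
  obtain ⟨n, ⟨h1, h2⟩, ⟨h3, h4⟩, h5⟩ :=
    ((mem_nilIdeal.1 hx).and ((mem_nilIdeal.1 hy).and (S.eventually_mem z))).exists
  have := S.F_findim n
  have h := (S.weaklyReductive n).lie_nilRad_mem_center _ h2 _ h4
  exact congrArg Subtype.val (mem_center_iff'.1 h ⟨z, h5⟩)

lemma mem_nilIdeal_or_exists_triple {α : Module.Dual K S.h} (hα : α ≠ 0) {x : g} (hx : x ∈ S.W α) :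
    x ∈ S.nilIdeal ∨ ∃ y, S.RealTriple α x y := by
  by_cases hJ : x ∈ S.nilIdeal
  · exact Or.inl hJ
  right
  have hx0 : x ≠ 0 := fun h => hJ (h ▸ zero_mem _)
  obtain ⟨H, hH⟩ : ∃ H, α H ≠ 0 := by
    by_contra! h
    exact hα (LinearMap.ext h)
  rw [mem_nilIdeal, not_eventually] at hJ
  obtain ⟨n, hn, hxn, hHn⟩ :=
    (hJ.and_eventually ((S.eventually_mem x).and (S.eventually_mem H))).exists
  have := S.F_findim n
  have hαn : S.res n α ≠ 0 := fun h0 => hH (LinearMap.congr_fun h0 ⟨⟨H, hHn⟩, H.2⟩)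
  rcases (S.maxTorus n).mem_nilRad_or_exists_triple (S.weaklyReductive n) hαn (mem_res hx hxn) with
    h | ⟨y, hy, ht⟩
  · exact absurd ⟨hxn, h⟩ hn
  have hh : ⁅x, (y : g)⁆ ∈ S.h := (S.maxTorus n).lie_mem_of_triple ht (mem_res hx hxn) hy
  have h1 : ⁅⁅x, (y : g)⁆, x⁆ = (2 : K) • x := congrArg Subtype.val ht.1
  obtain ⟨z, hz, hzx, -⟩ := exists_homogeneous (S := S) (α := -α) (δ := α) (A := toEnd K g g x)
    (fun β z hz => by rw [add_comm]; exact lie_mem_adWeightSpace hx hz) y (by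
      rw [neg_add_cancel]; exact mem_W_zero.2 hh)
  have hzx' : ⁅x, z⁆ = ⁅x, (y : g)⁆ := hzx
  have h2 : α ⟨_, hh⟩ = 2 := smul_left_injective K hx0 ((hx ⟨_, hh⟩).symm.trans h1)
  refine ⟨z, hx, hz, ⟨hzx'.symm ▸ h1, ?_⟩, hx0⟩
  rw [hzx']
  refine (hz ⟨_, hh⟩).trans ?_
  rw [LinearMap.neg_apply, h2, neg_smul]

lemma RealTriple.eq_zero_of_mem_nilIdeal {α : Module.Dual K S.h} {x y v : g}
    (h : S.RealTriple α x y) (hv : v ∈ S.W α) (hJ : v ∈ S.nilIdeal) : v = 0 := by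
  obtain ⟨n, ⟨h1, h2⟩, h3, h4⟩ :=
    ((mem_nilIdeal.1 hJ).and ((S.eventually_mem x).and (S.eventually_mem y))).exists
  have := S.F_findim n
  exact congrArg Subtype.val ((S.maxTorus n).eq_zero_of_mem_nilRad (S.weaklyReductive n)
    (mem_res h.x_mem h3) (mem_res h.y_mem h4)
    ⟨Subtype.ext h.triple.1, Subtype.ext h.triple.2⟩ (fun h0 => h.ne (congrArg Subtype.val h0))
    (mem_res hv h1) h2)

theorem sum_eq_zero {ι : Type*} (s : Finset ι) (n : ι → ℕ) (α : ι → Module.Dual K S.h)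
    (x y : ι → g) (h : ∀ i (_ : i ∈ s), S.RealTriple (α i) (x i) (y i))
    (hneg : ∀ i (hi : i ∈ s), ∃ m : ℕ, (∑ j ∈ s, n j • α j) ⟨_, (h i hi).lie_mem⟩ = -m) :
    ∑ i ∈ s, n i • α i = 0 := by
  classical
  ext H
  obtain ⟨k, hH, hk⟩ := ((S.eventually_mem H).and ((eventually_all_finset s).2 fun i _ =>
    (S.eventually_mem (x i)).and (S.eventually_mem (y i)))).exists
  have := S.F_findim k
  let x' : ι → S.F k := fun i => if hi : i ∈ s then ⟨x i, (hk i hi).1⟩ else 0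
  let y' : ι → S.F k := fun i => if hi : i ∈ s then ⟨y i, (hk i hi).2⟩ else 0
  let c : ι → S.T k := fun i => if hi : i ∈ s then
    ⟨⟨⁅x i, y i⁆, (S.F k).lie_mem (hk i hi).1 (hk i hi).2⟩, (h i hi).lie_mem⟩ else 0
  have hx' : ∀ i (hi : i ∈ s), x' i = ⟨x i, (hk i hi).1⟩ := fun i hi => dif_pos hi
  have hy' : ∀ i (hi : i ∈ s), y' i = ⟨y i, (hk i hi).2⟩ := fun i hi => dif_pos hi
  have hc : ∀ i (hi : i ∈ s), c i = ⟨⟨⁅x i, y i⁆, (S.F k).lie_mem (hk i hi).1 (hk i hi).2⟩,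
    (h i hi).lie_mem⟩ := fun i hi => dif_pos hi
  have key := (S.maxTorus k).sum_eq_zero s n (fun i => S.res k (α i)) x' y'
    (fun i hi => by rw [hx' i hi]; exact mem_res (h i hi).x_mem _)
    (fun i hi => by rw [hy' i hi]; exact mem_res (h i hi).y_mem _)
    (fun i hi => by
      rw [hx' i hi, hy' i hi]
      exact ⟨Subtype.ext (h i hi).triple.1, Subtype.ext (h i hi).triple.2⟩)
    (fun i hi => by rw [hx' i hi]; exact fun h0 => (h i hi).ne (congrArg Subtype.val h0))
    c (fun i hi => by rw [hx' i hi, hy' i hi, hc i hi]; rfl)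
    (fun i hi => by
      obtain ⟨m, hm⟩ := hneg i hi
      refine ⟨m, ?_⟩
      rw [← hm, LinearMap.sum_apply, hc i hi]
      refine Finset.sum_congr rfl fun j _ => ?_
      rw [LinearMap.smul_apply, nsmul_eq_mul]
      rfl)
  have := LinearMap.congr_fun key ⟨⟨H, hH⟩, H.2⟩
  simp only [LinearMap.sum_apply, LinearMap.smul_apply, LinearMap.zero_apply, smul_eq_mul] at this
  simp only [LinearMap.sum_apply, LinearMap.smul_apply, LinearMap.zero_apply, nsmul_eq_mul]
  exact this

end RealTriples
end Setup

namespace Setup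
section PositiveRoots

open LieModule Filter

variable {K : Type} [Field K] [IsAlgClosed K] [CharZero K]
variable {g : Type} [LieRing g] [LieAlgebra K g]
variable {S : Setup K g}

lemma isRootOf_of_mem {α : Module.Dual K S.h} (hα : α ≠ 0) {x : g} (hx : x ∈ S.W α) (hx0 : x ≠ 0) :
    IsRootOf K g S.h α :=
  ⟨hα, fun h => hx0 ((Submodule.mem_bot K).1 (h ▸ hx))⟩

lemma mem_pos_or_neg_mem {α : Module.Dual K S.h} (h : IsRootOf K g S.h α) : α ∈ S.pos ∨ -α ∈ S.pos := by
  by_cases h1 : α ∈ S.pos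
  · exact Or.inl h1
  · exact Or.inr (not_not.1 (mt (S.pos_polar α h).2 h1))

lemma neg_notMem_pos {α : Module.Dual K S.h} (h : α ∈ S.pos) : -α ∉ S.pos :=
  (S.pos_polar α (S.pos_root α h)).1 h

lemma zero_notMem_pos : (0 : Module.Dual K S.h) ∉ S.pos := fun h => (S.pos_root 0 h).1 rfl

lemma W_le_nplus {α : Module.Dual K S.h} (h : α ∈ S.pos) : S.W α ≤ S.nplus :=
  le_iSup₂_of_le α h le_rfl

lemma mem_pos_of_mem_nplus {β : Module.Dual K S.h} {x : g} (hx : x ∈ S.W β) (hx' : x ∈ S.nplus)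
    (hx0 : x ≠ 0) : β ∈ S.pos := by
  by_contra hβ
  have h1 : S.nplus ≤ ⨆ j, ⨆ _ : j ≠ β, S.W j := by
    refine iSup₂_le fun α hα => le_iSup₂_of_le α (fun h => hβ (h ▸ hα)) le_rfl
  exact hx0 ((Submodule.disjoint_def.1 (S.h_indep β)) x hx (h1 hx'))

lemma lie_h_nplus {t x : g} (ht : t ∈ S.h) (hx : x ∈ S.nplus) : ⁅t, x⁆ ∈ S.nplus := by
  have h : S.nplus ≤ S.nplus.comap (toEnd K g g t) := by
    refine iSup₂_le fun α hα x hx => ?_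
    change ⁅t, x⁆ ∈ S.nplus
    rw [hx ⟨t, ht⟩]
    exact Submodule.smul_mem _ _ (W_le_nplus hα hx)
  exact h hx

lemma lie_nplus_nplus {x y : g} (hx : x ∈ S.nplus) (hy : y ∈ S.nplus) : ⁅x, y⁆ ∈ S.nplus := by
  have h1 : ∀ α ∈ S.pos, ∀ x ∈ S.W α, S.nplus ≤ S.nplus.comap (toEnd K g g x) := by
    intro α hα x hx
    refine iSup₂_le fun β hβ y hy => ?_
    change ⁅x, y⁆ ∈ S.nplus
    by_cases h0 : ⁅x, y⁆ = 0
    · rw [h0]; exact zero_mem _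
    have hxy := lie_mem_adWeightSpace hx hy
    refine W_le_nplus (S.pos_add α hα β hβ (isRootOf_of_mem (fun h => ?_) hxy h0)) hxy
    exact neg_notMem_pos hα (neg_eq_of_add_eq_zero_right h ▸ hβ)
  have h2 : S.nplus ≤ S.nplus.comap ((toEnd K g g : g →ₗ[K] Module.End K g).flip y) :=
    iSup₂_le fun α hα x hx => h1 α hα x hx hy
  exact h2 hx

lemma sub_mem_pos {α β : Module.Dual K S.h} (hα : S.IsSimpleRoot α) (hβ : β ∈ S.pos)
    (hr : IsRootOf K g S.h (β - α)) : β - α ∈ S.pos := by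
  rcases mem_pos_or_neg_mem hr with h | h
  · exact h
  · rw [neg_sub] at h
    refine absurd ⟨{β, α - β}, by simp, ?_, by simp⟩ hα.2
    simp [hβ, h]

lemma not_isRootOf_sub {α β : Module.Dual K S.h} (hα : S.IsSimpleRoot α) (hβ : S.IsSimpleRoot β) :
    ¬IsRootOf K g S.h (β - α) := by
  intro hr
  have h := sub_mem_pos hα hβ.1 hr
  refine absurd ⟨{α, β - α}, by simp, ?_, by simp⟩ hβ.2
  simp [hα.1, h]

/-- A subalgebra argument from the Dynkin property. -/
lemma IsDynkin.mem_or_mem (hD : S.IsDynkin) (A : AddSubmonoid (Module.Dual K S.h)) (I : LieIdeal K g)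
    (h : ∀ α, S.IsSimpleRoot α → α ∈ A ∨ S.W α ≤ I.toSubmodule) {γ : Module.Dual K S.h}
    (hγ : γ ∈ S.pos) {x : g} (hx : x ∈ S.W γ) : γ ∈ A ∨ x ∈ I := by
  by_contra! hcon
  obtain ⟨hγA, hxI⟩ := hcon
  let P : Submodule K g := ⨆ δ : A, S.W δ
  have hP : ∀ x ∈ P, ∀ y ∈ P, ⁅x, y⁆ ∈ P := by
    have h1 : ∀ δ : A, ∀ x ∈ S.W δ, P ≤ P.comap (toEnd K g g x) := fun δ x hx =>
      iSup_le fun ε y hy => Submodule.mem_iSup_of_mem (δ + ε) (lie_mem_adWeightSpace hx hy)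
    intro x hx y hy
    have h2 : P ≤ P.comap ((toEnd K g g : g →ₗ[K] Module.End K g).flip y) :=
      iSup_le fun δ x hx => h1 δ x hx hy
    exact h2 hx
  let B : LieSubalgebra K g :=
    { I.toSubmodule ⊔ P with
      lie_mem' := fun {x y} hx hy => by
        obtain ⟨i, hi, a, ha, rfl⟩ := Submodule.mem_sup.1 hx
        obtain ⟨j, hj, b, hb, rfl⟩ := Submodule.mem_sup.1 hy
        rw [lie_add, add_lie i a b, ← add_assoc]
        refine Submodule.add_mem_sup (add_mem ?_ ?_) (hP a ha b hb)
        · exact lie_mem_right K g I _ _ hj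
        · exact lie_mem_left K g I _ _ hi }
  have hb : S.b ≤ B := by
    rw [show S.b = _ from hD, LieSubalgebra.lieSpan_le]
    rintro z (hz | hz)
    · exact Submodule.mem_sup_right (Submodule.mem_iSup_of_mem (0 : A) (mem_W_zero.2 hz))
    · simp only [Set.mem_iUnion] at hz
      obtain ⟨α, hα, hz⟩ := hz
      rcases h α hα with h1 | h1
      · exact Submodule.mem_sup_right (Submodule.mem_iSup_of_mem ⟨α, h1⟩ hz)
      · exact Submodule.mem_sup_left (h1 hz)
  have hxb : x ∈ S.b := by
    have : x ∈ S.b.toSubmodule := by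
      rw [S.b_eq]
      exact Submodule.mem_sup_right (W_le_nplus hγ hx)
    exact this
  obtain ⟨j, hj, a, ha, hja⟩ := Submodule.mem_sup.1 (hb hxb : x ∈ I.toSubmodule ⊔ P)
  obtain ⟨f, hf, rfl⟩ := (Submodule.mem_iSup_iff_exists_finsupp _ _).1 ha
  have key := mem_of_sum_mem (fun t : S.h => toEnd K g g (t : g))
    (c := fun o : Option A => (o.elim γ (fun δ => (δ : Module.Dual K S.h)) : Module.Dual K S.h))
    (fun o o' hoo => by
      replace hoo := DFunLike.coe_injective hoo
      match o, o', hoo with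
      | none, none, _ => rfl
      | none, some δ, h => exact absurd ((show (δ : Module.Dual K S.h) = γ from h.symm) ▸ δ.2) hγA
      | some δ, none, h => exact absurd ((show (δ : Module.Dual K S.h) = γ from h) ▸ δ.2) hγA
      | some δ, some ε, h => exact congrArg some (Subtype.ext h))
    I.toSubmodule (fun t x hx => lie_mem_right K g I _ _ hx) f.support.insertNone
    (fun o => o.elim x (fun δ => -f δ))
    (fun o _ => match o with
      | none => hx
      | some δ => neg_mem (hf δ)) (by
      rw [Finset.sum_insertNone]
      simp only [Option.elim, Finset.sum_neg_distrib]
      rw [← hja]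
      simpa [Finsupp.sum] using hj) none (by simp)
  exact hxI key

lemma IsDynkin.exists_simple (hD : S.IsDynkin) {γ : Module.Dual K S.h} (hγ : γ ∈ S.pos) :
    ∃ s : Multiset (Module.Dual K S.h), (∀ α ∈ s, S.IsSimpleRoot α) ∧ s.sum = γ := by
  obtain ⟨x, hx, hx0⟩ := Submodule.exists_mem_ne_zero_of_ne_bot (S.pos_root γ hγ).2
  rcases hD.mem_or_mem (AddSubmonoid.closure {α | S.IsSimpleRoot α}) ⊥
    (fun α hα => Or.inl (AddSubmonoid.subset_closure hα)) hγ hx with h | h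
  · exact AddSubmonoid.exists_multiset_of_mem_closure h
  · exact absurd ((LieSubmodule.mem_bot _).1 h) hx0

lemma IsDynkin.exists_simple_multiset (hD : S.IsDynkin) (s : Multiset (Module.Dual K S.h)) :
    (∀ α ∈ s, α ∈ S.pos) → ∃ t : Multiset (Module.Dual K S.h),
      (∀ α ∈ t, S.IsSimpleRoot α) ∧ t.sum = s.sum ∧ (s ≠ 0 → t ≠ 0) := by
  induction s using Multiset.induction_on with
  | empty => exact fun _ => ⟨0, by simp, rfl, fun h => h⟩
  | cons γ s ih =>
    intro h
    obtain ⟨t, ht, hts, -⟩ := ih fun α hα => h α (Multiset.mem_cons_of_mem hα)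
    obtain ⟨u, hu, huγ⟩ := hD.exists_simple (h γ (Multiset.mem_cons_self _ _))
    refine ⟨u + t, fun α hα => ?_, by simp [huγ, hts], fun _ h0 => ?_⟩
    · rcases Multiset.mem_add.1 hα with h1 | h1
      exacts [hu α h1, ht α h1]
    · rw [add_eq_zero] at h0
      rw [h0.1, Multiset.sum_zero] at huγ
      exact zero_notMem_pos (huγ ▸ h γ (Multiset.mem_cons_self _ _))

theorem IsDynkin.eq_zero_of_sum_eq_zero (hD : S.IsDynkin) {s : Multiset (Module.Dual K S.h)}
    (hs : ∀ α ∈ s, α ∈ S.pos) (h0 : s.sum = 0) : s = 0 := by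
  by_contra hne
  obtain ⟨t, ht, hts, htne⟩ := hD.exists_simple_multiset s hs
  obtain ⟨α, hα⟩ := Multiset.exists_mem_of_ne_zero (htne hne)
  refine (ht α hα).2 ⟨α ::ₘ t, ?_, ?_, by simp [hts, h0]⟩
  · rw [Multiset.card_cons]
    have := Multiset.card_pos.2 (htne hne)
    omega
  · intro β hβ
    rcases Multiset.mem_cons.1 hβ with rfl | h
    exacts [(ht β hα).1, (ht β h).1]

end PositiveRoots
end Setup

namespace Setup
section NilpotentIdeal

open LieModule Filter

variable {K : Type} [Field K] [IsAlgClosed K] [CharZero K]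
variable {g : Type} [LieRing g] [LieAlgebra K g]
variable {S : Setup K g}

/-- The positive part of the nilpotent ideal. -/
def nilPos (S : Setup K g) : Submodule K g := S.nilIdeal.toSubmodule ⊓ S.nplus

lemma lie_h_nilPos {t x : g} (ht : t ∈ S.h) (hx : x ∈ S.nilPos) : ⁅t, x⁆ ∈ S.nilPos :=
  ⟨lie_mem_right K g S.nilIdeal _ _ hx.1, lie_h_nplus ht hx.2⟩

lemma eq_zero_of_central {x : g} (hx : x ∈ S.nplus) (hc : ∀ y : g, ⁅y, x⁆ = 0) : x = 0 := by
  by_contra h0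
  refine zero_notMem_pos (S := S) (mem_pos_of_mem_nplus (fun H => ?_) hx h0)
  rw [hc, LinearMap.zero_apply, zero_smul]

/-- The elements acting on the positive part of the nilpotent ideal, up to the center. -/
def nilStab (S : Setup K g) : LieSubalgebra K g where
  carrier := {x | ∀ v ∈ S.nilPos, ⁅x, v⁆ ∈ S.nilPos ⊔ (LieAlgebra.center K g).toSubmodule}
  add_mem' ha hb v hv := by rw [add_lie]; exact add_mem (ha v hv) (hb v hv)
  zero_mem' v _ := by rw [zero_lie]; exact zero_mem _
  smul_mem' c x hx v hv := by rw [smul_lie]; exact Submodule.smul_mem _ _ (hx v hv)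
  lie_mem' := fun {x y} hx hy v hv => by
    have h1 : ∀ {z : g}, (∀ v ∈ S.nilPos, ⁅z, v⁆ ∈ S.nilPos ⊔ (LieAlgebra.center K g).toSubmodule) →
        ∀ v ∈ S.nilPos ⊔ (LieAlgebra.center K g).toSubmodule,
          ⁅z, v⁆ ∈ S.nilPos ⊔ (LieAlgebra.center K g).toSubmodule := by
      intro z hz v hv
      obtain ⟨a, ha, c, hc, rfl⟩ := Submodule.mem_sup.1 hv
      rw [lie_add, mem_center_iff'.1 hc, add_zero]
      exact hz a ha
    rw [lie_lie]
    exact sub_mem (h1 hx _ (hy v hv)) (h1 hy _ (hx v hv))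

lemma mem_nilStab {x : g} : x ∈ S.nilStab ↔
    ∀ v ∈ S.nilPos, ⁅x, v⁆ ∈ S.nilPos ⊔ (LieAlgebra.center K g).toSubmodule := Iff.rfl

lemma nilIdeal_le_nilStab {x : g} (hx : x ∈ S.nilIdeal) : x ∈ S.nilStab := fun _ hv =>
  Submodule.mem_sup_right (mem_center_iff'.2 fun z => lie_lie_nilIdeal hx hv.1 z)

lemma h_le_nilStab {x : g} (hx : x ∈ S.h) : x ∈ S.nilStab := fun _ hv =>
  Submodule.mem_sup_left (lie_h_nilPos hx hv)

lemma nplus_le_nilStab {x : g} (hx : x ∈ S.nplus) : x ∈ S.nilStab := fun _ hv =>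
  Submodule.mem_sup_left ⟨lie_mem_right K g S.nilIdeal _ _ hv.1, lie_nplus_nplus hx hv.2⟩

lemma RealTriple.neg_le_nilStab {α : Module.Dual K S.h} (hα : S.IsSimpleRoot α) {e f : g}
    (h : S.RealTriple α e f) {y : g} (hy : y ∈ S.W (-α)) : y ∈ S.nilStab := by
  have h1 : S.nilPos ≤ (S.nilPos ⊔ (LieAlgebra.center K g).toSubmodule).comap (toEnd K g g y) := by
    refine (le_iSup_inf (p := S.nilPos) fun t ht x hx => lie_h_nilPos ht hx).trans
      (iSup_le fun β => ?_)
    rintro v ⟨⟨hvJ, hvn⟩, hvβ⟩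
    change ⁅y, v⁆ ∈ S.nilPos ⊔ (LieAlgebra.center K g).toSubmodule
    by_cases h0 : ⁅y, v⁆ = 0
    · rw [h0]; exact zero_mem _
    have hv0 : v ≠ 0 := fun h => h0 (by rw [h, lie_zero])
    have hne : β ≠ α := by
      rintro rfl
      exact hv0 (h.eq_zero_of_mem_nilIdeal hvβ hvJ)
    have hyv := lie_mem_adWeightSpace hy hvβ
    rw [neg_add_eq_sub] at hyv
    exact Submodule.mem_sup_left ⟨lie_mem_right K g S.nilIdeal _ _ hvJ, W_le_nplus (sub_mem_pos hα
      (mem_pos_of_mem_nplus hvβ hvn hv0) (isRootOf_of_mem (sub_ne_zero.2 hne) hyv h0)) hyv⟩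
  exact h1

/-- If a sum of simple roots with `sl₂`-triples is nonpositive on the corresponding coroots, then it
is empty. -/
lemma IsDynkin.eq_zero_of_nonpos (hD : S.IsDynkin) {s : Multiset (Module.Dual K S.h)}
    (hs : ∀ α ∈ s, α ∈ S.pos) (e f : Module.Dual K S.h → g)
    (h : ∀ α (_ : α ∈ s), S.RealTriple α (e α) (f α))
    (hn : ∀ α (hα : α ∈ s), ∃ m : ℕ, s.sum ⟨_, (h α hα).lie_mem⟩ = -m) : s = 0 := by
  classical
  refine hD.eq_zero_of_sum_eq_zero hs ?_
  rw [Finset.sum_multiset_count]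
  refine sum_eq_zero s.toFinset s.count (fun α => α) e f
    (fun α hα => h α (Multiset.mem_toFinset.1 hα)) fun α hα => ?_
  rw [← Finset.sum_multiset_count]
  exact hn α (Multiset.mem_toFinset.1 hα)

lemma IsDynkin.neg_sum_le_nilStab (hD : S.IsDynkin) (n : ℕ) : ∀ s : Multiset (Module.Dual K S.h),
    Multiset.card s = n → (∀ α ∈ s, S.IsSimpleRoot α ∧ ∃ e f, S.RealTriple α e f) →
    ∀ x ∈ S.W (-s.sum), x ∈ S.nilStab := by
  classical
  induction n with
  | zero =>
    intro s hs _ x hx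
    rw [Multiset.card_eq_zero.1 hs, Multiset.sum_zero, neg_zero] at hx
    exact h_le_nilStab (mem_W_zero.1 hx)
  | succ n ih =>
    intro s hs h x hx
    have h' := fun α hα => (h α hα).2
    choose! e f hef using h'
    obtain ⟨α, hα, hαn⟩ : ∃ α, ∃ hα : α ∈ s, ∀ m : ℕ, s.sum ⟨_, (hef α hα).lie_mem⟩ ≠ -m := by
      by_contra! hcon
      rw [hD.eq_zero_of_nonpos (fun α hα => (h α hα).1.1) e f hef hcon] at hs
      simp at hs
    have ht := hef α hα
    obtain ⟨k, hxk, hek, hfk⟩ := ((S.eventually_mem x).and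
      ((S.eventually_mem (e α)).and (S.eventually_mem (f α)))).exists
    have := S.F_findim k
    have htk : IsTriple K (⟨e α, hek⟩ : S.F k) ⟨f α, hfk⟩ :=
      ⟨Subtype.ext ht.triple.1, Subtype.ext ht.triple.2⟩
    obtain ⟨w, -, hw⟩ := (htk.sl2Ops (V := S.F k)).exists_FE (v := ⟨x, hxk⟩)
      (μ := (-s.sum) ⟨_, ht.lie_mem⟩) (Subtype.ext (hx ⟨_, ht.lie_mem⟩)) fun m hm => by
        rw [LinearMap.neg_apply, neg_eq_iff_eq_neg] at hm
        exact hαn m hm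
    have hwx : ⁅f α, ⁅e α, (w : g)⁆⁆ = x := congrArg Subtype.val hw
    obtain ⟨z, hz, hzx, -⟩ := exists_homogeneous (S := S) (α := -s.sum) (δ := 0)
      (A := toEnd K g g (f α) * toEnd K g g (e α)) (fun β z hz => by
        have := lie_mem_adWeightSpace ht.y_mem (lie_mem_adWeightSpace ht.x_mem hz)
        rwa [neg_add_cancel_left, ← add_zero β] at this) w (by
        rw [add_zero]
        simpa [hwx] using hx)
    have hzx' : ⁅f α, ⁅e α, z⁆⁆ = x := by
      rw [← hwx]
      exact hzx
    rw [← hzx']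
    refine S.nilStab.lie_mem (ht.neg_le_nilStab (h α hα).1 ht.y_mem) ?_
    refine ih (s.erase α) ?_ (fun β hβ => h β (Multiset.mem_of_mem_erase hβ)) _ ?_
    · rw [Multiset.card_erase_of_mem hα, hs]; rfl
    · have h1 := lie_mem_adWeightSpace ht.x_mem hz
      have h2 := congrArg Multiset.sum (Multiset.cons_erase hα)
      rw [Multiset.sum_cons] at h2
      rwa [show α + -s.sum = -(s.erase α).sum by rw [← h2]; abel] at h1

lemma IsDynkin.neg_le_nilStab (hD : S.IsDynkin) {γ : Module.Dual K S.h} (hγ : γ ∈ S.pos) {y : g}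
    (hy : y ∈ S.W (-γ)) : y ∈ S.nilStab := by
  have hγ0 : -γ ≠ 0 := neg_ne_zero.2 (S.pos_root γ hγ).1
  rcases mem_nilIdeal_or_exists_triple hγ0 hy with h | ⟨x, h⟩
  · exact nilIdeal_le_nilStab h
  have hs := h.symm
  rw [neg_neg] at hs
  have := hD.mem_or_mem (AddSubmonoid.closure {α | S.IsSimpleRoot α ∧ ∃ e f, S.RealTriple α e f})
    S.nilIdeal (fun α hα => by
      by_cases h1 : S.W α ≤ S.nilIdeal.toSubmodule
      · exact Or.inr h1
      · obtain ⟨e, he, heJ⟩ := SetLike.not_le_iff_exists.1 h1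
        have hα0 : α ≠ 0 := (S.pos_root α hα.1).1
        obtain ⟨f, hf⟩ := (mem_nilIdeal_or_exists_triple hα0 he).resolve_left heJ
        exact Or.inl (AddSubmonoid.subset_closure ⟨hα, e, f, hf⟩)) hγ hs.x_mem
  rcases this with h1 | h1
  · obtain ⟨s, hs2, rfl⟩ := AddSubmonoid.exists_multiset_of_mem_closure h1
    exact hD.neg_sum_le_nilStab _ s rfl hs2 y hy
  · exact absurd (hs.eq_zero_of_mem_nilIdeal hs.x_mem h1) hs.ne

lemma IsDynkin.mem_nilStab (hD : S.IsDynkin) (x : g) : x ∈ S.nilStab := by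
  have h : (⨆ α, S.W α) ≤ S.nilStab.toSubmodule := by
    refine iSup_le fun α x hx => ?_
    by_cases h0 : x = 0
    · rw [h0]; exact zero_mem _
    by_cases hα : α = 0
    · subst hα
      exact h_le_nilStab (mem_W_zero.1 hx)
    rcases mem_pos_or_neg_mem (isRootOf_of_mem hα hx h0) with h | h
    · exact nplus_le_nilStab (W_le_nplus h hx)
    · exact hD.neg_le_nilStab h (by rwa [neg_neg])
  exact h (S.h_span ▸ Submodule.mem_top)

lemma IsDynkin.nilPos_eq_bot (hD : S.IsDynkin) {x : g} (hx : x ∈ S.nilPos) : x = 0 := by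
  have hab : ∀ u ∈ S.nilPos ⊔ (LieAlgebra.center K g).toSubmodule,
      ∀ v ∈ S.nilPos ⊔ (LieAlgebra.center K g).toSubmodule, ⁅u, v⁆ = 0 := by
    intro u hu v hv
    obtain ⟨a, ha, b, hb, rfl⟩ := Submodule.mem_sup.1 hu
    obtain ⟨c, hc, d, hd, rfl⟩ := Submodule.mem_sup.1 hv
    rw [lie_add, mem_center_iff'.1 hd, add_zero, add_lie, lie_center_left hb, add_zero]
    exact eq_zero_of_central (lie_nplus_nplus ha.2 hc.2) fun z => lie_lie_nilIdeal ha.1 hc.1 z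
  refine eq_zero_of_central hx.2 fun y => ?_
  obtain ⟨n, hxn, hyn⟩ := ((S.eventually_mem x).and (S.eventually_mem y)).exists
  let I : LieIdeal K (S.F n) :=
    { (S.nilPos ⊔ (LieAlgebra.center K g).toSubmodule).comap (S.F n).toSubmodule.subtype with
      lie_mem := fun {z m} hm => by
        obtain ⟨a, ha, b, hb, hab⟩ := Submodule.mem_sup.1 hm
        change ⁅(z : g), (m : g)⁆ ∈ S.nilPos ⊔ (LieAlgebra.center K g).toSubmodule
        rw [show (m : g) = a + b from hab.symm, lie_add, mem_center_iff'.1 hb, add_zero]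
        exact hD.mem_nilStab z a ha }
  have := S.F_findim n
  have hI := (S.weaklyReductive n).le_center I fun u hu v hv => Subtype.ext (hab u hu v hv)
  have hxI : (⟨x, hxn⟩ : S.F n) ∈ I := Submodule.mem_sup_left (T := (LieAlgebra.center K g).toSubmodule) hx
  exact congrArg Subtype.val (mem_center_iff'.1 (hI hxI) ⟨y, hyn⟩)

theorem IsDynkin.exists_triple (hD : S.IsDynkin) {γ : Module.Dual K S.h} (hγ : γ ∈ S.pos) :
    ∃ x y, S.RealTriple γ x y := by
  obtain ⟨x, hx, hx0⟩ := Submodule.exists_mem_ne_zero_of_ne_bot (S.pos_root γ hγ).2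
  rcases mem_nilIdeal_or_exists_triple (S.pos_root γ hγ).1 hx with h | ⟨y, h⟩
  · exact absurd (hD.nilPos_eq_bot ⟨h, W_le_nplus hγ hx⟩) hx0
  · exact ⟨x, y, h⟩

lemma RealTriple.simple_nonpos {α β : Module.Dual K S.h} {e f : g} (h : S.RealTriple α e f)
    (hα : S.IsSimpleRoot α) (hβ : S.IsSimpleRoot β) (hne : β ≠ α) :
    ∃ m : ℕ, β ⟨_, h.lie_mem⟩ = -m := by
  obtain ⟨x, hx, hx0⟩ := Submodule.exists_mem_ne_zero_of_ne_bot (S.pos_root β hβ.1).2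
  obtain ⟨k, hxk, hek, hfk⟩ := ((S.eventually_mem x).and
    ((S.eventually_mem e).and (S.eventually_mem f))).exists
  have := S.F_findim k
  have htk : IsTriple K (⟨e, hek⟩ : S.F k) ⟨f, hfk⟩ :=
    ⟨Subtype.ext h.triple.1, Subtype.ext h.triple.2⟩
  refine (htk.sl2Ops (V := S.F k)).lowest_nat (v := ⟨x, hxk⟩)
    (fun h0 => hx0 (congrArg Subtype.val h0)) (Subtype.ext (hx ⟨_, h.lie_mem⟩)) (Subtype.ext ?_)
  change ⁅f, x⁆ = 0
  by_contra h0
  have hfx := lie_mem_adWeightSpace h.y_mem hx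
  rw [neg_add_eq_sub] at hfx
  exact not_isRootOf_sub hα hβ (isRootOf_of_mem (sub_ne_zero.2 hne) hfx h0)

lemma IsDynkin.eq_zero_of_disjoint (hD : S.IsDynkin) {s t : Multiset (Module.Dual K S.h)}
    (hs : ∀ α ∈ s, S.IsSimpleRoot α) (ht : ∀ α ∈ t, S.IsSimpleRoot α) (hst : ∀ α ∈ s, α ∉ t)
    (h : s.sum = t.sum) : s = 0 := by
  have hr := fun α (hα : α ∈ s) => hD.exists_triple (hs α hα).1
  choose! e f hef using hr
  refine hD.eq_zero_of_nonpos (fun α hα => (hs α hα).1) e f hef fun α hα => ?_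
  rw [h]
  have hne : ∀ β ∈ t, β ≠ α := fun β hβ h => hst α hα (h ▸ hβ)
  clear h hst
  induction t using Multiset.induction_on with
  | empty => exact ⟨0, by simp⟩
  | cons β t ih =>
    obtain ⟨m, hm⟩ := ih (fun α hα => ht α (Multiset.mem_cons_of_mem hα))
      (fun β hβ => hne β (Multiset.mem_cons_of_mem hβ))
    obtain ⟨n, hn⟩ := (hef α hα).simple_nonpos (hs α hα) (ht β (Multiset.mem_cons_self _ _))
      (hne β (Multiset.mem_cons_self _ _))
    refine ⟨n + m, ?_⟩
    rw [Multiset.sum_cons, LinearMap.add_apply, hn, hm]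
    push_cast
    ring

lemma IsDynkin.eq_of_sum_eq (hD : S.IsDynkin) {s t : Multiset (Module.Dual K S.h)}
    (hs : ∀ α ∈ s, S.IsSimpleRoot α) (ht : ∀ α ∈ t, S.IsSimpleRoot α) (h : s.sum = t.sum) : s = t := by
  classical
  have hd : (s - t).sum = (t - s).sum := by
    have h1 := congrArg Multiset.sum (Multiset.sub_add_inter s t)
    have h2 := congrArg Multiset.sum (Multiset.sub_add_inter t s)
    rw [Multiset.sum_add] at h1 h2
    rw [Multiset.inter_comm, ← h, ← h1] at h2
    exact (add_right_cancel h2).symm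
  have hdisj : ∀ α ∈ s - t, α ∉ t - s := by
    intro α h1 h2
    rw [← Multiset.one_le_count_iff_mem, Multiset.count_sub] at h1 h2
    omega
  have hs' : ∀ α ∈ s - t, S.IsSimpleRoot α := fun α hα =>
    hs α (Multiset.mem_of_le (Multiset.sub_le_self s t) hα)
  have ht' : ∀ α ∈ t - s, S.IsSimpleRoot α := fun α hα =>
    ht α (Multiset.mem_of_le (Multiset.sub_le_self t s) hα)
  exact le_antisymm (tsub_eq_zero_iff_le.1 (hD.eq_zero_of_disjoint hs' ht' hdisj hd))
    (tsub_eq_zero_iff_le.1 (hD.eq_zero_of_disjoint ht' hs' (fun α h1 h2 => hdisj α h2 h1) hd.symm))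

theorem IsDynkin.finite_Icc (hD : S.IsDynkin) (lam nu : Module.Dual K S.h) :
    {ξ | S.wle lam ξ ∧ S.wle ξ nu}.Finite := by
  classical
  by_cases hex : ∃ u : Multiset (Module.Dual K S.h), (∀ α ∈ u, S.IsSimpleRoot α) ∧ nu - lam = u.sum
  · obtain ⟨u, hu, huν⟩ := hex
    refine ((Set.finite_Iic u).image fun s => lam + s.sum).subset ?_
    rintro ξ ⟨⟨s, hs, h1⟩, ⟨t, ht, h2⟩⟩
    obtain ⟨s', hs', hss, -⟩ := hD.exists_simple_multiset s hs
    obtain ⟨t', ht', htt, -⟩ := hD.exists_simple_multiset t ht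
    have : s' + t' = u := hD.eq_of_sum_eq (fun α hα => (Multiset.mem_add.1 hα).elim (hs' α) (ht' α))
      hu (by rw [Multiset.sum_add, hss, htt, ← h1, ← h2, ← huν]; abel)
    refine ⟨s', this ▸ Multiset.le_add_right s' t', ?_⟩
    change lam + s'.sum = ξ
    rw [hss, ← h1]
    abel
  · refine Set.finite_empty.subset ?_
    rintro ξ ⟨⟨s, hs, h1⟩, ⟨t, ht, h2⟩⟩
    obtain ⟨u, hu, huu, -⟩ := hD.exists_simple_multiset (s + t)
      fun α hα => (Multiset.mem_add.1 hα).elim (hs α) (ht α)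
    exact hex ⟨u, hu, by rw [huu, Multiset.sum_add, ← h1, ← h2]; abel⟩

lemma wle_refl (lam : Module.Dual K S.h) : S.wle lam lam := ⟨0, by simp, by simp⟩

lemma wle_trans {a b c : Module.Dual K S.h} (h1 : S.wle a b) (h2 : S.wle b c) : S.wle a c := by
  obtain ⟨s, hs, h1⟩ := h1
  obtain ⟨t, ht, h2⟩ := h2
  exact ⟨s + t, fun α hα => (Multiset.mem_add.1 hα).elim (hs α) (ht α), by
    rw [Multiset.sum_add, ← h1, ← h2]; abel⟩

theorem IsDynkin.wle_antisymm (hD : S.IsDynkin) {a b : Module.Dual K S.h} (h1 : S.wle a b)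
    (h2 : S.wle b a) : a = b := by
  obtain ⟨s, hs, h1⟩ := h1
  obtain ⟨t, ht, h2⟩ := h2
  have h := hD.eq_zero_of_sum_eq_zero (s := s + t)
    (fun α hα => (Multiset.mem_add.1 hα).elim (hs α) (ht α))
    (by rw [Multiset.sum_add, ← h1, ← h2]; abel)
  rw [add_eq_zero] at h
  rw [h.1, Multiset.sum_zero, sub_eq_zero] at h1
  exact h1.symm

end NilpotentIdeal
end Setup

section EnvelopingAction

attribute [local instance] LieRing.ofAssociativeRing

variable {K : Type} [Field K] {g : Type} [LieRing g] [LieAlgebra K g]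

open UniversalEnvelopingAlgebra in
lemma env_smul_mem {X : Type*} [AddCommGroup X] [Module K X] [Module (Env K g) X]
    [IsScalarTower K (Env K g) X] (Y : Submodule K X) (hY : ∀ x : g, ∀ m ∈ Y, ι K x • m ∈ Y)
    (u : Env K g) {m : X} (hm : m ∈ Y) : u • m ∈ Y := by
  let T : Subalgebra K (Env K g) :=
    { carrier := {u | ∀ m ∈ Y, u • m ∈ Y}
      mul_mem' := fun {a b} ha hb m hm => by rw [mul_smul]; exact ha _ (hb m hm)
      add_mem' := fun {a b} ha hb m hm => by rw [add_smul]; exact add_mem (ha m hm) (hb m hm)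
      algebraMap_mem' := fun c m hm => by rw [algebraMap_smul]; exact Y.smul_mem c hm }
  let j : g →ₗ⁅K⁆ T :=
    { toFun := fun x => ⟨ι K x, hY x⟩
      map_add' := fun x y => Subtype.ext (map_add (ι K) x y)
      map_smul' := fun c x => Subtype.ext (map_smul (ι K) c x)
      map_lie' := fun {x y} => Subtype.ext (LieHom.map_lie (ι K) x y) }
  have h : T.val.comp (lift K j) = AlgHom.id K (Env K g) := by
    refine UniversalEnvelopingAlgebra.hom_ext K (LieHom.ext fun x => ?_)
    change ((lift K j (ι K x) : T) : Env K g) = ι K x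
    rw [lift_ι_apply]
    rfl
  have h1 : ((lift K j u : T) : Env K g) = u := DFunLike.congr_fun h u
  rw [← h1]
  exact (lift K j u).2 m hm

/-- The action of the Lie algebra on a module over its enveloping algebra. -/
def envAct (K : Type) [Field K] (g : Type) [LieRing g] [LieAlgebra K g] (X : Type*) [AddCommGroup X]
    [Module K X] [Module (Env K g) X] [IsScalarTower K (Env K g) X] : g →ₗ[K] Module.End K X :=
  (Algebra.lsmul K K X).toLinearMap ∘ₗ (UniversalEnvelopingAlgebra.ι K : g →ₗ⁅K⁆ Env K g).toLinearMap

variable {X : Type*} [AddCommGroup X] [Module K X] [Module (Env K g) X] [IsScalarTower K (Env K g) X]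

lemma envAct_apply (x : g) (m : X) :
    envAct K g X x m = UniversalEnvelopingAlgebra.ι K x • m := rfl

lemma envAct_lie (x y : g) (m : X) :
    envAct K g X ⁅x, y⁆ m = envAct K g X x (envAct K g X y m) - envAct K g X y (envAct K g X x m) := by
  simp only [envAct_apply]
  rw [LieHom.map_lie, LieRing.of_associative_ring_bracket, sub_smul, mul_smul, mul_smul]

end EnvelopingAction

namespace Setup
section Weights

variable {K : Type} [Field K] [IsAlgClosed K] [CharZero K]
variable {g : Type} [LieRing g] [LieAlgebra K g]
variable {S : Setup K g}
variable {M : Type} [AddCommGroup M] [Module K M] [Module (Env K g) M] [IsScalarTower K (Env K g) M]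

lemma envAct_mem_wtSpace {S : Setup K g} {α μ : Module.Dual K S.h} {x : g} (hx : x ∈ S.W α) {m : M}
    (hm : m ∈ S.wtSpace M μ) : envAct K g M x m ∈ S.wtSpace M (μ + α) := by
  intro H
  have h1 := envAct_lie (K := K) (H : g) x m
  have h2 : ⁅(H : g), x⁆ = α H • x := hx H
  have h3 : envAct K g M (H : g) m = μ H • m := hm H
  rw [h2, h3, map_smul, map_smul, LinearMap.smul_apply, eq_sub_iff_add_eq] at h1
  change envAct K g M (H : g) (envAct K g M x m) = _
  rw [LinearMap.add_apply, add_smul, ← h1]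
  abel

/-- The span of the weight spaces with weights in `D`. -/
def wtSum (S : Setup K g) (M : Type) [AddCommGroup M] [Module K M] [Module (Env K g) M]
    [IsScalarTower K (Env K g) M] (D : Set (Module.Dual K S.h)) : Submodule K M :=
  ⨆ μ : D, S.wtSpace M μ

lemma wtSpace_le_wtSum {D : Set (Module.Dual K S.h)} {μ : Module.Dual K S.h} (h : μ ∈ D) :
    S.wtSpace M μ ≤ S.wtSum M D := le_iSup (fun μ : D => S.wtSpace M (μ : Module.Dual K S.h)) ⟨μ, h⟩

lemma envAct_mem_wtSum {D : Set (Module.Dual K S.h)} {α : Module.Dual K S.h}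
    (hD : ∀ μ ∈ D, μ + α ∈ D) {x : g} (hx : x ∈ S.W α) {m : M} (hm : m ∈ S.wtSum M D) :
    envAct K g M x m ∈ S.wtSum M D := by
  have h : S.wtSum M D ≤ (S.wtSum M D).comap (envAct K g M x) := iSup_le fun μ m hm =>
    wtSpace_le_wtSum (hD _ μ.2) (envAct_mem_wtSpace hx hm)
  exact h hm

lemma mem_of_mem_sup_wtSum {p : Submodule K M}
    (hp : ∀ H : S.h, ∀ m ∈ p, envAct K g M (H : g) m ∈ p) {D : Set (Module.Dual K S.h)}
    {μ : Module.Dual K S.h} (hμ : μ ∉ D) {x : M} (hx : x ∈ S.wtSpace M μ)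
    (h : x ∈ p ⊔ S.wtSum M D) : x ∈ p := by
  classical
  obtain ⟨a, ha, d, hd, rfl⟩ := Submodule.mem_sup.1 h
  obtain ⟨f, hf, rfl⟩ := (Submodule.mem_iSup_iff_exists_finsupp _ _).1 hd
  let s : Finset (Option D) := insert none (f.support.map Function.Embedding.some)
  have := mem_of_sum_mem (fun H : S.h => envAct K g M (H : g))
    (c := fun i : Option D => i.elim (μ : S.h → K) fun i => (i : Module.Dual K S.h))
    (by
      rintro (_ | i) (_ | j) hij
      · rfl
      · exact absurd (DFunLike.coe_injective hij) fun h => hμ (h ▸ j.2)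
      · exact absurd (DFunLike.coe_injective hij) fun h => hμ (h ▸ i.2)
      · exact congrArg some (Subtype.ext (DFunLike.coe_injective hij))) p hp s
    (fun i => i.elim (a + f.sum fun _ m => m) fun i => -f i)
    (by
      rintro (_ | i) -
      · exact hx
      · exact neg_mem (hf i))
    (by
      rw [Finset.sum_insert (by simp), Finset.sum_map]
      simpa [Finsupp.sum] using ha) none (Finset.mem_insert_self _ _)
  exact this

lemma restrictScalars_stable (A : Submodule (Env K g) M) (x : g) (m : M)
    (hm : m ∈ A.restrictScalars K) : envAct K g M x m ∈ A.restrictScalars K := A.smul_mem _ hm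

/-- The weights strictly below `ξ`. -/
def below (S : Setup K g) (ξ : Module.Dual K S.h) : Set (Module.Dual K S.h) :=
  {μ | S.wle μ ξ ∧ μ ≠ ξ}

lemma wle_add {α : Module.Dual K S.h} (hα : α ∈ S.pos) (μ : Module.Dual K S.h) :
    S.wle μ (μ + α) := ⟨{α}, by simpa using hα, by simp⟩

lemma wle_sub {α : Module.Dual K S.h} (hα : α ∈ S.pos) (μ : Module.Dual K S.h) :
    S.wle (μ - α) μ := ⟨{α}, by simpa using hα, by simp⟩

lemma IsDynkin.add_neg_mem_below (hD : S.IsDynkin) {α ξ μ : Module.Dual K S.h} (hα : α ∈ S.pos)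
    (hμ : S.wle μ ξ) : μ + -α ∈ S.below ξ := by
  rw [← sub_eq_add_neg]
  refine ⟨wle_trans (wle_sub hα μ) hμ, ?_⟩
  rintro rfl
  have h := hD.wle_antisymm hμ (wle_sub hα μ)
  exact (S.pos_root α hα).1 (sub_eq_self.1 h.symm)

/-- The weight vector `v` is a highest weight vector modulo `A`. -/
structure IsHighest (S : Setup K g) (A : Submodule (Env K g) M) (ξ : Module.Dual K S.h) (v : M) :
    Prop where
  mem : v ∈ S.wtSpace M ξ
  smul_mem : ∀ x ∈ S.nplus, UniversalEnvelopingAlgebra.ι K x • v ∈ A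

lemma exists_neg_add_nonneg (x : g) : ∃ a ∈ (⨆ α : S.pos, S.W (-α : Module.Dual K S.h)),
    ∃ b ∈ S.h.toSubmodule ⊔ S.nplus, x = a + b := by
  have h : (⊤ : Submodule K g) ≤
      (⨆ α : S.pos, S.W (-α : Module.Dual K S.h)) ⊔ (S.h.toSubmodule ⊔ S.nplus) := by
    rw [← S.h_span]
    refine iSup_le fun α x hx => ?_
    by_cases h0 : x = 0
    · rw [h0]; exact zero_mem _
    by_cases hα : α = 0
    · subst hα
      exact Submodule.mem_sup_right (Submodule.mem_sup_left (mem_W_zero.1 hx))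
    rcases mem_pos_or_neg_mem (isRootOf_of_mem hα hx h0) with h | h
    · exact Submodule.mem_sup_right (Submodule.mem_sup_right (W_le_nplus h hx))
    · refine Submodule.mem_sup_left (Submodule.mem_iSup_of_mem ⟨-α, h⟩ ?_)
      rwa [neg_neg]
  obtain ⟨a, ha, b, hb, hab⟩ := Submodule.mem_sup.1 (h (Submodule.mem_top (x := x)))
  exact ⟨a, ha, b, hb, hab.symm⟩

lemma IsHighest.le_sup (hD : S.IsDynkin) {A : Submodule (Env K g) M} {ξ : Module.Dual K S.h} {v : M}
    (h : S.IsHighest A ξ v) : (A ⊔ Submodule.span (Env K g) {v}).restrictScalars K ≤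
      A.restrictScalars K ⊔ K ∙ v ⊔ S.wtSum M (S.below ξ) := by
  obtain ⟨Y, hY, hvY, hAY, hYW⟩ := exists_stable_le (envAct K g M) envAct_lie
    (A := ((⨆ α : S.pos, S.W (-α : Module.Dual K S.h) : Submodule K g) : Set g))
    (B := ((S.h.toSubmodule ⊔ S.nplus : Submodule K g) : Set g)) exists_neg_add_nonneg
    (p := A.restrictScalars K) (restrictScalars_stable A) (v := v) (by
      intro b hb
      obtain ⟨H, hH, x, hx, rfl⟩ := Submodule.mem_sup.1 hb
      refine ⟨ξ ⟨H, hH⟩, ?_⟩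
      have h1 : envAct K g M H v = ξ ⟨H, hH⟩ • v := h.mem ⟨H, hH⟩
      rw [map_add, LinearMap.add_apply, h1, add_sub_cancel_left]
      exact h.smul_mem x hx)
    (W := A.restrictScalars K ⊔ K ∙ v ⊔ S.wtSum M (S.below ξ)) (le_sup_left.trans le_sup_left)
    (Submodule.mem_sup_left (Submodule.mem_sup_right (Submodule.mem_span_singleton_self v))) (by
      intro a ha w hw
      have key : (⨆ α : S.pos, S.W (-α : Module.Dual K S.h)) ≤
          (A.restrictScalars K ⊔ K ∙ v ⊔ S.wtSum M (S.below ξ)).comap ((envAct K g M).flip w) := by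
        refine iSup_le fun α x hx => ?_
        change envAct K g M x w ∈ A.restrictScalars K ⊔ K ∙ v ⊔ S.wtSum M (S.below ξ)
        obtain ⟨w', hw', d, hd, rfl⟩ := Submodule.mem_sup.1 hw
        obtain ⟨c, hc, u, hu, rfl⟩ := Submodule.mem_sup.1 hw'
        obtain ⟨t, rfl⟩ := Submodule.mem_span_singleton.1 hu
        rw [map_add, map_add]
        refine add_mem (add_mem (Submodule.mem_sup_left (Submodule.mem_sup_left
          (restrictScalars_stable A x c hc))) (Submodule.mem_sup_right ?_))
          (Submodule.mem_sup_right ?_)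
        · rw [map_smul]
          exact Submodule.smul_mem _ _ (wtSpace_le_wtSum (hD.add_neg_mem_below α.2 (wle_refl ξ))
            (envAct_mem_wtSpace hx h.mem))
        · exact envAct_mem_wtSum (fun μ hμ => hD.add_neg_mem_below α.2 hμ.1) hx hd
      exact key ha)
  let Y' : Submodule (Env K g) M :=
    { Y with smul_mem' := fun u m hm => env_smul_mem Y hY u hm }
  have h1 : A ⊔ Submodule.span (Env K g) {v} ≤ Y' :=
    sup_le (fun m hm => hAY hm) (Submodule.span_le.2 (by simpa using (show v ∈ Y' from hvY)))
  exact fun m hm => hYW (h1 hm)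

lemma IsHighest.le_sup_of_notMem (hD : S.IsDynkin) {A C : Submodule (Env K g) M}
    {ξ : Module.Dual K S.h} {v : M} (h : S.IsHighest A ξ v) (hAC : A ≤ C)
    (hCB : C ≤ A ⊔ Submodule.span (Env K g) {v}) (hv : v ∉ C) :
    C.restrictScalars K ≤ A.restrictScalars K ⊔ S.wtSum M (S.below ξ) := by
  intro m hm
  obtain ⟨w, hw, d, hd, rfl⟩ := Submodule.mem_sup.1 (h.le_sup hD (hCB hm))
  obtain ⟨a, ha, u, hu, rfl⟩ := Submodule.mem_sup.1 hw
  obtain ⟨t, rfl⟩ := Submodule.mem_span_singleton.1 hu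
  have h1 : t • v ∈ C.restrictScalars K := by
    refine mem_of_mem_sup_wtSum (fun H => restrictScalars_stable C (H : g))
      (D := S.below ξ) (μ := ξ) (fun h => h.2 rfl) (Submodule.smul_mem _ _ h.mem) ?_
    have h2 : t • v = (a + t • v + d - a) + -d := by abel
    rw [h2]
    exact Submodule.add_mem_sup (sub_mem hm (hAC ha)) (neg_mem hd)
  have ht : t = 0 := by
    by_contra ht
    exact hv (((C.restrictScalars K).smul_mem_iff ht).1 h1)
  rw [ht, zero_smul, add_zero]
  exact Submodule.add_mem_sup ha hd

end Weights
end Setup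

namespace Setup
section Simple

variable {K : Type} [Field K] [IsAlgClosed K] [CharZero K]
variable {g : Type} [LieRing g] [LieAlgebra K g]
variable {S : Setup K g}
variable {M : Type} [AddCommGroup M] [Module K M] [Module (Env K g) M] [IsScalarTower K (Env K g) M]

lemma sSup_restrictScalars_le {T : Set (Submodule (Env K g) M)} {W : Submodule K M}
    (h : ∀ C ∈ T, C.restrictScalars K ≤ W) : (sSup T).restrictScalars K ≤ W := by
  intro x hx
  rw [Submodule.restrictScalars_mem, sSup_eq_iSup'] at hx
  exact Submodule.iSup_induction _ (motive := (· ∈ W)) hx (fun C x hx => h C C.2 hx) W.zero_mem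
    fun _ _ => W.add_mem

lemma isHighest_mk (ξ : Module.Dual K S.h) :
    S.IsHighest (⊥ : Submodule (Env K g) (S.Verma ξ)) ξ (Submodule.Quotient.mk 1) where
  mem H := by
    rw [← Submodule.Quotient.mk_smul, ← sub_eq_zero, ← algebraMap_smul (Env K g) (ξ H),
      ← Submodule.Quotient.mk_smul, ← Submodule.Quotient.mk_sub, Submodule.Quotient.mk_eq_zero,
      smul_eq_mul, smul_eq_mul, mul_one, mul_one]
    exact Submodule.subset_span (Or.inr ⟨H, rfl⟩)
  smul_mem x hx := by
    rw [Submodule.mem_bot, ← Submodule.Quotient.mk_smul, Submodule.Quotient.mk_eq_zero, smul_eq_mul,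
      mul_one]
    exact Submodule.subset_span (Or.inl ⟨x, hx, rfl⟩)

lemma span_mk_one (ξ : Module.Dual K S.h) :
    Submodule.span (Env K g) {(Submodule.Quotient.mk 1 : S.Verma ξ)} = ⊤ := by
  rw [eq_top_iff]
  rintro x -
  obtain ⟨u, rfl⟩ := Submodule.Quotient.mk_surjective _ x
  exact Submodule.mem_span_singleton.2 ⟨u, by rw [← Submodule.Quotient.mk_smul, smul_eq_mul, mul_one]⟩

lemma IsDynkin.mk_one_notMem_maxSub (hD : S.IsDynkin) {ξ : Module.Dual K S.h}
    (h0 : (Submodule.Quotient.mk 1 : S.Verma ξ) ≠ 0) :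
    (Submodule.Quotient.mk 1 : S.Verma ξ) ∉ S.maxSub ξ := by
  have key : ∀ N : Submodule (Env K g) (S.Verma ξ), N ≠ ⊤ →
      N.restrictScalars K ≤ S.wtSum (S.Verma ξ) (S.below ξ) := by
    intro N hN
    have h := (isHighest_mk ξ).le_sup_of_notMem hD (bot_le (a := N))
      (by rw [span_mk_one, sup_top_eq]; exact le_top) fun h => hN (eq_top_iff.2 (by
        rw [← span_mk_one]
        exact Submodule.span_le.2 (by simpa using h)))
    simpa using h
  intro hmem
  have h : (S.maxSub ξ).restrictScalars K ≤ S.wtSum (S.Verma ξ) (S.below ξ) :=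
    sSup_restrictScalars_le key
  refine h0 (mem_of_mem_sup_wtSum (p := ⊥) (fun H m hm => ?_) (μ := ξ) (fun h => h.2 rfl)
    (isHighest_mk ξ).mem (Submodule.mem_sup_right (h hmem)))
  rw [Submodule.mem_bot] at hm ⊢
  rw [hm, map_zero]

/-- A module generated by a highest weight vector contained in every nonzero submodule is simple
of that highest weight. -/
lemma IsDynkin.nonempty_equiv (hD : S.IsDynkin) {Q : Type} [AddCommGroup Q] [Module K Q]
    [Module (Env K g) Q] [IsScalarTower K (Env K g) Q] {ξ : Module.Dual K S.h} {v : Q}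
    (hv : S.IsHighest ⊥ ξ v) (hv0 : v ≠ 0) (hspan : Submodule.span (Env K g) {v} = ⊤)
    (hsimple : ∀ P : Submodule (Env K g) Q, v ∉ P → P = ⊥) :
    Nonempty (Q ≃ₗ[Env K g] S.SimpleL ξ) := by
  let φ : S.Verma ξ →ₗ[Env K g] Q :=
    (S.vermaIdeal ξ).liftQ (LinearMap.toSpanSingleton (Env K g) Q v) (by
      refine Submodule.span_le.2 ?_
      rintro _ (⟨x, hx, rfl⟩ | ⟨H, rfl⟩)
      · exact (Submodule.mem_bot _).1 (hv.smul_mem x hx)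
      · change (UniversalEnvelopingAlgebra.ι K (H : g) - algebraMap K (Env K g) (ξ H)) • v = 0
        rw [sub_smul, algebraMap_smul, sub_eq_zero]
        exact hv.mem H)
  have hφ1 : φ (Submodule.Quotient.mk 1) = v := one_smul (Env K g) v
  have hsurj : Function.Surjective φ := by
    rw [← LinearMap.range_eq_top, eq_top_iff, ← hspan]
    exact Submodule.span_le.2 (by simpa using ⟨_, hφ1⟩)
  have hne : (Submodule.Quotient.mk 1 : S.Verma ξ) ≠ 0 := fun h => hv0 (by rw [← hφ1, h, map_zero])
  have hker : LinearMap.ker φ ≤ S.maxSub ξ := le_sSup fun h => hv0 (by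
    rw [← hφ1]
    exact LinearMap.mem_ker.1 (h ▸ Submodule.mem_top))
  have hmap : (S.maxSub ξ).map φ = ⊥ := hsimple _ (by
    rintro ⟨n, hn, hnv⟩
    refine hD.mk_one_notMem_maxSub hne ?_
    have h1 : Submodule.Quotient.mk 1 - n ∈ LinearMap.ker φ := by
      rw [LinearMap.mem_ker, map_sub, hφ1, hnv, sub_self]
    exact (Submodule.sub_mem_iff_left _ hn).1 (hker h1))
  have heq : LinearMap.ker φ = S.maxSub ξ :=
    le_antisymm hker (LinearMap.le_ker_iff_map.2 hmap)
  exact ⟨((Submodule.quotEquivOfEq _ _ heq).symm.trans (φ.quotKerEquivOfSurjective hsurj)).symm⟩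

/-- A highest weight vector modulo `A` produces a simple subquotient, and the weights of what remains
are strictly smaller. -/
theorem IsHighest.exists_simple (hD : S.IsDynkin) {A : Submodule (Env K g) M}
    {ξ : Module.Dual K S.h} {v : M} (h : S.IsHighest A ξ v) (hv : v ∉ A) :
    ∃ C : Submodule (Env K g) M, A ≤ C ∧ C ≤ A ⊔ Submodule.span (Env K g) {v} ∧
      (∀ μ, ¬ S.wtSpace M μ ⊓ C.restrictScalars K ≤ A.restrictScalars K → μ ∈ S.below ξ) ∧
      Nonempty (subQuot C (A ⊔ Submodule.span (Env K g) {v}) ≃ₗ[Env K g] S.SimpleL ξ) := by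
  set B := A ⊔ Submodule.span (Env K g) {v} with hB
  set T : Set (Submodule (Env K g) M) := {C | A ≤ C ∧ C ≤ B ∧ v ∉ C}
  set C := sSup T
  have hAT : A ∈ T := ⟨le_rfl, le_sup_left, hv⟩
  have hAC : A ≤ C := le_sSup hAT
  have hCB : C ≤ B := sSup_le fun C' hC' => hC'.2.1
  have hCle : C.restrictScalars K ≤ A.restrictScalars K ⊔ S.wtSum M (S.below ξ) :=
    sSup_restrictScalars_le fun C' hC' => h.le_sup_of_notMem hD hC'.1 hC'.2.1 hC'.2.2
  have hbelow : ∀ μ, ¬ S.wtSpace M μ ⊓ C.restrictScalars K ≤ A.restrictScalars K → μ ∈ S.below ξ := by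
    intro μ hμ
    by_contra hn
    exact hμ fun x hx => mem_of_mem_sup_wtSum (fun H => restrictScalars_stable A (H : g)) hn hx.1
      (hCle hx.2)
  have hvC : v ∉ C := fun hvC => hv (mem_of_mem_sup_wtSum
    (fun H => restrictScalars_stable A (H : g)) (fun h => h.2 rfl : ξ ∉ S.below ξ) h.mem (hCle hvC))
  refine ⟨C, hAC, hCB, hbelow, ?_⟩
  have hvB : v ∈ B := Submodule.mem_sup_right (Submodule.mem_span_singleton_self v)
  refine hD.nonempty_equiv (v := Submodule.Quotient.mk ⟨v, hvB⟩) ⟨fun H => ?_, fun x hx => ?_⟩ ?_ ?_ ?_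
  · exact congrArg (Submodule.Quotient.mk (p := C.comap B.subtype))
      (Subtype.ext (h.mem H) : (UniversalEnvelopingAlgebra.ι K (H : g) • (⟨v, hvB⟩ : B)) = ξ H • ⟨v, hvB⟩)
  · rw [Submodule.mem_bot, ← Submodule.Quotient.mk_smul, Submodule.Quotient.mk_eq_zero]
    exact hAC (h.smul_mem x hx)
  · rw [Ne, Submodule.Quotient.mk_eq_zero]
    exact hvC
  · rw [eq_top_iff]
    rintro y -
    obtain ⟨⟨b, hb⟩, rfl⟩ := Submodule.Quotient.mk_surjective _ y
    obtain ⟨a, ha, w, hw, rfl⟩ := Submodule.mem_sup.1 hb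
    obtain ⟨u, rfl⟩ := Submodule.mem_span_singleton.1 hw
    refine Submodule.mem_span_singleton.2 ⟨u, ?_⟩
    rw [← Submodule.Quotient.mk_smul, Submodule.Quotient.eq]
    change u • v - (a + u • v) ∈ C
    rw [sub_add_cancel_right]
    exact neg_mem (hAC ha)
  · intro P hP
    let P' := (P.comap (C.comap B.subtype).mkQ).map B.subtype
    have hP' : P' ∈ T := by
      refine ⟨fun a ha => ⟨⟨a, le_sup_left (a := A) ha⟩, ?_, rfl⟩, Submodule.map_subtype_le _ _, ?_⟩
      · change (C.comap B.subtype).mkQ _ ∈ P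
        have : (C.comap B.subtype).mkQ ⟨a, le_sup_left (a := A) ha⟩ = 0 :=
          (Submodule.Quotient.mk_eq_zero _).2 (hAC ha)
        rw [this]
        exact zero_mem _
      · rintro ⟨w, hw, hwv⟩
        refine hP ?_
        rw [← show w = ⟨v, hvB⟩ from Subtype.ext hwv]
        exact hw
    rw [eq_bot_iff]
    intro y hy
    obtain ⟨b, rfl⟩ := Submodule.Quotient.mk_surjective _ y
    rw [Submodule.mem_bot, Submodule.Quotient.mk_eq_zero]
    exact (le_sSup hP' : P' ≤ C) ⟨b, hy, rfl⟩

end Simple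
end Setup

namespace Setup
section Chain

variable {K : Type} [Field K] [IsAlgClosed K] [CharZero K]
variable {g : Type} [LieRing g] [LieAlgebra K g]
variable {S : Setup K g}
variable {M : Type} [AddCommGroup M] [Module K M] [Module (Env K g) M] [IsScalarTower K (Env K g) M]

/-- One step of a composition series with bounds. -/
def IsStep (S : Setup K g) (lam nu : Module.Dual K S.h) (A B : Submodule (Env K g) M) : Prop :=
  A ≤ B ∧ ((∃ ξ, S.wle lam ξ ∧ Nonempty (subQuot A B ≃ₗ[Env K g] S.SimpleL ξ)) ∨
    ∀ μ, S.wle lam μ → S.wle μ nu → S.wtSpace (subQuot A B) μ = ⊥)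

lemma exists_seq_of_reflTransGen {α : Type*} {r : α → α → Prop} {a b : α}
    (h : Relation.ReflTransGen r a b) :
    ∃ (k : ℕ) (c : ℕ → α), c 0 = a ∧ c k = b ∧ ∀ i < k, r (c i) (c (i + 1)) := by
  induction h with
  | refl => exact ⟨0, fun _ => a, rfl, rfl, by simp⟩
  | @tail x y _ hxy ih =>
    obtain ⟨k, c, h0, hk, hc⟩ := ih
    refine ⟨k + 1, fun i => if i ≤ k then c i else y, by simpa using h0, by simp, fun i hi => ?_⟩
    rcases Nat.lt_succ_iff_lt_or_eq.1 hi with h | rfl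
    · simpa [h.le, Nat.succ_le_of_lt h] using hc i h
    · simpa [hk] using hxy

lemma nonempty_compSeries {lam nu : Module.Dual K S.h} (hln : S.wle lam nu)
    (h : Relation.ReflTransGen (S.IsStep lam nu) (⊥ : Submodule (Env K g) M) ⊤) :
    Nonempty (S.CompSeries lam nu M) := by
  classical
  obtain ⟨k, c, h0, hk, hc⟩ := exists_seq_of_reflTransGen h
  exact ⟨{
    k := k
    c := fun i => c i
    mono := Fin.monotone_iff_le_succ.2 fun i => (hc i i.2).1
    bot := h0
    top := hk
    J := Finset.univ.filter fun j : Fin k => ∃ ξ, S.wle lam ξ ∧ S.wle ξ nu ∧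
      Nonempty (subQuot (c j.castSucc) (c j.succ) ≃ₗ[Env K g] S.SimpleL ξ)
    rel := fun j hj => (Finset.mem_filter.1 hj).2
    irrel := fun j hj => by
      rcases (hc j j.2).2 with ⟨ξ, hξ, e⟩ | hw
      · have hn : ¬ S.wle ξ nu := fun hn =>
          hj (Finset.mem_filter.2 ⟨Finset.mem_univ _, ξ, hξ, hn, e⟩)
        exact Or.inr ⟨ξ, hξ, fun h => hn (h ▸ hln), hn, e⟩
      · exact Or.inl hw }⟩

/-- A submodule is spanned by its weight vectors. -/
lemma InO.le_iSup (hM : S.InO M) {p : Submodule K M}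
    (hp : ∀ H : S.h, ∀ m ∈ p, envAct K g M (H : g) m ∈ p) : p ≤ ⨆ μ, p ⊓ S.wtSpace M μ :=
  le_iSup_inf_jointEig (A := fun H : S.h => envAct K g M (H : g)) (c := fun μ : Module.Dual K S.h => (μ : S.h → K)) DFunLike.coe_injective
    hM.span p hp

lemma InO.wtSpace_subQuot (hM : S.InO M) {A B : Submodule (Env K g) M} {μ : Module.Dual K S.h}
    (h : B.restrictScalars K ⊓ S.wtSpace M μ ≤ A.restrictScalars K) :
    S.wtSpace (subQuot A B) μ = ⊥ := by
  rw [eq_bot_iff]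
  intro y hy
  obtain ⟨⟨b, hb⟩, rfl⟩ := Submodule.Quotient.mk_surjective _ y
  rw [Submodule.mem_bot, Submodule.Quotient.mk_eq_zero]
  change b ∈ A
  have hyA : ∀ H : S.h, envAct K g M (H : g) b - μ H • b ∈ A := by
    intro H
    have h1 := hy H
    rw [← sub_eq_zero] at h1
    have h2 : Submodule.Quotient.mk (p := A.comap B.subtype)
        (UniversalEnvelopingAlgebra.ι K (H : g) • (⟨b, hb⟩ : B) - μ H • (⟨b, hb⟩ : B)) = 0 := h1
    exact (Submodule.Quotient.mk_eq_zero (A.comap B.subtype)).1 h2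
  obtain ⟨f, hf, rfl⟩ := (Submodule.mem_iSup_iff_exists_finsupp _ _).1
    (hM.le_iSup (fun H => restrictScalars_stable B (H : g)) hb)
  refine sum_mem fun i hi => ?_
  by_cases hiμ : i = μ
  · subst hiμ
    exact h (hf i)
  obtain ⟨H, hH⟩ : ∃ H, i H ≠ μ H := by
    by_contra! hcon
    exact hiμ (LinearMap.ext hcon)
  have h2 := mem_of_sum_mem (fun H : S.h => envAct K g M (H : g))
    (c := fun ν : Module.Dual K S.h => (ν : S.h → K)) DFunLike.coe_injective (A.restrictScalars K)
    (fun H => restrictScalars_stable A (H : g)) f.support (fun ν => (ν H - μ H) • f ν)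
    (fun ν _ => Submodule.smul_mem _ _ (hf ν).2) (by
      have h3 := hyA H
      rw [map_finsuppSum, Finsupp.sum, Finsupp.sum, Finset.smul_sum, ← Finset.sum_sub_distrib] at h3
      rwa [Finset.sum_congr rfl fun ν _ => show envAct K g M (H : g) (f ν) - μ H • f ν =
        (ν H - μ H) • f ν by rw [sub_smul, ← (hf ν).2 H]; rfl] at h3) i hi
  exact ((A.restrictScalars K).smul_mem_iff (sub_ne_zero.2 hH)).1 h2

/-- A finite-dimensional space of vectors lies in a finite-dimensional `n⁺`-stable subspace. -/
lemma InO.exists_stable (hM : S.InO M) {E : Submodule K M} (hE : E.FG) :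
    ∃ N : Submodule K M, N.FG ∧ E ≤ N ∧ ∀ x ∈ S.nplus, ∀ m ∈ N, envAct K g M x m ∈ N := by
  induction E, hE using Submodule.fg_induction with
  | singleton v =>
    obtain ⟨N, hN, hv, h⟩ := hM.locFin v
    exact ⟨N, Module.Finite.iff_fg.1 hN, Submodule.span_le.2 (by simpa using hv), h⟩
  | sup E₁ E₂ _ _ h₁ h₂ =>
    obtain ⟨N₁, hf₁, hE₁, hs₁⟩ := h₁
    obtain ⟨N₂, hf₂, hE₂, hs₂⟩ := h₂
    refine ⟨N₁ ⊔ N₂, hf₁.sup hf₂, sup_le_sup hE₁ hE₂, fun x hx m hm => ?_⟩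
    obtain ⟨a, ha, b, hb, rfl⟩ := Submodule.mem_sup.1 hm
    rw [map_add]
    exact Submodule.add_mem_sup (hs₁ x hx a ha) (hs₂ x hx b hb)

/-- The smallest `n⁺`-stable subspace containing `E` is finite-dimensional and `h`-stable. -/
lemma InO.exists_closure (hM : S.InO M) {E : Submodule K M} (hE : E.FG)
    (hEh : ∀ H : S.h, ∀ m ∈ E, envAct K g M (H : g) m ∈ E) :
    ∃ N : Submodule K M, N.FG ∧ E ≤ N ∧ (∀ x ∈ S.nplus, ∀ m ∈ N, envAct K g M x m ∈ N) ∧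
      (∀ H : S.h, ∀ m ∈ N, envAct K g M (H : g) m ∈ N) ∧
      ∀ P : Submodule K M, E ≤ P → (∀ x ∈ S.nplus, ∀ m ∈ P, envAct K g M x m ∈ P) → N ≤ P := by
  obtain ⟨N₀, hf₀, hE₀, hs₀⟩ := hM.exists_stable hE
  set T : Set (Submodule K M) := {P | E ≤ P ∧ ∀ x ∈ S.nplus, ∀ m ∈ P, envAct K g M x m ∈ P}
  have hmin : ∀ P, E ≤ P → (∀ x ∈ S.nplus, ∀ m ∈ P, envAct K g M x m ∈ P) → sInf T ≤ P :=
    fun P h1 h2 => sInf_le ⟨h1, h2⟩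
  have hET : E ≤ sInf T := le_sInf fun P hP => hP.1
  have hsT : ∀ x ∈ S.nplus, ∀ m ∈ sInf T, envAct K g M x m ∈ sInf T := by
    intro x hx m hm
    rw [Submodule.mem_sInf] at hm ⊢
    exact fun P hP => hP.2 x hx m (hm P hP)
  refine ⟨sInf T, ?_, hET, hsT, fun H => ?_, hmin⟩
  · have := Module.Finite.iff_fg.2 hf₀
    exact Module.Finite.iff_fg.1 (Submodule.finiteDimensional_of_le (hmin N₀ hE₀ hs₀))
  · have h1 := hmin (sInf T ⊓ (sInf T).comap (envAct K g M (H : g)))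
      (le_inf hET fun m hm => hET (hEh H m hm)) (fun x hx m hm => ⟨hsT x hx m hm.1, by
        have h2 := envAct_lie (K := K) (H : g) x m
        rw [eq_sub_iff_add_eq] at h2
        change envAct K g M (H : g) (envAct K g M x m) ∈ sInf T
        rw [← h2]
        exact add_mem (hsT _ (lie_h_nplus H.2 hx) m hm.1) (hsT x hx _ hm.2)⟩)
    exact fun m hm => (h1 hm).2

/-- A finite-dimensional `b`-stable space not contained in `A` contains a highest weight vector
modulo `A`. -/
lemma IsDynkin.exists_isHighest (hD : S.IsDynkin) (hM : S.InO M) {N : Submodule K M} (hN : N.FG)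
    (hNn : ∀ x ∈ S.nplus, ∀ m ∈ N, envAct K g M x m ∈ N)
    (hNh : ∀ H : S.h, ∀ m ∈ N, envAct K g M (H : g) m ∈ N) {A : Submodule (Env K g) M}
    (hNA : ¬ N ≤ A.restrictScalars K) :
    ∃ μ, ∃ v ∈ N, v ∉ A ∧ S.IsHighest A μ v := by
  classical
  obtain ⟨F, hF⟩ := CompleteLattice.IsCompactElement.exists_finset_of_le_iSup _
    ((Submodule.fg_iff_compact N).1 hN) _ (show N ≤ ⨆ μ, S.wtSpace M μ from hM.span ▸ le_top)
  have hF' : N ≤ ⊥ ⊔ S.wtSum M F := hF.trans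
    (iSup₂_le fun μ hμ => (wtSpace_le_wtSum hμ).trans le_sup_right)
  set T : Set (Module.Dual K S.h) := {μ | ¬ N ⊓ S.wtSpace M μ ≤ A.restrictScalars K}
  have hTF : T ⊆ F := by
    intro μ hμ
    by_contra hn
    refine hμ fun x hx => ?_
    have h0 := mem_of_mem_sup_wtSum (p := ⊥) (fun H m hm => by
      rw [Submodule.mem_bot] at hm ⊢
      rw [hm, map_zero]) hn hx.2 (hF' hx.1)
    rw [(Submodule.mem_bot K).1 h0]
    exact zero_mem _
  have hT : T.Finite := F.finite_toSet.subset hTF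
  have hTne : T.Nonempty := by
    by_contra! hcon
    refine hNA ((hM.le_iSup hNh).trans (iSup_le fun μ => ?_))
    by_contra hμ
    exact (hcon ▸ (show μ ∈ T from hμ) : μ ∈ (∅ : Set _))
  obtain ⟨μ, hμ, hmin⟩ := Set.exists_min_image T (fun μ => {η ∈ T | S.wle μ η}.ncard) hT hTne
  obtain ⟨v, hv, hvA⟩ := SetLike.not_le_iff_exists.1 hμ
  refine ⟨μ, v, hv.1, hvA, hv.2, fun x hx => ?_⟩
  have key : S.nplus ≤ (A.restrictScalars K).comap ((envAct K g M).flip v) := by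
    refine iSup₂_le fun α hα x hx => ?_
    change envAct K g M x v ∈ A.restrictScalars K
    by_contra hxA
    have hαT : μ + α ∈ T := fun h =>
      hxA (h ⟨hNn x (W_le_nplus hα hx) v hv.1, envAct_mem_wtSpace hx hv.2⟩)
    refine absurd (hmin _ hαT) (not_le.2 (Set.ncard_lt_ncard ⟨fun η hη =>
      ⟨hη.1, wle_trans (wle_add hα μ) hη.2⟩, fun h => ?_⟩ (hT.subset fun η hη => hη.1)))
    have h1 := hD.wle_antisymm (wle_add hα μ) (h ⟨hμ, wle_refl μ⟩).2
    exact (S.pos_root α hα).1 (by simpa using h1)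
  exact key hx

/-- The highest weight modules of highest weight `ξ` inside `M` have composition series. -/
def HasSeries (S : Setup K g) (M : Type) [AddCommGroup M] [Module K M] [Module (Env K g) M]
    [IsScalarTower K (Env K g) M] (lam nu ξ : Module.Dual K S.h) : Prop :=
  ∀ (A : Submodule (Env K g) M) (v : M), S.IsHighest A ξ v →
    Relation.ReflTransGen (S.IsStep lam nu) A (A ⊔ Submodule.span (Env K g) {v})

lemma IsDynkin.reflTransGen_sup_span (hD : S.IsDynkin) (hM : S.InO M) {lam nu : Module.Dual K S.h}
    {N : Submodule K M} (hN : N.FG) (hNn : ∀ x ∈ S.nplus, ∀ m ∈ N, envAct K g M x m ∈ N)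
    (hNh : ∀ H : S.h, ∀ m ∈ N, envAct K g M (H : g) m ∈ N) (A : Submodule (Env K g) M)
    (hS : ∀ μ, ¬ N ⊓ S.wtSpace M μ ≤ A.restrictScalars K → S.HasSeries M lam nu μ) :
    Relation.ReflTransGen (S.IsStep lam nu) A (A ⊔ Submodule.span (Env K g) (N : Set M)) := by
  have := Module.Finite.iff_fg.2 hN
  generalize hP : (A.restrictScalars K).comap N.subtype = P
  induction P using WellFoundedGT.induction generalizing A with
  | ind P ih =>
    by_cases hNA : N ≤ A.restrictScalars K
    · rw [sup_eq_left.2 (Submodule.span_le.2 (show (N : Set M) ⊆ A from hNA))]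
    obtain ⟨μ, v, hvN, hvA, hv⟩ := hD.exists_isHighest hM hN hNn hNh hNA
    set A' := A ⊔ Submodule.span (Env K g) {v}
    have hvA' : v ∈ A' := Submodule.mem_sup_right (Submodule.mem_span_singleton_self v)
    have hsup : A' ⊔ Submodule.span (Env K g) (N : Set M) =
        A ⊔ Submodule.span (Env K g) (N : Set M) := by
      rw [sup_assoc, sup_of_le_right (a := Submodule.span (Env K g) {v})
        (Submodule.span_mono (Set.singleton_subset_iff.2 hvN))]
    rw [← hsup]
    refine (hS μ (fun h => hvA (h ⟨hvN, hv.mem⟩)) A v hv).trans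
      (ih _ ?_ A' (fun η hη => hS η fun h => hη (h.trans fun m hm => ?_)) rfl)
    · rw [← hP]
      exact ⟨fun m hm => Submodule.mem_sup_left hm, fun h => hvA (h (x := ⟨v, hvN⟩) hvA')⟩
    · exact Submodule.mem_sup_left hm

lemma IsDynkin.reflTransGen_of_le (hD : S.IsDynkin) (hM : S.InO M) {lam nu : Module.Dual K S.h}
    {A B : Submodule (Env K g) M} (hAB : A ≤ B)
    (hS : ∀ μ, S.wle lam μ → ¬ S.wtSpace M μ ⊓ B.restrictScalars K ≤ A.restrictScalars K →
      S.HasSeries M lam nu μ) :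
    Relation.ReflTransGen (S.IsStep lam nu) A B := by
  set I : Set (Module.Dual K S.h) := {μ | S.wle lam μ ∧ S.wle μ nu}
  have hI : I.Finite := hD.finite_Icc lam nu
  let E : Submodule K M := ⨆ μ : I, B.restrictScalars K ⊓ S.wtSpace M μ
  have hEle : ∀ μ ∈ I, B.restrictScalars K ⊓ S.wtSpace M μ ≤ E := fun μ hμ =>
    le_iSup (fun μ : I => B.restrictScalars K ⊓ S.wtSpace M (μ : Module.Dual K S.h)) ⟨μ, hμ⟩
  have hE : E.FG := by
    have := hI.to_subtype
    refine Submodule.fg_iSup _ fun μ => ?_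
    have := hM.finite μ
    exact Module.Finite.iff_fg.1 (Submodule.finiteDimensional_of_le
      (inf_le_right : B.restrictScalars K ⊓ S.wtSpace M μ ≤ S.wtSpace M μ))
  have hEB : E ≤ B.restrictScalars K := iSup_le fun μ => inf_le_left
  have hEh : ∀ H : S.h, ∀ m ∈ E, envAct K g M (H : g) m ∈ E := by
    intro H
    have h : E ≤ E.comap (envAct K g M (H : g)) := by
      refine iSup_le fun μ m hm => ?_
      change envAct K g M (H : g) m ∈ E
      rw [show envAct K g M (H : g) m = (μ : Module.Dual K S.h) H • m from hm.2 H]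
      exact E.smul_mem _ (hEle μ μ.2 hm)
    exact h
  obtain ⟨N, hN, hEN, hNn, hNh, hNmin⟩ := hM.exists_closure hE hEh
  have hNB : N ≤ B.restrictScalars K := hNmin _ hEB fun x _ => restrictScalars_stable B x
  have hNlam : N ≤ S.wtSum M {μ | S.wle lam μ} := by
    refine hNmin _ (iSup_le fun μ => inf_le_right.trans (wtSpace_le_wtSum μ.2.1)) fun x hx m hm => ?_
    have key : S.nplus ≤ (S.wtSum M {μ | S.wle lam μ}).comap ((envAct K g M).flip m) :=
      iSup₂_le fun α hα x hx =>
        envAct_mem_wtSum (fun μ hμ => wle_trans hμ (wle_add hα μ)) hx hm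
    exact key hx
  have h1 := hD.reflTransGen_sup_span hM (lam := lam) (nu := nu) hN hNn hNh A fun μ hμ => by
    refine hS μ ?_ fun h => hμ fun x hx => h ⟨hx.2, hNB hx.1⟩
    by_contra hn
    refine hμ fun x hx => mem_of_mem_sup_wtSum (fun H => restrictScalars_stable A (H : g))
      (D := {μ | S.wle lam μ}) hn hx.2 (Submodule.mem_sup_right (hNlam hx.1))
  refine h1.tail ⟨sup_le hAB (Submodule.span_le.2 hNB), Or.inr fun μ hμ1 hμ2 =>
    hM.wtSpace_subQuot fun x hx => ?_⟩
  exact Submodule.mem_sup_right (Submodule.subset_span (hEN (hEle μ ⟨hμ1, hμ2⟩ hx)))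

lemma IsDynkin.hasSeries (hD : S.IsDynkin) (hM : S.InO M) {lam nu : Module.Dual K S.h} (n : ℕ) :
    ∀ ξ, S.wle lam ξ → {η | S.wle lam η ∧ S.wle η ξ}.ncard = n → S.HasSeries M lam nu ξ := by
  induction n using Nat.strong_induction_on with
  | _ n ih =>
    intro ξ hξ hn A v hv
    by_cases hvA : v ∈ A
    · rw [sup_eq_left.2 (Submodule.span_le.2 (by simpa using hvA))]
    obtain ⟨C, hAC, hCB, hC, hiso⟩ := hv.exists_simple hD hvA
    refine (hD.reflTransGen_of_le hM hAC fun μ hμ hμC => ih _ ?_ μ hμ rfl).tail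
      ⟨hCB, Or.inl ⟨ξ, hξ, hiso⟩⟩
    obtain ⟨hle, hne⟩ := hC μ hμC
    rw [← hn]
    exact Set.ncard_lt_ncard ⟨fun η hη => ⟨hη.1, wle_trans hη.2 hle⟩,
      fun h => hne (hD.wle_antisymm hle (h ⟨hξ, wle_refl ξ⟩).2)⟩ (hD.finite_Icc lam ξ)

end Chain
end Setup

/-- Every object `M` of `O-bar` has a composition series with bounds
`lam` and `nu`, for any `lam ≼ nu` in `h^*`. -/
theorem exists_compSeries_with_bounds
    (K : Type) [Field K] [IsAlgClosed K] [CharZero K]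
    (g : Type) [LieRing g] [LieAlgebra K g] (S : Setup K g) (hDynkin : S.IsDynkin)
    (M : Type) [AddCommGroup M] [Module K M] [Module (Env K g) M]
    [IsScalarTower K (Env K g) M] (hM : S.InO M)
    (lam nu : Module.Dual K S.h) (hln : S.wle lam nu) :
    Nonempty (S.CompSeries lam nu M) :=
  Setup.nonempty_compSeries hln (hDynkin.reflTransGen_of_le hM bot_le fun μ hμ _ =>
    hDynkin.hasSeries hM _ μ hμ rfl)
end Paper
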